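/- Let p ∈ X be a germ of a smooth n-dimensional variety with local coordinates x_1,…,x_n, D an effective ℚ-divisor on X, and φ: Y → X the weighted blowup at p with weights (c_1,…,c_n), gcd = 1, with exceptional divisor E. Then lct_p(X; D) ≥ min{ (c_1 + ⋯ + c_n)/ord_E(D), lct(E, Diff; D̃|_E) }, where D̃ is the proper transform of D and Diff is the different of the pair (Y, E) on E. Moreover, if (c_1+⋯+c_n)/ord_E(D) ≤ lct(E, Diff; D̃|_E), then equality lct_p(X; D) = (c_1+⋯+c_n)/ord_E(D) holds. -/

import Mathlib

open MeasureTheory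

/-- The weight of a monomial exponent `m` with respect to weights `c`. -/
def wDeg {n : ℕ} (c : Fin n → ℕ) (m : Fin n →₀ ℕ) : ℕ :=
  ∑ i, c i * m i

/-- The weighted order of vanishing at the origin of a polynomial `f` with respect to
weights `c` (the smallest weight of a monomial appearing in `f`). -/
noncomputable def wOrd {n : ℕ} (c : Fin n → ℕ) (f : MvPolynomial (Fin n) ℂ) : ℕ :=
  sInf {k | ∃ m ∈ f.support, wDeg c m = k}

/-- The lowest weight part of `f` with respect to the weights `c`. -/
noncomputable def wLowest {n : ℕ} (c : Fin n → ℕ) (f : MvPolynomial (Fin n) ℂ) :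
    MvPolynomial (Fin n) ℂ :=
  ∑ m ∈ f.support.filter (fun m => wDeg c m = wOrd c f),
    MvPolynomial.monomial m (MvPolynomial.coeff m f)

namespace OT
set_option linter.all false
set_option linter.unusedSectionVars false
set_option linter.unusedSimpArgs false
set_option linter.unusedVariables false
set_option linter.unusedDecidableInType false
open scoped ContDiff ComplexConjugate
open Complex (I)

variable {ι : Type} [Fintype ι] [DecidableEq ι]

/-- Wirtinger derivative. -/
noncomputable def dz (j : ι) (f : (ι → ℂ) → ℂ) (x : ι → ℂ) : ℂ :=
  (fderiv ℝ f x (Pi.single j 1) - I * fderiv ℝ f x (Pi.single j I)) / 2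

/-- Conjugate Wirtinger derivative. -/
noncomputable def db (j : ι) (f : (ι → ℂ) → ℂ) (x : ι → ℂ) : ℂ :=
  (fderiv ℝ f x (Pi.single j 1) + I * fderiv ℝ f x (Pi.single j I)) / 2

/-- Smoothness. -/
def Sm (f : (ι → ℂ) → ℂ) : Prop := ContDiff ℝ ∞ f

lemma Sm.diff {f : (ι → ℂ) → ℂ} (hf : Sm f) (x) : DifferentiableAt ℝ f x :=
  (ContDiff.differentiable hf (by simp)) x

lemma Sm.cont {f : (ι → ℂ) → ℂ} (hf : Sm f) : Continuous f := ContDiff.continuous hf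

lemma Sm.fd {f : (ι → ℂ) → ℂ} (hf : Sm f) (v) : Sm (fun x => fderiv ℝ f x v) := by
  have h : ContDiff ℝ ∞ (fderiv ℝ f) := ContDiff.fderiv_right hf (by simp)
  exact h.clm_apply contDiff_const

lemma Sm.dz {f : (ι → ℂ) → ℂ} (hf : Sm f) (j) : Sm (dz j f) := by
  have h1 := hf.fd (Pi.single j 1)
  have h2 := hf.fd (Pi.single j I)
  unfold Sm at *
  unfold OT.dz
  fun_prop

lemma Sm.db {f : (ι → ℂ) → ℂ} (hf : Sm f) (j) : Sm (db j f) := by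
  have h1 := hf.fd (Pi.single j 1)
  have h2 := hf.fd (Pi.single j I)
  unfold Sm at *
  unfold OT.db
  fun_prop

lemma Sm.mul {f g : (ι → ℂ) → ℂ} (hf : Sm f) (hg : Sm g) : Sm (fun x => f x * g x) :=
  ContDiff.mul hf hg
lemma Sm.add {f g : (ι → ℂ) → ℂ} (hf : Sm f) (hg : Sm g) : Sm (fun x => f x + g x) :=
  ContDiff.add hf hg
lemma Sm.sub {f g : (ι → ℂ) → ℂ} (hf : Sm f) (hg : Sm g) : Sm (fun x => f x - g x) :=
  ContDiff.sub hf hg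
lemma Sm.neg {f : (ι → ℂ) → ℂ} (hf : Sm f) : Sm (fun x => - f x) :=
  ContDiff.neg hf
lemma Sm.const (c : ℂ) : Sm (fun _ : ι → ℂ => c) := contDiff_const
lemma Sm.sum {κ : Type*} {s : Finset κ} {f : κ → (ι → ℂ) → ℂ} (hf : ∀ i ∈ s, Sm (f i)) :
    Sm (fun x => ∑ i ∈ s, f i x) := ContDiff.sum hf
lemma Sm.conj {f : (ι → ℂ) → ℂ} (hf : Sm f) : Sm (fun x => conj (f x)) :=
  Complex.conjCLE.contDiff.comp hf
lemma Sm.ofReal {f : (ι → ℂ) → ℝ} (hf : ContDiff ℝ ∞ f) : Sm (fun x => (f x : ℂ)) :=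
  Complex.ofRealCLM.contDiff.comp hf
lemma Sm.proj (j : ι) : Sm (fun x : ι → ℂ => x j) := contDiff_apply ℝ ℂ j

section rules
variable {f g : (ι → ℂ) → ℂ} (j : ι)

lemma dz_mul (hf : Sm f) (hg : Sm g) (x) :
    dz j (fun x => f x * g x) x = dz j f x * g x + f x * dz j g x := by
  unfold dz
  rw [fderiv_fun_mul (hf.diff x) (hg.diff x)]
  simp; ring

lemma db_mul (hf : Sm f) (hg : Sm g) (x) :
    db j (fun x => f x * g x) x = db j f x * g x + f x * db j g x := by
  unfold db
  rw [fderiv_fun_mul (hf.diff x) (hg.diff x)]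
  simp; ring

lemma dz_add (hf : Sm f) (hg : Sm g) (x) :
    dz j (fun x => f x + g x) x = dz j f x + dz j g x := by
  unfold dz
  rw [fderiv_fun_add (hf.diff x) (hg.diff x)]
  simp; ring

lemma db_add (hf : Sm f) (hg : Sm g) (x) :
    db j (fun x => f x + g x) x = db j f x + db j g x := by
  unfold db
  rw [fderiv_fun_add (hf.diff x) (hg.diff x)]
  simp; ring

lemma dz_sub (hf : Sm f) (hg : Sm g) (x) :
    dz j (fun x => f x - g x) x = dz j f x - dz j g x := by
  unfold dz
  rw [fderiv_fun_sub (hf.diff x) (hg.diff x)]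
  simp; ring

lemma db_sub (hf : Sm f) (hg : Sm g) (x) :
    db j (fun x => f x - g x) x = db j f x - db j g x := by
  unfold db
  rw [fderiv_fun_sub (hf.diff x) (hg.diff x)]
  simp; ring

lemma dz_const (c : ℂ) (x) : dz j (fun _ : ι → ℂ => c) x = 0 := by
  unfold dz; simp
lemma db_const (c : ℂ) (x) : db j (fun _ : ι → ℂ => c) x = 0 := by
  unfold db; simp

lemma dz_const_mul (c : ℂ) (hf : Sm f) (x) : dz j (fun x => c * f x) x = c * dz j f x := by
  rw [dz_mul j (Sm.const c) hf, dz_const]; ring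
lemma db_const_mul (c : ℂ) (hf : Sm f) (x) : db j (fun x => c * f x) x = c * db j f x := by
  rw [db_mul j (Sm.const c) hf, db_const]; ring

lemma dz_neg (hf : Sm f) (x) : dz j (fun x => - f x) x = - dz j f x := by
  have := dz_const_mul j (-1) hf x
  simpa using this
lemma db_neg (hf : Sm f) (x) : db j (fun x => - f x) x = - db j f x := by
  have := db_const_mul j (-1) hf x
  simpa using this

lemma dz_sum {κ : Type*} {s : Finset κ} {f : κ → (ι → ℂ) → ℂ} (hf : ∀ i ∈ s, Sm (f i)) (x) :
    dz j (fun x => ∑ i ∈ s, f i x) x = ∑ i ∈ s, dz j (f i) x := by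
  unfold dz
  rw [fderiv_fun_sum (fun i hi => (hf i hi).diff x)]
  simp [Finset.mul_sum, Finset.sum_div, sub_div]
lemma db_sum {κ : Type*} {s : Finset κ} {f : κ → (ι → ℂ) → ℂ} (hf : ∀ i ∈ s, Sm (f i)) (x) :
    db j (fun x => ∑ i ∈ s, f i x) x = ∑ i ∈ s, db j (f i) x := by
  unfold db
  rw [fderiv_fun_sum (fun i hi => (hf i hi).diff x)]
  simp [Finset.mul_sum, Finset.sum_div, add_div, Finset.sum_add_distrib]

lemma fderiv_conj (hf : Sm f) (x v) :
    fderiv ℝ (fun x => conj (f x)) x v = conj (fderiv ℝ f x v) := by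
  have h : HasFDerivAt (fun x => conj (f x))
      ((Complex.conjCLE : ℂ →L[ℝ] ℂ).comp (fderiv ℝ f x)) x :=
    (Complex.conjCLE : ℂ →L[ℝ] ℂ).hasFDerivAt.comp x (hf.diff x).hasFDerivAt
  rw [h.fderiv]; simp

lemma dz_conj (hf : Sm f) (x) : dz j (fun x => conj (f x)) x = conj (db j f x) := by
  unfold dz db
  rw [fderiv_conj hf, fderiv_conj hf]
  have h2 : conj (2:ℂ) = 2 := Complex.conj_ofNat 2
  simp [h2]; ring
lemma db_conj (hf : Sm f) (x) : db j (fun x => conj (f x)) x = conj (dz j f x) := by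
  unfold dz db
  rw [fderiv_conj hf, fderiv_conj hf]
  have h2 : conj (2:ℂ) = 2 := Complex.conj_ofNat 2
  simp [h2]

lemma fderiv_comm (hf : Sm f) (x u v) :
    fderiv ℝ (fun x => fderiv ℝ f x u) x v = fderiv ℝ (fun x => fderiv ℝ f x v) x u := by
  have h : ContDiff ℝ ∞ (fderiv ℝ f) := ContDiff.fderiv_right hf (by simp)
  have hd : DifferentiableAt ℝ (fderiv ℝ f) x := (h.differentiable (by simp)) x
  rw [fderiv_clm_apply hd (by fun_prop), fderiv_clm_apply hd (by fun_prop)]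
  simp
  have := (ContDiff.contDiffAt hf (x := x)).isSymmSndFDerivAt (by simp only [minSmoothness_of_isRCLikeNormedField]; exact (WithTop.coe_le_coe.2 (le_top : (2:ℕ∞) ≤ ⊤)))
  exact this v u

lemma db_db_comm (k : ι) (hf : Sm f) (x) : db j (db k f) x = db k (db j f) x := by
  unfold db
  have e : ∀ j : ι, ∀ v : ι → ℂ, fderiv ℝ (fun x => (fderiv ℝ f x (Pi.single j 1) + I * fderiv ℝ f x (Pi.single j I)) / 2) x v
    = (fderiv ℝ (fun x => fderiv ℝ f x (Pi.single j 1)) x v + I * fderiv ℝ (fun x => fderiv ℝ f x (Pi.single j I)) x v)/2 := by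
    intro j v
    have h1 := (hf.fd (Pi.single j 1)).diff x
    have h2 := (hf.fd (Pi.single j I)).diff x
    have : HasFDerivAt (fun x => (fderiv ℝ f x (Pi.single j 1) + I * fderiv ℝ f x (Pi.single j I)) / 2) _ x :=
      (h1.hasFDerivAt.add (h2.hasFDerivAt.const_mul I)).mul_const' (2⁻¹ : ℂ)
    rw [this.fderiv]; simp; ring
  rw [e, e, e, e]
  rw [fderiv_comm hf x (Pi.single k 1) (Pi.single j 1), fderiv_comm hf x (Pi.single k I) (Pi.single j 1),
    fderiv_comm hf x (Pi.single k 1) (Pi.single j I), fderiv_comm hf x (Pi.single k I) (Pi.single j I)]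
  ring

lemma db_dz_comm (k : ι) (hf : Sm f) (x) : db j (dz k f) x = dz k (db j f) x := by
  unfold db dz
  have e : ∀ j : ι, ∀ v : ι → ℂ, fderiv ℝ (fun x => (fderiv ℝ f x (Pi.single j 1) + I * fderiv ℝ f x (Pi.single j I)) / 2) x v
    = (fderiv ℝ (fun x => fderiv ℝ f x (Pi.single j 1)) x v + I * fderiv ℝ (fun x => fderiv ℝ f x (Pi.single j I)) x v)/2 := by
    intro j v
    have h1 := (hf.fd (Pi.single j 1)).diff x
    have h2 := (hf.fd (Pi.single j I)).diff x
    have : HasFDerivAt (fun x => (fderiv ℝ f x (Pi.single j 1) + I * fderiv ℝ f x (Pi.single j I)) / 2) _ x :=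
      (h1.hasFDerivAt.add (h2.hasFDerivAt.const_mul I)).mul_const' (2⁻¹ : ℂ)
    rw [this.fderiv]; simp; ring
  have e' : ∀ j : ι, ∀ v : ι → ℂ, fderiv ℝ (fun x => (fderiv ℝ f x (Pi.single j 1) - I * fderiv ℝ f x (Pi.single j I)) / 2) x v
    = (fderiv ℝ (fun x => fderiv ℝ f x (Pi.single j 1)) x v - I * fderiv ℝ (fun x => fderiv ℝ f x (Pi.single j I)) x v)/2 := by
    intro j v
    have h1 := (hf.fd (Pi.single j 1)).diff x
    have h2 := (hf.fd (Pi.single j I)).diff x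
    have : HasFDerivAt (fun x => (fderiv ℝ f x (Pi.single j 1) - I * fderiv ℝ f x (Pi.single j I)) / 2) _ x :=
      (h1.hasFDerivAt.sub (h2.hasFDerivAt.const_mul I)).mul_const' (2⁻¹ : ℂ)
    rw [this.fderiv]; simp; ring
  rw [e, e, e', e']
  rw [fderiv_comm hf x (Pi.single k 1) (Pi.single j 1), fderiv_comm hf x (Pi.single k I) (Pi.single j 1),
    fderiv_comm hf x (Pi.single k 1) (Pi.single j I), fderiv_comm hf x (Pi.single k I) (Pi.single j I)]
  ring

lemma hcs_fd (hc : HasCompactSupport f) (v) : HasCompactSupport (fun x => fderiv ℝ f x v) :=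
  hc.fderiv_apply (𝕜 := ℝ) v

lemma hcs_dz (hc : HasCompactSupport f) : HasCompactSupport (dz j f) := by
  have h1 := hcs_fd hc (Pi.single j 1)
  have h2 := hcs_fd hc (Pi.single j I)
  refine HasCompactSupport.intro (h1.isCompact.union h2.isCompact) ?_
  intro x hx
  simp only [Set.mem_union, not_or] at hx
  have e1 := image_eq_zero_of_notMem_tsupport hx.1
  have e2 := image_eq_zero_of_notMem_tsupport hx.2
  simp [dz, e1, e2]

lemma hcs_db (hc : HasCompactSupport f) : HasCompactSupport (db j f) := by
  have h1 := hcs_fd hc (Pi.single j 1)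
  have h2 := hcs_fd hc (Pi.single j I)
  refine HasCompactSupport.intro (h1.isCompact.union h2.isCompact) ?_
  intro x hx
  simp only [Set.mem_union, not_or] at hx
  have e1 := image_eq_zero_of_notMem_tsupport hx.1
  have e2 := image_eq_zero_of_notMem_tsupport hx.2
  simp [db, e1, e2]

lemma int_fd (hf : Sm f) (hc : HasCompactSupport f) (v) : ∫ x, fderiv ℝ f x v = 0 := by
  have h := integral_mul_fderiv_eq_neg_fderiv_mul_of_integrable (μ := (volume : Measure (ι → ℂ)))
    (f := fun _ => (1:ℂ)) (g := f) (v := v) (by simp) ?_ ?_ (by simp) (fun x _ => hf.diff x)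
  · simpa using h
  · simpa using (hf.fd v).cont.integrable_of_hasCompactSupport (hcs_fd hc v)
  · simpa using hf.cont.integrable_of_hasCompactSupport hc

lemma int_dz (hf : Sm f) (hc : HasCompactSupport f) : ∫ x, dz j f x = 0 := by
  unfold dz
  have i1 : ∀ v, Integrable (fun x => fderiv ℝ f x v) := fun v =>
    (hf.fd v).cont.integrable_of_hasCompactSupport (hcs_fd hc v)
  rw [integral_div, integral_sub (i1 _) ((i1 _).const_mul I), integral_const_mul, int_fd hf hc, int_fd hf hc]
  simp

lemma int_db (hf : Sm f) (hc : HasCompactSupport f) : ∫ x, db j f x = 0 := by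
  unfold db
  have i1 : ∀ v, Integrable (fun x => fderiv ℝ f x v) := fun v =>
    (hf.fd v).cont.integrable_of_hasCompactSupport (hcs_fd hc v)
  rw [integral_div, integral_add (i1 _) ((i1 _).const_mul I), integral_const_mul, int_fd hf hc, int_fd hf hc]
  simp

lemma ibp_dz (hf : Sm f) (hg : Sm g) (hc : HasCompactSupport g) :
    ∫ x, dz j f x * g x = - ∫ x, f x * dz j g x := by
  have h := int_dz j (hf.mul hg) hc.mul_left
  have i1 : Integrable (fun x => dz j f x * g x) :=
    ((hf.dz j).mul hg).cont.integrable_of_hasCompactSupport hc.mul_left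
  have i2 : Integrable (fun x => f x * dz j g x) :=
    (hf.mul (hg.dz j)).cont.integrable_of_hasCompactSupport (hcs_dz j hc).mul_left
  simp_rw [dz_mul j hf hg] at h
  rw [integral_add i1 i2] at h
  exact eq_neg_of_add_eq_zero_left h

lemma ibp_db (hf : Sm f) (hg : Sm g) (hc : HasCompactSupport g) :
    ∫ x, db j f x * g x = - ∫ x, f x * db j g x := by
  have h := int_db j (hf.mul hg) hc.mul_left
  have i1 : Integrable (fun x => db j f x * g x) :=
    ((hf.db j).mul hg).cont.integrable_of_hasCompactSupport hc.mul_left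
  have i2 : Integrable (fun x => f x * db j g x) :=
    (hf.mul (hg.db j)).cont.integrable_of_hasCompactSupport (hcs_db j hc).mul_left
  simp_rw [db_mul j hf hg] at h
  rw [integral_add i1 i2] at h
  exact eq_neg_of_add_eq_zero_left h

lemma dz_proj (k : ι) (x) : dz j (fun x : ι → ℂ => x k) x = if j = k then 1 else 0 := by
  unfold dz
  have : HasFDerivAt (fun x : ι → ℂ => x k) (ContinuousLinearMap.proj (R := ℝ) k) x :=
    (ContinuousLinearMap.proj (R := ℝ) (φ := fun _ : ι => ℂ) k).hasFDerivAt
  rw [this.fderiv]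
  by_cases h : j = k
  · subst h; simp [Complex.ext_iff]
  · simp [h, Pi.single_apply, Ne.symm h]

lemma db_proj (k : ι) (x) : db j (fun x : ι → ℂ => x k) x = 0 := by
  unfold db
  have : HasFDerivAt (fun x : ι → ℂ => x k) (ContinuousLinearMap.proj (R := ℝ) k) x :=
    (ContinuousLinearMap.proj (R := ℝ) (φ := fun _ : ι => ℂ) k).hasFDerivAt
  rw [this.fderiv]
  by_cases h : j = k
  · subst h; simp [Complex.ext_iff]
  · simp [h, Pi.single_apply, Ne.symm h]

/-- chain rule with a real function -/
lemma dz_comp_real {u : (ι → ℂ) → ℝ} {φ : ℝ → ℝ} {φ' : ℝ} {x} (hu : ContDiff ℝ ∞ u)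
    (hφ : HasDerivAt φ φ' (u x)) :
    dz j (fun x => ((φ (u x) : ℝ) : ℂ)) x = φ' * dz j (fun x => (u x : ℂ)) x := by
  unfold dz
  have h1 : HasFDerivAt u (fderiv ℝ u x) x := (hu.differentiable (by simp) x).hasFDerivAt
  have h2 := Complex.ofRealCLM.hasFDerivAt.comp x h1
  have h3 := Complex.ofRealCLM.hasFDerivAt.comp x (hφ.comp_hasFDerivAt x h1)
  have e2 : fderiv ℝ (fun x => (u x : ℂ)) x = _ := h2.fderiv
  have e3 : fderiv ℝ (fun x => ((φ (u x) : ℝ) : ℂ)) x = _ := h3.fderiv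
  rw [e2, e3]; simp; ring
lemma db_comp_real {u : (ι → ℂ) → ℝ} {φ : ℝ → ℝ} {φ' : ℝ} {x} (hu : ContDiff ℝ ∞ u)
    (hφ : HasDerivAt φ φ' (u x)) :
    db j (fun x => ((φ (u x) : ℝ) : ℂ)) x = φ' * db j (fun x => (u x : ℂ)) x := by
  unfold db
  have h1 : HasFDerivAt u (fderiv ℝ u x) x := (hu.differentiable (by simp) x).hasFDerivAt
  have h2 := Complex.ofRealCLM.hasFDerivAt.comp x h1
  have h3 := Complex.ofRealCLM.hasFDerivAt.comp x (hφ.comp_hasFDerivAt x h1)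
  have e2 : fderiv ℝ (fun x => (u x : ℂ)) x = _ := h2.fderiv
  have e3 : fderiv ℝ (fun x => ((φ (u x) : ℝ) : ℂ)) x = _ := h3.fderiv
  rw [e2, e3]; simp; ring

lemma conj_dz_real {u : (ι → ℂ) → ℝ} (hu : ContDiff ℝ ∞ u) (x) :
    conj (dz j (fun x => (u x : ℂ)) x) = db j (fun x => (u x : ℂ)) x := by
  rw [← db_conj j (Sm.ofReal hu)]; simp
lemma conj_db_real {u : (ι → ℂ) → ℝ} (hu : ContDiff ℝ ∞ u) (x) :
    conj (db j (fun x => (u x : ℂ)) x) = dz j (fun x => (u x : ℂ)) x := by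
  rw [← dz_conj j (Sm.ofReal hu)]; simp

end rules
end OT

namespace OT
set_option linter.all false
open scoped ContDiff ComplexConjugate
open Complex (I)
variable {ι : Type} [Fintype ι] [DecidableEq ι]

/-- the weight `e^{-ψ}` -/
noncomputable def wt (ψ : (ι → ℂ) → ℝ) (x : ι → ℂ) : ℂ := ((Real.exp (-ψ x) : ℝ) : ℂ)

/-- first derivatives of the weight -/
noncomputable def wz (ψ : (ι → ℂ) → ℝ) (j : ι) (x : ι → ℂ) : ℂ := dz j (fun x => (ψ x : ℂ)) x

/-- Levi form coefficients -/
noncomputable def Lev (ψ : (ι → ℂ) → ℝ) (j k : ι) (x : ι → ℂ) : ℂ := db k (wz ψ j) x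

/-- formal adjoint (up to sign) -/
noncomputable def del (ψ : (ι → ℂ) → ℝ) (j : ι) (g : (ι → ℂ) → ℂ) (x : ι → ℂ) : ℂ :=
  dz j g x - wz ψ j x * g x

/-- the Laplacian -/
noncomputable def box (ψ : (ι → ℂ) → ℝ) (v : (ι → ℂ) → ℂ) (x : ι → ℂ) : ℂ :=
  - ∑ j, del ψ j (db j v) x

variable {ψ : (ι → ℂ) → ℝ} (hψ : ContDiff ℝ ∞ ψ)
include hψ

lemma sm_wt : Sm (wt ψ) := Sm.ofReal (Real.contDiff_exp.comp hψ.neg)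
lemma sm_wz (j) : Sm (wz ψ j) := (Sm.ofReal hψ).dz j
lemma sm_lev (j k) : Sm (Lev ψ j k) := (sm_wz hψ j).db k
lemma sm_del (j) {g} (hg : Sm g) : Sm (del ψ j g) := (hg.dz j).sub ((sm_wz hψ j).mul hg)
lemma sm_box {g} (hg : Sm g) : Sm (box ψ g) := (Sm.sum fun j _ => sm_del hψ j (hg.db j)).neg

omit hψ in
lemma hcs_del (j) {g} (hc : HasCompactSupport g) : HasCompactSupport (del ψ j g) := by
  unfold del
  exact (hcs_dz j hc).sub (hc.mul_left (f := wz ψ j))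

omit hψ in
lemma hcs_sum {κ : Type*} {s : Finset κ} {f : κ → (ι → ℂ) → ℂ} (hf : ∀ i, HasCompactSupport (f i)) :
    HasCompactSupport (fun x => ∑ i ∈ s, f i x) := by
  classical
  induction s using Finset.induction_on with
  | empty => simp only [Finset.sum_empty]; exact (HasCompactSupport.zero : HasCompactSupport (0 : (ι → ℂ) → ℂ))
  | insert a s ha ih => simp_rw [Finset.sum_insert ha]; exact (hf a).add ih

omit hψ in
lemma hcs_box {g} (hc : HasCompactSupport g) : HasCompactSupport (box ψ g) := by
  unfold box
  exact (hcs_sum fun j => hcs_del j (hcs_db j hc)).neg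

lemma dz_wt (j x) : dz j (wt ψ) x = - wz ψ j x * wt ψ x := by
  unfold wt wz
  have h := dz_comp_real (φ := fun t => Real.exp (-t)) j (x := x) hψ
    ((Real.hasDerivAt_exp _).comp (ψ x) (hasDerivAt_neg (ψ x)))
  rw [h]; push_cast; ring

lemma db_wt (j x) : db j (wt ψ) x = - conj (wz ψ j x) * wt ψ x := by
  unfold wz
  rw [conj_dz_real j hψ]
  unfold wt
  have h := db_comp_real (φ := fun t => Real.exp (-t)) j (x := x) hψ
    ((Real.hasDerivAt_exp _).comp (ψ x) (hasDerivAt_neg (ψ x)))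
  rw [h]; push_cast; ring

omit hψ in
lemma wt_conj (x) : conj (wt ψ x) = wt ψ x := by
  unfold wt; exact Complex.conj_ofReal _

lemma ibp_del (j) {a b : (ι → ℂ) → ℂ} (ha : Sm a) (hb : Sm b)
    (hc : HasCompactSupport a ∨ HasCompactSupport b) :
    ∫ x, del ψ j a x * conj (b x) * wt ψ x = - ∫ x, a x * conj (db j b x) * wt ψ x := by
  have hw := sm_wt hψ
  have hz := sm_wz hψ j
  have hS : Sm (fun x => a x * (conj (b x) * wt ψ x)) := ha.mul (hb.conj.mul hw)
  have e : ∀ x, dz j (fun x => a x * (conj (b x) * wt ψ x)) x =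
      del ψ j a x * conj (b x) * wt ψ x + a x * conj (db j b x) * wt ψ x := by
    intro x
    rw [dz_mul j ha (hb.conj.mul hw), dz_mul j hb.conj hw, dz_conj j hb, dz_wt hψ]
    unfold del; ring
  have hcc : ∀ {g : (ι → ℂ) → ℂ}, HasCompactSupport g → HasCompactSupport (fun x => conj (g x)) :=
    fun h => h.comp_left (g := fun z : ℂ => conj z) (by simp)
  have hcs : HasCompactSupport (fun x => a x * (conj (b x) * wt ψ x)) := by
    rcases hc with h | h
    · exact h.mul_right
    · exact ((hcc h).mul_right (f' := wt ψ)).mul_left (f := a)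
  have h := int_dz j hS hcs
  simp_rw [e] at h
  have i1 : Integrable (fun x => del ψ j a x * conj (b x) * wt ψ x) := by
    refine (((sm_del hψ j ha).mul hb.conj).mul hw).cont.integrable_of_hasCompactSupport ?_
    rcases hc with h | h
    · exact ((hcs_del j h).mul_right).mul_right
    · exact ((hcc h).mul_left (f := del ψ j a)).mul_right
  have i2 : Integrable (fun x => a x * conj (db j b x) * wt ψ x) := by
    refine ((ha.mul (hb.db j).conj).mul hw).cont.integrable_of_hasCompactSupport ?_
    rcases hc with h | h
    · exact (h.mul_right).mul_right
    · exact ((hcc (hcs_db j h)).mul_left (f := a)).mul_right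
  rw [integral_add i1 i2] at h
  exact eq_neg_of_add_eq_zero_left h

lemma ibp_del' (j) {a b : (ι → ℂ) → ℂ} (ha : Sm a) (hb : Sm b)
    (hc : HasCompactSupport a ∨ HasCompactSupport b) :
    ∫ x, a x * conj (del ψ j b x) * wt ψ x = - ∫ x, db j a x * conj (b x) * wt ψ x := by
  have h := congrArg conj (ibp_del hψ j hb ha hc.symm)
  rw [map_neg, ← integral_conj, ← integral_conj] at h
  simp only [map_mul, Complex.conj_conj, wt_conj] at h
  calc _ = ∫ x, conj (del ψ j b x) * a x * wt ψ x := by congr 1; ext x; ring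
    _ = _ := by rw [h]; congr 2; ext x; ring

lemma db_del (j k) {a : (ι → ℂ) → ℂ} (ha : Sm a) (x) :
    db k (del ψ j a) x = del ψ j (db k a) x - Lev ψ j k x * a x := by
  unfold del
  rw [db_sub k (ha.dz j) ((sm_wz hψ j).mul ha), db_mul k (sm_wz hψ j) ha, db_dz_comm k j ha]
  unfold Lev; ring

lemma ibp_box {u v : (ι → ℂ) → ℂ} (hu : Sm u) (hv : Sm v) (hc : HasCompactSupport v) :
    ∫ x, u x * conj (box ψ v x) * wt ψ x = ∫ x, ∑ j, db j u x * conj (db j v x) * wt ψ x := by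
  have i1 : ∀ j, Integrable (fun x => u x * conj (del ψ j (db j v) x) * wt ψ x) := fun j => by
    refine ((hu.mul (sm_del hψ j (hv.db j)).conj).mul (sm_wt hψ)).cont.integrable_of_hasCompactSupport ?_
    have : HasCompactSupport (fun x => conj (del ψ j (db j v) x)) :=
      (hcs_del j (hcs_db j hc)).comp_left (g := fun z : ℂ => conj z) (by simp)
    exact (this.mul_left (f := u)).mul_right
  have i2 : ∀ j, Integrable (fun x => db j u x * conj (db j v x) * wt ψ x) := fun j => by
    refine (((hu.db j).mul (hv.db j).conj).mul (sm_wt hψ)).cont.integrable_of_hasCompactSupport ?_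
    have : HasCompactSupport (fun x => conj (db j v x)) :=
      (hcs_db j hc).comp_left (g := fun z : ℂ => conj z) (by simp)
    exact (this.mul_left (f := db j u)).mul_right
  rw [integral_finsetSum _ fun j _ => i2 j]
  have e : ∀ x, u x * conj (box ψ v x) * wt ψ x = - ∑ j, u x * conj (del ψ j (db j v) x) * wt ψ x := by
    intro x; unfold box
    simp [Finset.mul_sum, Finset.sum_mul]
  simp_rw [e]
  rw [integral_neg, integral_finsetSum _ fun j _ => i1 j, ← Finset.sum_neg_distrib]
  refine Finset.sum_congr rfl fun j _ => ?_
  rw [ibp_del' hψ j hu (hv.db j) (Or.inr (hcs_db j hc)), neg_neg]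

lemma box_norm {v : (ι → ℂ) → ℂ} (hv : Sm v) (hc : HasCompactSupport v) :
    ∫ x, box ψ v x * conj (box ψ v x) * wt ψ x =
      ∫ x, (∑ j, ∑ k, db k (db j v) x * conj (db k (db j v) x) * wt ψ x) +
        ∑ j, ∑ k, Lev ψ j k x * db j v x * conj (db k v x) * wt ψ x := by
  have hw := sm_wt hψ
  have hcc : ∀ {g : (ι → ℂ) → ℂ}, HasCompactSupport g → HasCompactSupport (fun x => conj (g x)) :=
    fun h => h.comp_left (g := fun z : ℂ => conj z) (by simp)
  have cs : ∀ a b : (ι → ℂ) → ℂ, Sm a → Sm b → HasCompactSupport b →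
      Integrable (fun x => a x * conj (b x) * wt ψ x) := fun a b ha hb hcb => by
    refine ((ha.mul hb.conj).mul hw).cont.integrable_of_hasCompactSupport ?_
    exact ((hcc hcb).mul_left (f := a)).mul_right
  have i0 : ∀ j k, Integrable (fun x => del ψ j (db j v) x * conj (del ψ k (db k v) x) * wt ψ x) :=
    fun j k => cs _ _ (sm_del hψ j (hv.db j)) (sm_del hψ k (hv.db k)) (hcs_del k (hcs_db k hc))
  have i1 : ∀ j k, Integrable (fun x => db k (db j v) x * conj (db k (db j v) x) * wt ψ x) :=
    fun j k => cs _ _ ((hv.db j).db k) ((hv.db j).db k) (hcs_db k (hcs_db j hc))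
  have i2 : ∀ j k, Integrable (fun x => Lev ψ j k x * db j v x * conj (db k v x) * wt ψ x) :=
    fun j k => cs (fun x => Lev ψ j k x * db j v x) _ ((sm_lev hψ j k).mul (hv.db j)) (hv.db k) (hcs_db k hc)
  have i3 : ∀ j k, Integrable (fun x => del ψ j (db k (db j v)) x * conj (db k v x) * wt ψ x) :=
    fun j k => cs _ _ (sm_del hψ j ((hv.db j).db k)) (hv.db k) (hcs_db k hc)
  have key : ∀ j k, ∫ x, del ψ j (db j v) x * conj (del ψ k (db k v) x) * wt ψ x =
      (∫ x, db k (db j v) x * conj (db k (db j v) x) * wt ψ x) +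
      ∫ x, Lev ψ j k x * db j v x * conj (db k v x) * wt ψ x := by
    intro j k
    rw [ibp_del' hψ k (sm_del hψ j (hv.db j)) (hv.db k) (Or.inr (hcs_db k hc))]
    have e : ∀ x, db k (del ψ j (db j v)) x * conj (db k v x) * wt ψ x =
        del ψ j (db k (db j v)) x * conj (db k v x) * wt ψ x -
          Lev ψ j k x * db j v x * conj (db k v x) * wt ψ x := by
      intro x; rw [db_del hψ j k (hv.db j)]; ring
    simp_rw [e]
    rw [integral_sub (i3 j k) (i2 j k),
      ibp_del hψ j ((hv.db j).db k) (hv.db k) (Or.inr (hcs_db k hc))]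
    simp_rw [db_db_comm j k hv]
    ring
  have e : ∀ x, box ψ v x * conj (box ψ v x) * wt ψ x =
      ∑ j, ∑ k, del ψ j (db j v) x * conj (del ψ k (db k v) x) * wt ψ x := by
    intro x; unfold box
    simp only [map_neg, map_sum, neg_mul_neg]
    rw [Finset.sum_mul_sum, Finset.sum_mul]
    refine Finset.sum_congr rfl fun j _ => ?_
    rw [Finset.sum_mul]
  simp_rw [e]
  rw [integral_add (integrable_finset_sum _ fun j _ => integrable_finset_sum _ fun k _ => i1 j k)
    (integrable_finset_sum _ fun j _ => integrable_finset_sum _ fun k _ => i2 j k)]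
  rw [integral_finsetSum _ fun j _ => integrable_finset_sum _ fun k _ => i0 j k,
    integral_finsetSum _ fun j _ => integrable_finset_sum _ fun k _ => i1 j k,
    integral_finsetSum _ fun j _ => integrable_finset_sum _ fun k _ => i2 j k, ← Finset.sum_add_distrib]
  refine Finset.sum_congr rfl fun j _ => ?_
  rw [integral_finsetSum _ fun k _ => i0 j k,
    integral_finsetSum _ fun k _ => i1 j k,
    integral_finsetSum _ fun k _ => i2 j k, ← Finset.sum_add_distrib]
  exact Finset.sum_congr rfl fun k _ => key j k

/-- basic inequality -/
lemma box_ineq {v : (ι → ℂ) → ℂ} (hv : Sm v) (hc : HasCompactSupport v) (i0 : ι)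
    {b : (ι → ℂ) → ℝ} (hb : Continuous b)
    (hL : ∀ x (a : ι → ℂ), b x * ‖a i0‖ ^ 2 ≤ (∑ j, ∑ k, Lev ψ j k x * a j * conj (a k)).re) :
    ∫ x, b x * ‖db i0 v x‖ ^ 2 * Real.exp (-ψ x) ≤ ∫ x, ‖box ψ v x‖ ^ 2 * Real.exp (-ψ x) := by
  have hw := sm_wt hψ
  have h := congrArg Complex.re (box_norm hψ hv hc)
  have e1 : (∫ x, box ψ v x * conj (box ψ v x) * wt ψ x).re = ∫ x, ‖box ψ v x‖ ^ 2 * Real.exp (-ψ x) := by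
    have : ∀ x, box ψ v x * conj (box ψ v x) * wt ψ x = ((‖box ψ v x‖ ^ 2 * Real.exp (-ψ x) : ℝ) : ℂ) := by
      intro x; rw [Complex.mul_conj, Complex.normSq_eq_norm_sq]; simp [wt]
    simp_rw [this]
    rw [integral_complex_ofReal]; exact Complex.ofReal_re _
  rw [← e1, h]
  have hcc : ∀ {g : (ι → ℂ) → ℂ}, HasCompactSupport g → HasCompactSupport (fun x => conj (g x)) :=
    fun h => h.comp_left (g := fun z : ℂ => conj z) (by simp)
  have cs : ∀ a b : (ι → ℂ) → ℂ, Sm a → Sm b → HasCompactSupport b →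
      Integrable (fun x => a x * conj (b x) * wt ψ x) := fun a b ha hb hcb => by
    refine ((ha.mul hb.conj).mul hw).cont.integrable_of_hasCompactSupport ?_
    exact ((hcc hcb).mul_left (f := a)).mul_right
  have i1 : ∀ j k, Integrable (fun x => db k (db j v) x * conj (db k (db j v) x) * wt ψ x) :=
    fun j k => cs _ _ ((hv.db j).db k) ((hv.db j).db k) (hcs_db k (hcs_db j hc))
  have i2 : ∀ j k, Integrable (fun x => Lev ψ j k x * db j v x * conj (db k v x) * wt ψ x) :=
    fun j k => cs (fun x => Lev ψ j k x * db j v x) _ ((sm_lev hψ j k).mul (hv.db j)) (hv.db k) (hcs_db k hc)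
  have iT := (integrable_finset_sum Finset.univ fun j _ => integrable_finset_sum Finset.univ fun k _ => i1 j k).add
    (integrable_finset_sum Finset.univ fun j _ => integrable_finset_sum Finset.univ fun k _ => i2 j k)
  have := integral_re iT
  simp only [Pi.add_apply, RCLike.re_to_complex] at this
  rw [← this]
  refine integral_mono ?_ iT.re ?_
  · refine Continuous.integrable_of_hasCompactSupport ?_ ?_
    · exact (hb.mul ((hv.db i0).cont.norm.pow 2)).mul (Real.continuous_exp.comp hψ.continuous.neg)
    · have h1 : HasCompactSupport (fun x => ‖db i0 v x‖ ^ 2) :=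
        (hcs_db i0 hc).comp_left (g := fun z : ℂ => ‖z‖ ^ 2) (by simp)
      exact (h1.mul_left (f := b)).mul_right
  · intro x
    simp only
    rw [Complex.add_re]
    have p1 : 0 ≤ (∑ j, ∑ k, db k (db j v) x * conj (db k (db j v) x) * wt ψ x).re := by
      rw [Complex.re_sum]
      refine Finset.sum_nonneg fun j _ => ?_
      rw [Complex.re_sum]
      refine Finset.sum_nonneg fun k _ => ?_
      rw [Complex.mul_conj, wt, ← Complex.ofReal_mul, Complex.ofReal_re]
      exact mul_nonneg (Complex.normSq_nonneg _) (Real.exp_pos _).le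
    have p2 : (∑ j, ∑ k, Lev ψ j k x * db j v x * conj (db k v x) * wt ψ x).re =
        (∑ j, ∑ k, Lev ψ j k x * db j v x * conj (db k v x)).re * Real.exp (-ψ x) := by
      simp_rw [← Finset.sum_mul]
      rw [wt, Complex.re_mul_ofReal]
    rw [p2]
    have := mul_le_mul_of_nonneg_right (hL x (fun j => db j v x)) (Real.exp_pos (-ψ x)).le
    linarith

end OT

namespace OT
set_option linter.all false
open scoped ContDiff ComplexConjugate
open Complex (I)
variable {ι : Type} [Fintype ι] [DecidableEq ι]

lemma re_mul_ge (a b : ℂ) : -(‖a‖ * ‖b‖) ≤ (a * b).re := by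
  have := Complex.abs_re_le_norm (a * b)
  rw [norm_mul] at this
  exact (abs_le.1 this).1

lemma amgm {x y t : ℝ} (ht : 0 < t) : x * y ≤ t * x ^ 2 + y ^ 2 / (4 * t) := by
  have : t * x ^ 2 + y ^ 2 / (4 * t) - x * y = (2 * t * x - y) ^ 2 / (4 * t) := by
    field_simp; ring
  have h2 : 0 ≤ (2 * t * x - y) ^ 2 / (4 * t) := by positivity
  linarith

lemma ptw (k : ℝ) (kj b z r g W : ℂ) {t : ℝ} (ht : 0 < t) (ht' : t ≤ 1 / 12) :
    (1 / 4) * (k ^ 2 * ‖b‖ ^ 2) ≤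
      ((2 * k * conj kj * b * conj W + k ^ 2 * (b * conj b) - r * (k * g * conj W + k ^ 2 * conj z)) +
        t * (k * g * conj W * z + k ^ 2 * (z * conj z) - k * conj g * conj W * b - k ^ 2 * (b * conj b))).re
      + 2 * ‖kj‖ ^ 2 * ‖W‖ ^ 2 + 3 * t * ‖g‖ ^ 2 * ‖W‖ ^ 2 + (1 / t) * (k ^ 2 * ‖r‖ ^ 2) := by
  have e1 : (k ^ 2 * (b * conj b) : ℂ) = ((k ^ 2 * ‖b‖ ^ 2 : ℝ) : ℂ) := by
    rw [Complex.mul_conj, Complex.normSq_eq_norm_sq]; push_cast; ring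
  have e2 : (k ^ 2 * (z * conj z) : ℂ) = ((k ^ 2 * ‖z‖ ^ 2 : ℝ) : ℂ) := by
    rw [Complex.mul_conj, Complex.normSq_eq_norm_sq]; push_cast; ring
  have h1 := re_mul_ge (2 * k * b) (conj kj * conj W)
  have h2 := re_mul_ge (k * r) (- (g * conj W))
  have h3 := re_mul_ge (k * r) (-(k * conj z))
  have h4 := re_mul_ge (k * z) (g * conj W)
  have h5 := re_mul_ge (k * b) (-(conj g * conj W))
  simp only [norm_mul, norm_neg, RCLike.norm_conj, Complex.norm_real, Real.norm_eq_abs, Complex.norm_ofNat] at h1 h2 h3 h4 h5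
  have E : ((2 * k * conj kj * b * conj W + k ^ 2 * (b * conj b) - r * (k * g * conj W + k ^ 2 * conj z)) +
        t * (k * g * conj W * z + k ^ 2 * (z * conj z) - k * conj g * conj W * b - k ^ 2 * (b * conj b))).re
      = (2 * k * b * (conj kj * conj W)).re + k ^ 2 * ‖b‖ ^ 2 + (k * r * (-(g * conj W))).re
        + (k * r * (-(k * conj z))).re + t * ((k * z * (g * conj W)).re + k ^ 2 * ‖z‖ ^ 2 +
          (k * b * (-(conj g * conj W))).re - k ^ 2 * ‖b‖ ^ 2) := by
    rw [e1, e2]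
    have : ((2 * k * conj kj * b * conj W + ((k ^ 2 * ‖b‖ ^ 2 : ℝ) : ℂ) - r * (k * g * conj W + k ^ 2 * conj z)) +
        t * (k * g * conj W * z + ((k ^ 2 * ‖z‖ ^ 2 : ℝ) : ℂ) - k * conj g * conj W * b - ((k ^ 2 * ‖b‖ ^ 2 : ℝ) : ℂ))) =
        (2 * k * b * (conj kj * conj W)) + ((k ^ 2 * ‖b‖ ^ 2 : ℝ) : ℂ) + (k * r * (-(g * conj W)))
        + (k * r * (-(k * conj z))) + (t : ℂ) * ((k * z * (g * conj W)) + ((k ^ 2 * ‖z‖ ^ 2 : ℝ) : ℂ) +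
          (k * b * (-(conj g * conj W))) - ((k ^ 2 * ‖b‖ ^ 2 : ℝ) : ℂ)) := by ring
    rw [this, Complex.add_re, Complex.re_ofReal_mul]
    simp only [Complex.add_re, Complex.sub_re, Complex.ofReal_re]
  rw [E]
  have hk : |k| ^ 2 = k ^ 2 := sq_abs k
  have a1 := amgm (x := |k| * ‖b‖) (y := ‖kj‖ * ‖W‖) (t := 1 / 4) (by norm_num)
  have a2 := amgm (x := ‖g‖ * ‖W‖) (y := |k| * ‖r‖) ht
  have a3' := amgm (x := |k| * ‖z‖) (y := |k| * ‖r‖) (t := t / 2) (by linarith)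
  have a4' := amgm (x := |k| * ‖z‖) (y := ‖g‖ * ‖W‖) (t := 1/2) (by norm_num)
  have a5 := amgm (x := |k| * ‖b‖) (y := ‖g‖ * ‖W‖) (t := 1/2) (by norm_num)
  simp only [mul_pow, hk] at a1 a2 a3' a4' a5
  have hB : 0 ≤ k ^ 2 * ‖b‖ ^ 2 := by positivity
  have hG : 0 ≤ ‖g‖ ^ 2 * ‖W‖ ^ 2 := by positivity
  have hR : 0 ≤ (k ^ 2 * ‖r‖ ^ 2) / t := by positivity
  have d1 : k ^ 2 * ‖r‖ ^ 2 / (4 * t) = (1 / 4) * ((k ^ 2 * ‖r‖ ^ 2) / t) := by field_simp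
  have d2 : k ^ 2 * ‖r‖ ^ 2 / (4 * (t / 2)) = (1 / 2) * ((k ^ 2 * ‖r‖ ^ 2) / t) := by field_simp; ring
  have d3 : (1 / t) * (k ^ 2 * ‖r‖ ^ 2) = (k ^ 2 * ‖r‖ ^ 2) / t := by ring
  rw [d1] at a2
  rw [d2] at a3'
  rw [d3]
  have c4 := mul_le_mul_of_nonneg_left (h4) ht.le
  have c4' := mul_le_mul_of_nonneg_left (a4') ht.le
  have c5 := mul_le_mul_of_nonneg_left (h5) ht.le
  have c5' := mul_le_mul_of_nonneg_left (a5) ht.le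
  have c6 := mul_le_mul_of_nonneg_right ht' hB
  have c7 := mul_nonneg ht.le hG
  nlinarith

variable {ψ : (ι → ℂ) → ℝ}

/-- Caccioppoli type estimate. -/
lemma est (hψ : ContDiff ℝ ∞ ψ) {κ : (ι → ℂ) → ℝ} (hκ : ContDiff ℝ ∞ κ) (hκc : HasCompactSupport κ) :
    ∃ H : (ι → ℂ) → ℝ, Continuous H ∧ HasCompactSupport H ∧ (∀ x, 0 ≤ H x) ∧
    ∀ (W s : (ι → ℂ) → ℂ) (r : ι → (ι → ℂ) → ℂ), Sm W → Sm s → (∀ j, Sm (r j)) →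
      (∀ x, ∑ j, del ψ j (db j W) x = ∑ j, db j (r j) x - s x) → ∀ t : ℝ, 0 < t → t ≤ 1 / 12 →
      ∫ x, κ x ^ 2 * (∑ j, ‖db j W x‖ ^ 2) * Real.exp (-ψ x) ≤
        8 * (∫ x, (∑ j, ‖db j (fun x => (κ x : ℂ)) x‖ ^ 2) * ‖W x‖ ^ 2 * Real.exp (-ψ x)) +
        t * (∫ x, H x * ‖W x‖ ^ 2) +
        (4 / t) * ∫ x, κ x ^ 2 * (∑ j, ‖r j x‖ ^ 2 + ‖s x‖ ^ 2) * Real.exp (-ψ x) := by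
  have hw := sm_wt hψ
  have hk := Sm.ofReal hκ
  have hkc : HasCompactSupport (fun x => (κ x : ℂ)) := hκc.comp_left (g := fun t : ℝ => (t : ℂ)) (by simp)
  set g : ι → (ι → ℂ) → ℂ := fun j x => 2 * db j (fun x => (κ x : ℂ)) x - κ x * conj (wz ψ j x) with hg
  have hgs : ∀ j, Sm (g j) := fun j => ((Sm.const 2).mul (hk.db j)).sub (hk.mul (sm_wz hψ j).conj)
  have hgc : ∀ j, HasCompactSupport (g j) := fun j =>
    ((hcs_db j hkc).mul_left (f := fun _ => (2 : ℂ))).sub (hkc.mul_right)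
  have hexp : Continuous (fun x => Real.exp (-ψ x)) := Real.continuous_exp.comp hψ.continuous.neg
  have nc : ∀ {f : (ι → ℂ) → ℂ}, HasCompactSupport f → HasCompactSupport (fun x => ‖f x‖ ^ 2) :=
    fun h => h.comp_left (g := fun z : ℂ => ‖z‖ ^ 2) (by simp)
  have hcsR : ∀ f : ι → (ι → ℂ) → ℝ, (∀ j, HasCompactSupport (f j)) → HasCompactSupport (fun x => ∑ j, f j x) := by
    intro f hf
    have := HasCompactSupport.intro (f := fun x => ∑ j, f j x)
      (isCompact_iUnion fun j => (hf j).isCompact) (fun x hx => by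
        simp only [Set.mem_iUnion, not_exists] at hx
        exact Finset.sum_eq_zero fun j _ => image_eq_zero_of_notMem_tsupport (hx j))
    exact this
  have hκ2 : HasCompactSupport (fun x => κ x ^ 2) := hκc.comp_left (g := fun t : ℝ => t ^ 2) (by simp)
  refine ⟨fun x => (12 * (∑ j, ‖g j x‖ ^ 2) + 4 * κ x ^ 2) * Real.exp (-ψ x), ?_, ?_, ?_, ?_⟩
  · exact ((continuous_const.mul (continuous_finset_sum _ fun j _ => (hgs j).cont.norm.pow 2)).add
      (continuous_const.mul (hκ.continuous.pow 2))).mul hexp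
  · refine HasCompactSupport.mul_right ?_
    exact ((hcsR _ fun j => nc (hgc j)).mul_left (f := fun _ => (12:ℝ))).add (hκ2.mul_left (f := fun _ => (4 : ℝ)))
  · intro x; positivity
  intro W s r hW hs hr heq t ht ht'
  -- the two divergence fields
  have hG : Sm (fun x => (κ x : ℂ) * κ x * conj (W x) * wt ψ x) := ((hk.mul hk).mul hW.conj).mul hw
  have hGc : HasCompactSupport (fun x => (κ x : ℂ) * κ x * conj (W x) * wt ψ x) :=
    ((hkc.mul_right).mul_right).mul_right
  have hdbG : ∀ j x, db j (fun x => (κ x : ℂ) * κ x * conj (W x) * wt ψ x) x =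
      (κ x * g j x * conj (W x) + κ x ^ 2 * conj (dz j W x)) * wt ψ x := by
    intro j x
    rw [db_mul j ((hk.mul hk).mul hW.conj) hw, db_mul j (hk.mul hk) hW.conj, db_mul j hk hk, db_conj j hW,
      db_wt hψ]
    simp only [hg]; ring
  have hcg : ∀ j x, conj (g j x) = 2 * dz j (fun x => (κ x : ℂ)) x - κ x * wz ψ j x := by
    intro j x
    simp only [hg, map_sub, map_mul, Complex.conj_conj, Complex.conj_ofReal, conj_db_real j hκ, Complex.conj_ofNat]
  have hdzG : ∀ j x, dz j (fun x => (κ x : ℂ) * κ x * conj (W x) * wt ψ x) x =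
      (κ x * conj (g j x) * conj (W x) + κ x ^ 2 * conj (db j W x)) * wt ψ x := by
    intro j x
    rw [dz_mul j ((hk.mul hk).mul hW.conj) hw, dz_mul j (hk.mul hk) hW.conj, dz_mul j hk hk, dz_conj j hW,
      dz_wt hψ, hcg]
    ring
  let GG : (ι → ℂ) → ℂ := fun x => (κ x : ℂ) * κ x * conj (W x) * wt ψ x
  let V : (ι → ℂ) → ℂ := fun x => (∑ j, (dz j (fun x => db j W x * GG x) x - db j (fun x => r j x * GG x) x +
    t * (db j (fun x => dz j W x * GG x) x - dz j (fun x => db j W x * GG x) x)))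
  have s1 : ∀ j, Sm (fun x => db j W x * GG x) := fun j => (hW.db j).mul hG
  have s2 : ∀ j, Sm (fun x => r j x * GG x) := fun j => (hr j).mul hG
  have s3 : ∀ j, Sm (fun x => dz j W x * GG x) := fun j => (hW.dz j).mul hG
  have c1 : ∀ j, HasCompactSupport (fun x => db j W x * GG x) := fun j => hGc.mul_left
  have c2 : ∀ j, HasCompactSupport (fun x => r j x * GG x) := fun j => hGc.mul_left
  have c3 : ∀ j, HasCompactSupport (fun x => dz j W x * GG x) := fun j => hGc.mul_left
  have i1 := fun j => ((s1 j).dz j).cont.integrable_of_hasCompactSupport (μ := volume) (hcs_dz j (c1 j))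
  have i2 := fun j => ((s2 j).db j).cont.integrable_of_hasCompactSupport (μ := volume) (hcs_db j (c2 j))
  have i3 := fun j => ((s3 j).db j).cont.integrable_of_hasCompactSupport (μ := volume) (hcs_db j (c3 j))
  have iV0 : ∀ j, Integrable (fun x => (dz j (fun x => db j W x * GG x) x - db j (fun x => r j x * GG x) x +
    t * (db j (fun x => dz j W x * GG x) x - dz j (fun x => db j W x * GG x) x))) := fun j =>
    ((i1 j).sub (i2 j)).add (((i3 j).sub (i1 j)).const_mul _)
  have iV : Integrable V := integrable_finset_sum _ fun j _ => iV0 j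
  have hV0 : ∫ x, V x = 0 := by
    simp only [V]
    rw [integral_finsetSum _ fun j _ => iV0 j]
    refine Finset.sum_eq_zero fun j _ => ?_
    have e0 := integral_add ((i1 j).sub (i2 j)) (((i3 j).sub (i1 j)).const_mul (t : ℂ))
    have e1 := integral_sub (i1 j) (i2 j)
    have e2 := integral_sub (i3 j) (i1 j)
    simp only [Pi.sub_apply] at e0
    rw [e0, integral_const_mul, e1, e2, int_dz j (s1 j) (c1 j), int_db j (s2 j) (c2 j), int_db j (s3 j) (c3 j)]
    simp
  have hVx : ∀ x, V x = ((∑ j, ((2 * κ x * conj (db j (fun x => (κ x : ℂ)) x) * db j W x * conj (W x) + (κ x:ℂ) ^ 2 * (db j W x * conj (db j W x)) - r j x * (κ x * g j x * conj (W x) + κ x ^ 2 * conj (dz j W x))) +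
        t * (κ x * g j x * conj (W x) * dz j W x + (κ x:ℂ) ^ 2 * (dz j W x * conj (dz j W x)) - κ x * conj (g j x) * conj (W x) * db j W x - κ x ^ 2 * (db j W x * conj (db j W x))))) - κ x ^ 2 * conj (W x) * s x) * wt ψ x := by
    intro x
    have hq := heq x
    have : (- s x) = ∑ j, (del ψ j (db j W) x - db j (r j) x) := by
      rw [Finset.sum_sub_distrib, hq]; ring
    have h2 : -((κ x:ℂ) ^ 2 * conj (W x) * s x) = ∑ j, (del ψ j (db j W) x - db j (r j) x) * (κ x ^ 2 * conj (W x)) := by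
      rw [← Finset.sum_mul, ← this]; ring
    rw [sub_eq_add_neg, h2, ← Finset.sum_add_distrib, Finset.sum_mul]
    refine Finset.sum_congr rfl fun j _ => ?_
    rw [dz_mul j (hW.db j) hG, db_mul j (hr j) hG, db_mul j (hW.dz j) hG, hdbG, hdzG,
      db_dz_comm j j hW, hcg, conj_db_real j hκ]
    simp only [GG, del]
    ring
  have hpt : ∀ x, κ x ^ 2 * (∑ j, ‖db j W x‖ ^ 2) * Real.exp (-ψ x) ≤
      4 * (V x).re + 8 * ((∑ j, ‖db j (fun x => (κ x : ℂ)) x‖ ^ 2) * ‖W x‖ ^ 2 * Real.exp (-ψ x)) +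
        t * ((12 * (∑ j, ‖g j x‖ ^ 2) + 4 * κ x ^ 2) * Real.exp (-ψ x) * ‖W x‖ ^ 2) +
        (4 / t) * (κ x ^ 2 * (∑ j, ‖r j x‖ ^ 2 + ‖s x‖ ^ 2) * Real.exp (-ψ x)) := by
    intro x
    have hs1 := Finset.sum_le_sum fun j (_ : j ∈ Finset.univ) => ptw (κ x) (db j (fun x => (κ x : ℂ)) x) (db j W x) (dz j W x) (r j x) (g j x) (W x) ht ht'
    simp only [Finset.sum_add_distrib, ← Finset.mul_sum, ← Finset.sum_mul] at hs1
    have hsx := re_mul_ge (κ x * conj (W x)) (-(κ x * s x))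
    simp only [norm_mul, norm_neg, RCLike.norm_conj, Complex.norm_real, Real.norm_eq_abs] at hsx
    have a2 := amgm (x := |κ x| * ‖W x‖) (y := |κ x| * ‖s x‖) ht
    simp only [mul_pow, sq_abs] at a2
    have a3 : 0 ≤ κ x ^ 2 * ‖s x‖ ^ 2 / t := by positivity
    have d1 : κ x ^ 2 * ‖s x‖ ^ 2 / (4 * t) = (1 / 4) * (κ x ^ 2 * ‖s x‖ ^ 2 / t) := by field_simp
    rw [d1] at a2
    rw [hVx x, wt, Complex.re_mul_ofReal, Complex.sub_re]
    have es : (κ x * conj (W x) * (-(κ x * s x))).re = - ((κ x:ℂ) ^ 2 * conj (W x) * s x).re := by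
      rw [← Complex.neg_re]; congr 1; ring
    rw [es] at hsx
    rw [Complex.re_sum]
    have hex := (Real.exp_pos (-ψ x)).le
    have key : κ x ^ 2 * (∑ j, ‖db j W x‖ ^ 2) ≤ 4 * ((∑ i, ((2 * κ x * conj (db i (fun x => (κ x : ℂ)) x) * db i W x * conj (W x) + (κ x:ℂ) ^ 2 * (db i W x * conj (db i W x)) - r i x * (κ x * g i x * conj (W x) + κ x ^ 2 * conj (dz i W x))) +
        t * (κ x * g i x * conj (W x) * dz i W x + (κ x:ℂ) ^ 2 * (dz i W x * conj (dz i W x)) - κ x * conj (g i x) * conj (W x) * db i W x - κ x ^ 2 * (db i W x * conj (db i W x)))).re) - ((κ x:ℂ) ^ 2 * conj (W x) * s x).re) +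
        8 * ((∑ j, ‖db j (fun x => (κ x : ℂ)) x‖ ^ 2) * ‖W x‖ ^ 2) + t * ((12 * (∑ j, ‖g j x‖ ^ 2) + 4 * κ x ^ 2) * ‖W x‖ ^ 2) +
        (4 / t) * (κ x ^ 2 * (∑ j, ‖r j x‖ ^ 2 + ‖s x‖ ^ 2)) := by
      have d4 : (4 / t) * (κ x ^ 2 * (∑ j, ‖r j x‖ ^ 2 + ‖s x‖ ^ 2)) = 4 * (1 / t * (κ x ^ 2 * ∑ i, ‖r i x‖ ^ 2)) + 4 * (κ x ^ 2 * ‖s x‖ ^ 2 / t) := by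
        field_simp
      rw [d4]
      linarith
    refine (mul_le_mul_of_nonneg_right key hex).trans_eq ?_
    ring
  have j1 : Integrable (fun x => (∑ j, ‖db j (fun x => (κ x : ℂ)) x‖ ^ 2) * ‖W x‖ ^ 2 * Real.exp (-ψ x)) := by
    refine Continuous.integrable_of_hasCompactSupport ?_ ?_
    · exact ((continuous_finset_sum _ fun j _ => (hk.db j).cont.norm.pow 2).mul (hW.cont.norm.pow 2)).mul hexp
    · exact ((hcsR _ fun j => nc (hcs_db j hkc)).mul_right).mul_right
  have j2 : Integrable (fun x => (12 * (∑ j, ‖g j x‖ ^ 2) + 4 * κ x ^ 2) * Real.exp (-ψ x) * ‖W x‖ ^ 2) := by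
    refine Continuous.integrable_of_hasCompactSupport ?_ ?_
    · exact (((continuous_const.mul (continuous_finset_sum _ fun j _ => (hgs j).cont.norm.pow 2)).add
      (continuous_const.mul (hκ.continuous.pow 2))).mul hexp).mul (hW.cont.norm.pow 2)
    · refine (HasCompactSupport.mul_right ?_).mul_right
      exact ((hcsR _ fun j => nc (hgc j)).mul_left (f := fun _ => (12:ℝ))).add (hκ2.mul_left (f := fun _ => (4 : ℝ)))
  have j3 : Integrable (fun x => κ x ^ 2 * (∑ j, ‖r j x‖ ^ 2 + ‖s x‖ ^ 2) * Real.exp (-ψ x)) := by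
    refine Continuous.integrable_of_hasCompactSupport ?_ ?_
    · exact ((hκ.continuous.pow 2).mul ((continuous_finset_sum _ fun j _ => (hr j).cont.norm.pow 2).add (hs.cont.norm.pow 2))).mul hexp
    · exact (hκ2.mul_right).mul_right
  have j0 : Integrable (fun x => κ x ^ 2 * (∑ j, ‖db j W x‖ ^ 2) * Real.exp (-ψ x)) := by
    refine Continuous.integrable_of_hasCompactSupport ?_ ?_
    · exact ((hκ.continuous.pow 2).mul (continuous_finset_sum _ fun j _ => (hW.db j).cont.norm.pow 2)).mul hexp
    · exact (hκ2.mul_right).mul_right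
  have jV : Integrable (fun x => (V x).re) := iV.re
  have hVre : ∫ x, (V x).re = 0 := by
    have := integral_re iV
    simp only [RCLike.re_to_complex] at this
    rw [this, hV0]; simp
  have hm := integral_mono j0 ((((jV.const_mul 4).add (j1.const_mul 8)).add (j2.const_mul t)).add (j3.const_mul (4 / t))) hpt
  have b1 := integral_add (((jV.const_mul 4).add (j1.const_mul 8)).add (j2.const_mul t)) (j3.const_mul (4 / t))
  have b2 := integral_add ((jV.const_mul 4).add (j1.const_mul 8)) (j2.const_mul t)
  have b3 := integral_add (jV.const_mul 4) (j1.const_mul 8)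
  simp only [Pi.add_apply, integral_const_mul] at b1 b2 b3 hm
  rw [b1, b2, b3, hVre] at hm
  linarith
end OT

namespace OT
set_option linter.all false
open scoped ContDiff ComplexConjugate Convolution Topology
open Complex (I)
variable {ι : Type} [Fintype ι] [DecidableEq ι]

/-- mollification -/
noncomputable def mol (ρ w : (ι → ℂ) → ℂ) (x : ι → ℂ) : ℂ := ∫ y, w y * ρ (x - y)

section
variable {ρ w : (ι → ℂ) → ℂ} (hρ : Sm ρ) (hρc : HasCompactSupport ρ) (hw : LocallyIntegrable w)

lemma mol_eq (ρ w : (ι → ℂ) → ℂ) : mol ρ w = w ⋆[ContinuousLinearMap.mul ℝ ℂ] ρ := by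
  ext x; rfl

include hρ hρc hw
lemma sm_mol : Sm (mol ρ w) := by
  rw [mol_eq]
  exact hρc.contDiff_convolution_right _ hw hρ

lemma fd_mol (x v) : fderiv ℝ (mol ρ w) x v = mol (fun y => fderiv ℝ ρ y v) w x := by
  rw [mol_eq]
  have h := hρc.hasFDerivAt_convolution_right (L := ContinuousLinearMap.mul ℝ ℂ) (μ := volume) hw
    (ContDiff.of_le hρ (by simp)) x
  rw [h.fderiv]
  have hconv : ConvolutionExistsAt w (fderiv ℝ ρ) x ((ContinuousLinearMap.mul ℝ ℂ).precompR (ι → ℂ)) volume :=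
    (HasCompactSupport.convolutionExists_right (L := (ContinuousLinearMap.mul ℝ ℂ).precompR (ι → ℂ))
      (hρc.fderiv (𝕜 := ℝ)) hw ((ContDiff.of_le hρ (by simp) : ContDiff ℝ 1 ρ).continuous_fderiv (by simp))) x
  unfold convolution
  rw [ContinuousLinearMap.integral_apply hconv.integrable]
  rfl

lemma mol_int (x) : Integrable (fun y => w y * ρ (x - y)) := by
  have := (HasCompactSupport.convolutionExists_right (L := ContinuousLinearMap.mul ℝ ℂ) (μ := volume)
    hρc hw hρ.cont) x
  exact this.integrable

end

lemma mol_lin {ρ₁ ρ₂ w : (ι → ℂ) → ℂ} (h1 : Sm ρ₁) (h2 : Sm ρ₂) (c1 : HasCompactSupport ρ₁) (c2 : HasCompactSupport ρ₂)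
    (hw : LocallyIntegrable w) (a : ℂ) (x) :
    mol (fun y => (ρ₁ y + a * ρ₂ y) / 2) w x = (mol ρ₁ w x + a * mol ρ₂ w x) / 2 := by
  unfold mol
  rw [← integral_const_mul, ← integral_add (mol_int h1 c1 hw x) ((mol_int h2 c2 hw x).const_mul a), ← integral_div]
  congr 1; ext y; ring

section
variable {ρ w : (ι → ℂ) → ℂ} (hρ : Sm ρ) (hρc : HasCompactSupport ρ) (hw : LocallyIntegrable w)
include hρ hρc hw
lemma db_mol (j x) : db j (mol ρ w) x = mol (db j ρ) w x := by
  have := mol_lin (hρ.fd (Pi.single j 1)) (hρ.fd (Pi.single j I)) (hcs_fd hρc _) (hcs_fd hρc _) hw I x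
  unfold db
  rw [this, fd_mol hρ hρc hw, fd_mol hρ hρc hw]
lemma dz_mol (j x) : dz j (mol ρ w) x = mol (dz j ρ) w x := by
  have := mol_lin (hρ.fd (Pi.single j 1)) (hρ.fd (Pi.single j I)) (hcs_fd hρc _) (hcs_fd hρc _) hw (-I) x
  unfold dz
  rw [fd_mol hρ hρc hw, fd_mol hρ hρc hw]
  simp only [neg_mul, ← sub_eq_add_neg] at this
  rw [this]
end

/-- reflected test function -/
lemma fd_refl {ρ : (ι → ℂ) → ℂ} (hρ : Sm ρ) (x y v) :
    fderiv ℝ (fun y => ρ (x - y)) y v = - fderiv ℝ ρ (x - y) v := by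
  have h1 : HasFDerivAt (fun y : ι → ℂ => x - y) (-(ContinuousLinearMap.id ℝ (ι → ℂ))) y := by
    simpa using (hasFDerivAt_id (𝕜 := ℝ) y).const_sub x
  have h := (hρ.diff (x - y)).hasFDerivAt.comp y h1
  have e : fderiv ℝ (fun y => ρ (x - y)) y = _ := h.fderiv
  rw [e]; simp

lemma sm_refl {ρ : (ι → ℂ) → ℂ} (hρ : Sm ρ) (x) : Sm (fun y => ρ (x - y)) := by
  unfold Sm at *
  exact hρ.comp (contDiff_const.sub contDiff_id)

lemma hcs_refl {ρ : (ι → ℂ) → ℂ} (hρ : HasCompactSupport ρ) (x) : HasCompactSupport (fun y => ρ (x - y)) :=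
  hρ.comp_homeomorph (Homeomorph.subLeft x)

lemma db_refl {ρ : (ι → ℂ) → ℂ} (hρ : Sm ρ) (j) (x y) : db j (fun y => ρ (x - y)) y = - db j ρ (x - y) := by
  unfold db; rw [fd_refl hρ, fd_refl hρ]; ring
lemma dz_refl {ρ : (ι → ℂ) → ℂ} (hρ : Sm ρ) (j) (x y) : dz j (fun y => ρ (x - y)) y = - dz j ρ (x - y) := by
  unfold dz; rw [fd_refl hρ, fd_refl hρ]; ring

variable {ψ : (ι → ℂ) → ℝ}

lemma locInt_sq {w : (ι → ℂ) → ℂ} (hψ : Continuous ψ)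
    (hw : Integrable (fun x => ‖w x‖ ^ 2 * Real.exp (-ψ x))) :
    LocallyIntegrable (fun x => ‖w x‖ ^ 2) := by
  have h := hw.locallyIntegrable
  have h2 := h.mul_continuous (g := fun x => Real.exp (ψ x)) (Real.continuous_exp.comp hψ)
  refine h2.congr (Filter.Eventually.of_forall fun x => ?_)
  simp only [mul_assoc, ← Real.exp_add]; simp

lemma locInt_of {w : (ι → ℂ) → ℂ} (hψ : Continuous ψ) (hm : AEStronglyMeasurable w)
    (hw : Integrable (fun x => ‖w x‖ ^ 2 * Real.exp (-ψ x))) :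
    LocallyIntegrable w := by
  have h := (locInt_sq hψ hw).add (locallyIntegrable_const (1:ℝ))
  refine h.mono hm (Filter.Eventually.of_forall fun x => ?_)
  simp only [Pi.add_apply, Real.norm_eq_abs]
  rw [abs_of_nonneg (by positivity)]
  nlinarith [sq_nonneg (‖w x‖ - 1), norm_nonneg (w x)]

lemma wz_neg (hψ : ContDiff ℝ ∞ ψ) (j x) : wz (fun x => - ψ x) j x = - wz ψ j x := by
  unfold wz
  rw [← dz_neg j (Sm.ofReal hψ)]; simp

/-- weak equation in divergence form -/
lemma weak_eq (hψ : ContDiff ℝ ∞ ψ) {w : (ι → ℂ) → ℂ}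
    (hbox : ∀ v, Sm v → HasCompactSupport v → ∫ x, w x * conj (box ψ v x) * wt ψ x = 0)
    {k : (ι → ℂ) → ℂ} (hk : Sm k) (hkc : HasCompactSupport k) :
    ∫ x, w x * ∑ j, (db j (dz j k) x + Lev ψ j j x * k x + wz ψ j x * db j k x) = 0 := by
  have hψ' : ContDiff ℝ ∞ (fun x => - ψ x) := hψ.neg
  have he := sm_wt hψ'
  have hv : Sm (fun x => conj (wt (fun x => - ψ x) x * k x)) := (he.mul hk).conj
  have hvc : HasCompactSupport (fun x => conj (wt (fun x => - ψ x) x * k x)) :=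
    (hkc.mul_left (f := wt (fun x => - ψ x))).comp_left (g := fun z : ℂ => conj z) (by simp)
  have h := hbox _ hv hvc
  rw [← neg_eq_zero, ← h, ← integral_neg]
  congr 1; ext x
  have hp : ∀ j, Sm (fun x => dz j k x + wz ψ j x * k x) := fun j => (hk.dz j).add ((sm_wz hψ j).mul hk)
  have e1 : ∀ j, db j (fun x => conj (wt (fun x => - ψ x) x * k x)) =
      fun x => conj (wt (fun x => - ψ x) x * (dz j k x + wz ψ j x * k x)) := by
    intro j; ext x
    rw [db_conj j (he.mul hk), dz_mul j he hk, dz_wt hψ', wz_neg hψ]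
    congr 1; ring
  have e2 : ∀ j, del ψ j (db j (fun x => conj (wt (fun x => - ψ x) x * k x))) x =
      conj (wt (fun x => - ψ x) x * db j (fun x => dz j k x + wz ψ j x * k x) x) := by
    intro j
    rw [e1]
    unfold del
    rw [dz_conj j (he.mul (hp j)), db_mul j he (hp j), db_wt hψ', wz_neg hψ]
    simp only [map_add, map_mul, map_neg, Complex.conj_conj]; ring
  have e3 : wt (fun x => - ψ x) x * wt ψ x = 1 := by
    unfold wt; rw [← Complex.ofReal_mul, ← Real.exp_add]; simp
  unfold box
  simp_rw [e2]
  simp only [map_neg, map_sum, Complex.conj_conj]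
  have e4 : ∀ j, db j (fun x => dz j k x + wz ψ j x * k x) x =
      db j (dz j k) x + Lev ψ j j x * k x + wz ψ j x * db j k x := by
    intro j
    rw [db_add j (hk.dz j) ((sm_wz hψ j).mul hk), db_mul j (sm_wz hψ j) hk]
    unfold Lev; ring
  simp_rw [e4, ← Finset.mul_sum]
  linear_combination (w x * ∑ j, (db j (dz j k) x + Lev ψ j j x * k x + wz ψ j x * db j k x)) * e3

lemma mol_fun_eq (hψ : ContDiff ℝ ∞ ψ) {w : (ι → ℂ) → ℂ} (hw : LocallyIntegrable w)
    (hbox : ∀ v, Sm v → HasCompactSupport v → ∫ x, w x * conj (box ψ v x) * wt ψ x = 0)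
    {ρ : (ι → ℂ) → ℂ} (hρ : Sm ρ) (hρc : HasCompactSupport ρ) (x) :
    ∑ j, del ψ j (db j (mol ρ w)) x =
      ∑ j, db j (fun x => mol ρ (fun y => wz ψ j y * w y) x - wz ψ j x * mol ρ w x) x -
        (mol ρ (fun y => (∑ j, Lev ψ j j y) * w y) x - (∑ j, Lev ψ j j x) * mol ρ w x) := by
  have hwj : ∀ j, LocallyIntegrable (fun y => wz ψ j y * w y) := fun j =>
    hw.continuous_mul (sm_wz hψ j).cont
  have hwL : ∀ j, LocallyIntegrable (fun y => Lev ψ j j y * w y) := fun j =>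
    hw.continuous_mul (sm_lev hψ j j).cont
  have hW := sm_mol hρ hρc hw
  have hR := fun j => sm_mol hρ hρc (hwj j)
  have h := weak_eq hψ hbox (sm_refl hρ x) (hcs_refl hρc x)
  have ec : ∀ j y, db j (dz j fun y => ρ (x - y)) y = dz j (db j ρ) (x - y) := by
    intro j y
    have : (dz j fun y => ρ (x - y)) = fun y => - dz j ρ (x - y) := by
      ext y; exact dz_refl hρ j x y
    rw [this, db_neg j (sm_refl (hρ.dz j) x), db_refl (hρ.dz j), neg_neg, db_dz_comm j j hρ]
  simp_rw [ec, db_refl hρ] at h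
  have i1 := fun j => mol_int ((hρ.db j).dz j) (hcs_dz j (hcs_db j hρc)) hw x
  have i2 := fun j => mol_int hρ hρc (hwL j) x
  have i3 := fun j => mol_int (hρ.db j) (hcs_db j hρc) (hwj j) x
  have e : ∀ y, w y * ∑ j, (dz j (db j ρ) (x - y) + Lev ψ j j y * ρ (x - y) + wz ψ j y * -db j ρ (x - y)) =
      ∑ j, (w y * dz j (db j ρ) (x - y) + Lev ψ j j y * w y * ρ (x - y) - wz ψ j y * w y * db j ρ (x - y)) := by
    intro y; rw [Finset.mul_sum]; refine Finset.sum_congr rfl fun j _ => ?_; ring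
  simp_rw [e] at h
  have i4 : ∀ j, Integrable (fun y => w y * dz j (db j ρ) (x - y) + Lev ψ j j y * w y * ρ (x - y) - wz ψ j y * w y * db j ρ (x - y)) :=
    fun j => ((i1 j).add (i2 j)).sub (i3 j)
  rw [integral_finsetSum _ fun j _ => i4 j] at h
  have e5 : ∀ j, ∫ y, (w y * dz j (db j ρ) (x - y) + Lev ψ j j y * w y * ρ (x - y) - wz ψ j y * w y * db j ρ (x - y))
    = dz j (db j (mol ρ w)) x + mol ρ (fun y => Lev ψ j j y * w y) x - db j (mol ρ (fun y => wz ψ j y * w y)) x := by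
    intro j
    have a1 := integral_sub ((i1 j).add (i2 j)) (i3 j)
    have a2 := integral_add (i1 j) (i2 j)
    simp only [Pi.add_apply] at a1
    rw [a1, a2, db_mol hρ hρc (hwj j)]
    have : db j (mol ρ w) = mol (db j ρ) w := by ext x; exact db_mol hρ hρc hw j x
    rw [this, dz_mol (hρ.db j) (hcs_db j hρc) hw]
    rfl
  simp_rw [e5] at h
  have e6 : mol ρ (fun y => (∑ j, Lev ψ j j y) * w y) x = ∑ j, mol ρ (fun y => Lev ψ j j y * w y) x := by
    unfold mol
    rw [← integral_finsetSum _ fun j _ => i2 j]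
    congr 1; ext y; beta_reduce; rw [Finset.sum_mul, Finset.sum_mul]
  rw [e6]
  have e7 : ∀ j, db j (fun x => mol ρ (fun y => wz ψ j y * w y) x - wz ψ j x * mol ρ w x) x =
      db j (mol ρ (fun y => wz ψ j y * w y)) x - (Lev ψ j j x * mol ρ w x + wz ψ j x * db j (mol ρ w) x) := by
    intro j
    rw [db_sub j (hR j) ((sm_wz hψ j).mul hW), db_mul j (sm_wz hψ j) hW]
    rfl
  simp_rw [e7]
  unfold del
  simp only [Finset.sum_sub_distrib, Finset.sum_add_distrib, Finset.sum_mul] at h ⊢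
  linear_combination h

end OT

namespace OT
set_option linter.all false
open scoped ContDiff ComplexConjugate Convolution Topology
open Complex (I)
variable {ι : Type} [Fintype ι] [DecidableEq ι]

/-- bump functions -/
noncomputable def bn (ι : Type) [Fintype ι] (n : ℕ) : ContDiffBump (0 : ι → ℂ) :=
  ⟨1 / (2 * (n + 1)), 1 / (n + 1), by positivity, by
    rw [div_lt_div_iff₀ (by positivity) (by positivity)]
    have : (0:ℝ) ≤ n := n.cast_nonneg
    linarith⟩

/-- normalized kernel -/
noncomputable def rh (n : ℕ) (x : ι → ℂ) : ℝ := (bn ι n).normed volume x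
/-- complex valued normalized kernel -/
noncomputable def rho (n : ℕ) (x : ι → ℂ) : ℂ := (rh n x : ℂ)

lemma sm_rh (n) : ContDiff ℝ ∞ (rh n : (ι → ℂ) → ℝ) := (bn ι n).contDiff_normed
lemma sm_rho (n) : Sm (rho n : (ι → ℂ) → ℂ) := Sm.ofReal (sm_rh n)
lemma rh_nonneg (n) (x : ι → ℂ) : 0 ≤ rh n x := (bn ι n).nonneg_normed x
lemma hcs_rh (n) : HasCompactSupport (rh n : (ι → ℂ) → ℝ) := (bn ι n).hasCompactSupport_normed
lemma hcs_rho (n) : HasCompactSupport (rho n : (ι → ℂ) → ℂ) :=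
  (hcs_rh n).comp_left (g := fun t : ℝ => (t : ℂ)) (by simp)
lemma int_rh (n) : ∫ x : ι → ℂ, rh n x = 1 := (bn ι n).integral_normed
lemma rh_neg (n) (x : ι → ℂ) : rh n (-x) = rh n x := (bn ι n).normed_neg x
lemma rh_zero (n : ℕ) (x : ι → ℂ) (hx : 1 / ((n : ℝ) + 1) ≤ ‖x‖) : rh n x = 0 := by
  have := (bn ι n).support_normed_eq (μ := volume)
  by_contra h
  have h2 : x ∈ Function.support ((bn ι n).normed volume) := h
  rw [this] at h2
  simp [bn] at h2
  simp at hx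
  linarith

lemma lint_rh (n) : ∫⁻ x : ι → ℂ, ENNReal.ofReal (rh n x) = 1 := by
  rw [← ofReal_integral_eq_lintegral_ofReal (f := rh n) ((bn ι n).integrable_normed) (Filter.Eventually.of_forall (rh_nonneg n)), int_rh]
  simp

lemma lint_rh_sub (n) (x : ι → ℂ) : ∫⁻ y : ι → ℂ, ENNReal.ofReal (rh n (x - y)) = 1 := by
  rw [lintegral_sub_left_eq_self (fun y => ENNReal.ofReal (rh n y)) x, lint_rh]
lemma lint_rh_sub' (n) (y : ι → ℂ) : ∫⁻ x : ι → ℂ, ENNReal.ofReal (rh n (x - y)) = 1 := by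
  rw [lintegral_sub_right_eq_self (fun y => ENNReal.ofReal (rh n y)) y, lint_rh]

/-- the averaged absolute value -/
noncomputable def Pn (n : ℕ) (w : (ι → ℂ) → ℂ) (x : ι → ℂ) : ENNReal :=
  ∫⁻ y, ‖w y‖ₑ * ENNReal.ofReal (rh n (x - y))

lemma meas_rh (n) : Measurable (fun x : ι → ℂ => ENNReal.ofReal (rh n x)) :=
  ENNReal.measurable_ofReal.comp (sm_rh n).continuous.measurable

lemma Pn_sq (n : ℕ) {w : (ι → ℂ) → ℂ} (hw : AEStronglyMeasurable w) (x : ι → ℂ) :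
    Pn n w x ^ 2 ≤ ∫⁻ y, ‖w y‖ₑ ^ 2 * ENNReal.ofReal (rh n (x - y)) := by
  have hr : Measurable (fun y : ι → ℂ => ENNReal.ofReal (rh n (x - y))) :=
    (meas_rh n).comp (measurable_const.sub measurable_id)
  have h := ENNReal.lintegral_mul_le_Lp_mul_Lq volume (p := 2) (q := 2) Real.HolderConjugate.two_two
    (f := fun y => ‖w y‖ₑ * ENNReal.ofReal (rh n (x - y)) ^ (1 / 2 : ℝ))
    (g := fun y => ENNReal.ofReal (rh n (x - y)) ^ (1 / 2 : ℝ))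
    (hw.enorm.mul (hr.pow_const _).aemeasurable) (hr.pow_const _).aemeasurable
  have e0 : ∀ a : ENNReal, (a ^ (1 / 2 : ℝ)) ^ (2 : ℝ) = a := by
    intro a; rw [← ENNReal.rpow_mul]; norm_num
  have e1 : ∀ a : ENNReal, (a ^ (1 / 2 : ℝ)) * (a ^ (1 / 2 : ℝ)) = a := by
    intro a; rw [← ENNReal.rpow_add_of_nonneg _ _ (by norm_num) (by norm_num)]; norm_num
  simp only [Pi.mul_apply, ENNReal.mul_rpow_of_nonneg _ _ (by norm_num : (0:ℝ) ≤ 2), e0, mul_assoc, e1,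
    lint_rh_sub, ENNReal.one_rpow, mul_one] at h
  have h2 := pow_le_pow_left' h 2
  unfold Pn
  refine h2.trans_eq ?_
  rw [← ENNReal.rpow_natCast, ← ENNReal.rpow_mul]
  norm_num

lemma jensen0 (n : ℕ) {w : (ι → ℂ) → ℂ} (hw : AEStronglyMeasurable w) {H H' : (ι → ℂ) → ℝ}
    (hH : Continuous H) (hHH : ∀ x y, dist x y ≤ 1 / ((n : ℝ) + 1) → H x ≤ H' y) :
    ∫⁻ x, ENNReal.ofReal (H x) * Pn n w x ^ 2 ≤ ∫⁻ y, ENNReal.ofReal (H' y) * ‖w y‖ₑ ^ 2 := by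
  have hHm : Measurable (fun x => ENNReal.ofReal (H x)) := ENNReal.measurable_ofReal.comp hH.measurable
  calc _ ≤ ∫⁻ x, ∫⁻ y, ENNReal.ofReal (H x) * (‖w y‖ₑ ^ 2 * ENNReal.ofReal (rh n (x - y))) := by
        refine lintegral_mono fun x => ?_
        refine (mul_le_mul_right (Pn_sq n hw x) _).trans ?_
        rw [lintegral_const_mul' _ _ ENNReal.ofReal_ne_top]
    _ = ∫⁻ y, ∫⁻ x, ENNReal.ofReal (H x) * (‖w y‖ₑ ^ 2 * ENNReal.ofReal (rh n (x - y))) := by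
        refine lintegral_lintegral_swap ?_
        have a1 : AEMeasurable (fun a : (ι → ℂ) × (ι → ℂ) => ‖w a.2‖ₑ ^ 2) (volume.prod volume) :=
          ((hw.enorm.pow_const 2).comp_quasiMeasurePreserving Measure.quasiMeasurePreserving_snd)
        have a2 : AEMeasurable (fun a : (ι → ℂ) × (ι → ℂ) => ENNReal.ofReal (rh n (a.1 - a.2))) (volume.prod volume) :=
          ((meas_rh n).comp (measurable_fst.sub measurable_snd)).aemeasurable
        exact (hHm.comp measurable_fst).aemeasurable.mul (a1.mul a2)
    _ ≤ ∫⁻ y, ∫⁻ x, ENNReal.ofReal (H' y) * ‖w y‖ₑ ^ 2 * ENNReal.ofReal (rh n (x - y)) := by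
        refine lintegral_mono fun y => lintegral_mono fun x => ?_
        by_cases h : dist x y ≤ 1 / ((n : ℝ) + 1)
        · rw [← mul_assoc]
          exact mul_le_mul_left (mul_le_mul_left (ENNReal.ofReal_le_ofReal (hHH x y h)) _) _
        · have : rh n (x - y) = 0 := rh_zero n _ (by rw [← dist_eq_norm]; linarith)
          simp [this]
    _ = _ := by
        refine lintegral_congr fun y => ?_
        have hm : Measurable (fun x : ι → ℂ => ENNReal.ofReal (rh n (x - y))) :=
          (meas_rh n).comp (measurable_id.sub measurable_const)
        rw [lintegral_const_mul _ hm, lint_rh_sub' n y, mul_one]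

lemma jensen (n : ℕ) {w f : (ι → ℂ) → ℂ} (hw : AEStronglyMeasurable w) {H H' : (ι → ℂ) → ℝ}
    (hH : Continuous H) (hH0 : ∀ x, 0 ≤ H x) (hH'0 : ∀ x, 0 ≤ H' x) (hHH : ∀ x y, dist x y ≤ 1 / ((n : ℝ) + 1) → H x ≤ H' y)
    (hi : Integrable (fun y => H' y * ‖w y‖ ^ 2)) (hf : Continuous f) {om : ℝ} (hom : 0 ≤ om)
    (hfw : ∀ x, H x ≠ 0 → ‖f x‖ₑ ≤ ENNReal.ofReal om * Pn n w x) :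
    ∫ x, H x * ‖f x‖ ^ 2 ≤ om ^ 2 * ∫ y, H' y * ‖w y‖ ^ 2 := by
  have h := jensen0 n hw hH hHH
  rw [← integral_const_mul]
  have hi2 : Integrable (fun y => om ^ 2 * (H' y * ‖w y‖ ^ 2)) := hi.const_mul _
  have hm1 : AEStronglyMeasurable (fun x => H x * ‖f x‖ ^ 2) volume := (hH.mul (hf.norm.pow 2)).aestronglyMeasurable
  rw [integral_eq_lintegral_of_nonneg_ae (f := fun x => H x * ‖f x‖ ^ 2) (Filter.Eventually.of_forall fun x => mul_nonneg (hH0 x) (by positivity))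
    hm1,
    integral_eq_lintegral_of_nonneg_ae (Filter.Eventually.of_forall fun x => mul_nonneg (by positivity) (mul_nonneg (hH'0 x) (by positivity))) hi2.1]
  refine ENNReal.toReal_mono ?_ ?_
  · exact ((hasFiniteIntegral_iff_ofReal (Filter.Eventually.of_forall fun x => mul_nonneg (by positivity) (mul_nonneg (hH'0 x) (by positivity)))).1 hi2.2).ne
  · have e1 : ∀ y, ENNReal.ofReal (om ^ 2 * (H' y * ‖w y‖ ^ 2)) = ENNReal.ofReal (om ^ 2) * (ENNReal.ofReal (H' y) * ‖w y‖ₑ ^ 2) := by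
      intro y
      rw [ENNReal.ofReal_mul (by positivity), ENNReal.ofReal_mul (hH'0 y), ENNReal.ofReal_pow (norm_nonneg _), ofReal_norm_eq_enorm]
    simp_rw [e1]
    rw [lintegral_const_mul' _ _ ENNReal.ofReal_ne_top]
    refine le_trans ?_ (mul_le_mul_right h _)
    rw [← lintegral_const_mul' _ _ ENNReal.ofReal_ne_top]
    refine lintegral_mono fun x => ?_
    by_cases hx : H x = 0
    · simp [hx]
    rw [ENNReal.ofReal_mul (hH0 x), ENNReal.ofReal_pow (norm_nonneg _), ofReal_norm_eq_enorm, ENNReal.ofReal_pow hom]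
    refine (mul_le_mul_right (pow_le_pow_left' (hfw x hx) 2) _).trans_eq ?_
    rw [mul_pow]; ring

lemma mol_le_Pn (n : ℕ) (w : (ι → ℂ) → ℂ) (x) : ‖mol (rho n) w x‖ₑ ≤ Pn n w x := by
  unfold mol Pn
  refine (enorm_integral_le_lintegral_enorm _).trans_eq ?_
  refine lintegral_congr fun y => ?_
  rw [enorm_mul, rho]
  congr 1
  rw [← ofReal_norm_eq_enorm, Complex.norm_real, Real.norm_of_nonneg (rh_nonneg _ _)]

/-- commutator bound -/
lemma comm_le_Pn (n : ℕ) {w : (ι → ℂ) → ℂ} (hw : LocallyIntegrable w) {g : (ι → ℂ) → ℂ} (hg : Continuous g) (x) {om : ℝ}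
    (h : ∀ y, dist x y ≤ 1 / ((n:ℝ) + 1) → ‖g y - g x‖ ≤ om) :
    ‖mol (rho n) (fun y => g y * w y) x - g x * mol (rho n) w x‖ₑ ≤ ENNReal.ofReal om * Pn n w x := by
  have i1 := mol_int (sm_rho n) (hcs_rho n) (hw.continuous_mul hg) x
  have i2 := mol_int (sm_rho n) (hcs_rho n) hw x
  have e : mol (rho n) (fun y => g y * w y) x - g x * mol (rho n) w x =
      ∫ y, (g y - g x) * (w y * rho n (x - y)) := by
    unfold mol
    rw [← integral_const_mul, ← integral_sub i1 (i2.const_mul _)]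
    congr 1; ext y; ring
  rw [e]
  refine (enorm_integral_le_lintegral_enorm _).trans ?_
  unfold Pn
  rw [← lintegral_const_mul' _ _ ENNReal.ofReal_ne_top]
  refine lintegral_mono fun y => ?_
  rw [enorm_mul, enorm_mul]
  have er : ‖rho n (x - y)‖ₑ = ENNReal.ofReal (rh n (x - y)) := by
    rw [rho, ← ofReal_norm_eq_enorm, Complex.norm_real, Real.norm_of_nonneg (rh_nonneg _ _)]
  rw [er]
  by_cases hd : dist x y ≤ 1 / ((n : ℝ) + 1)
  · refine mul_le_mul_left ?_ _
    rw [← ofReal_norm_eq_enorm]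
    exact ENNReal.ofReal_le_ofReal (h y hd)
  · have : rh n (x - y) = 0 := rh_zero n _ (by rw [← dist_eq_norm]; linarith)
    simp [this]

end OT

namespace OT
set_option linter.all false
open scoped ContDiff ComplexConjugate Convolution Topology
open Complex (I)
variable {ι : Type} [Fintype ι] [DecidableEq ι]

lemma modulus {F : Type} [NormedAddCommGroup F] {g : (ι → ℂ) → F} (hg : Continuous g) (R : ℝ) {e : ℝ} (he : 0 < e) :
    ∀ᶠ n : ℕ in Filter.atTop, ∀ x ∈ Metric.closedBall (0 : ι → ℂ) R, ∀ y, dist x y ≤ 1 / ((n:ℝ) + 1) → ‖g y - g x‖ ≤ e := by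
  have h1 := (isCompact_closedBall (0 : ι → ℂ) (R + 1)).uniformContinuousOn_of_continuous hg.continuousOn
  rw [Metric.uniformContinuousOn_iff] at h1
  obtain ⟨d, hd, h⟩ := h1 e he
  have h2 : ∀ᶠ n : ℕ in Filter.atTop, 1 / ((n:ℝ) + 1) < d :=
    (tendsto_one_div_add_atTop_nhds_zero_nat (𝕜 := ℝ)).eventually (gt_mem_nhds hd)
  filter_upwards [h2] with n hn x hx y hxy
  have h3 : 1 / ((n:ℝ) + 1) ≤ 1 := by
    rw [div_le_one (by positivity)]; linarith [n.cast_nonneg (α := ℝ)]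
  rw [Metric.mem_closedBall] at hx
  have := h y (by
    rw [Metric.mem_closedBall]
    have := dist_triangle y x 0
    rw [dist_comm y x] at this; linarith) x (by rw [Metric.mem_closedBall]; linarith) (by rw [dist_comm]; linarith)
  rw [dist_eq_norm] at this
  exact this.le

lemma hcs_ball {F : Type} [NormedAddCommGroup F] {H : (ι → ℂ) → F} (h : HasCompactSupport H) :
    ∃ R : ℝ, ∀ x, H x ≠ 0 → x ∈ Metric.closedBall (0 : ι → ℂ) R := by
  obtain ⟨R, hR⟩ := h.isCompact.isBounded.subset_closedBall 0
  exact ⟨R, fun x hx => hR (subset_tsupport _ hx)⟩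

lemma jens_loc {w : (ι → ℂ) → ℂ} (hw : AEStronglyMeasurable w) (hw2 : LocallyIntegrable (fun x => ‖w x‖ ^ 2))
    {H : (ι → ℂ) → ℝ} (hH : Continuous H) (hHc : HasCompactSupport H) (hH0 : ∀ x, 0 ≤ H x) :
    ∃ C : ℝ, 0 ≤ C ∧ ∀ (n : ℕ) (f : (ι → ℂ) → ℂ) (om : ℝ), Continuous f → 0 ≤ om →
      (∀ x, H x ≠ 0 → ‖f x‖ₑ ≤ ENNReal.ofReal om * Pn n w x) → ∫ x, H x * ‖f x‖ ^ 2 ≤ om ^ 2 * C := by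
  obtain ⟨R, hR⟩ := hcs_ball hHc
  obtain ⟨B, hB⟩ := hHc.exists_bound_of_continuous hH
  have hB0 : 0 ≤ B := (norm_nonneg _).trans (hB 0)
  set K := Metric.closedBall (0 : ι → ℂ) (R + 1) with hK
  set H' : (ι → ℂ) → ℝ := K.indicator (fun _ => B) with hH'
  have hH'0 : ∀ x, 0 ≤ H' x := fun x => Set.indicator_nonneg (fun _ _ => hB0) x
  have hi : Integrable (fun y => H' y * ‖w y‖ ^ 2) := by
    have h1 : IntegrableOn (fun y => B * ‖w y‖ ^ 2) K :=
      (hw2.integrableOn_isCompact (isCompact_closedBall _ _)).const_mul B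
    have hKm : MeasurableSet K := Metric.isClosed_closedBall.measurableSet
    rw [← integrable_indicator_iff hKm] at h1
    refine h1.congr (Filter.Eventually.of_forall fun y => ?_)
    by_cases hy : y ∈ K <;> simp [hH', hy]
  refine ⟨∫ y, H' y * ‖w y‖ ^ 2, integral_nonneg fun y => mul_nonneg (hH'0 y) (by positivity), ?_⟩
  intro n f om hf hom hfw
  refine jensen n hw hH hH0 hH'0 ?_ hi hf hom hfw
  intro x y hxy
  by_cases hx : H x = 0
  · rw [hx]; exact hH'0 y
  have h3 : 1 / ((n:ℝ) + 1) ≤ 1 := by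
    rw [div_le_one (by positivity)]; linarith [n.cast_nonneg (α := ℝ)]
  have hy : y ∈ K := by
    have := hR x hx
    rw [Metric.mem_closedBall] at this
    rw [hK, Metric.mem_closedBall]
    have h2 := dist_triangle y x 0
    rw [dist_comm y x] at h2; linarith
  simp only [hH', Set.indicator_of_mem hy]
  have := hB x
  rw [Real.norm_of_nonneg (hH0 x)] at this
  exact this

variable {ψ : (ι → ℂ) → ℝ}

lemma lim_est (hψ : ContDiff ℝ ∞ ψ) {w : (ι → ℂ) → ℂ} (hm : AEStronglyMeasurable w)
    (hw : Integrable (fun x => ‖w x‖ ^ 2 * Real.exp (-ψ x)))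
    (hbox : ∀ v, Sm v → HasCompactSupport v → ∫ x, w x * conj (box ψ v x) * wt ψ x = 0)
    {κ : (ι → ℂ) → ℝ} (hκ : ContDiff ℝ ∞ κ) (hκc : HasCompactSupport κ) {δ : ℝ}
    (hδ : ∀ x, ∑ j, ‖db j (fun x => (κ x : ℂ)) x‖ ^ 2 ≤ δ) {e : ℝ} (he : 0 < e) :
    ∀ᶠ n : ℕ in Filter.atTop, ∫ x, κ x ^ 2 * (∑ j, ‖db j (mol (rho n) w) x‖ ^ 2) * Real.exp (-ψ x) ≤
      16 * δ * (∫ x, ‖w x‖ ^ 2 * Real.exp (-ψ x)) + e := by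
  have hwl := locInt_of hψ.continuous hm hw
  have hw2 := locInt_sq hψ.continuous hw
  have hexp : Continuous (fun x => Real.exp (-ψ x)) := Real.continuous_exp.comp hψ.continuous.neg
  have hk := Sm.ofReal hκ
  have hkc : HasCompactSupport (fun x => (κ x : ℂ)) := hκc.comp_left (g := fun t : ℝ => (t : ℂ)) (by simp)
  obtain ⟨H, hHc, hHcs, hH0, hest⟩ := est hψ hκ hκc
  obtain ⟨C1, hC1, hj1⟩ := jens_loc hm hw2 hHc hHcs hH0
  set H2 : (ι → ℂ) → ℝ := fun x => κ x ^ 2 * Real.exp (-ψ x) with hH2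
  have hH2c : Continuous H2 := (hκ.continuous.pow 2).mul hexp
  have hH2cs : HasCompactSupport H2 := by
    have : HasCompactSupport (fun x => κ x ^ 2) := hκc.comp_left (g := fun t : ℝ => t ^ 2) (by simp)
    exact this.mul_right
  have hH20 : ∀ x, 0 ≤ H2 x := fun x => by positivity
  obtain ⟨C2, hC2, hj2⟩ := jens_loc hm hw2 hH2c hH2cs hH20
  obtain ⟨R, hR⟩ := hcs_ball hκc
  obtain ⟨t, ht0, ht12, ht⟩ : ∃ t : ℝ, 0 < t ∧ t ≤ 1 / 12 ∧ t * C1 ≤ e / 2 := by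
    refine ⟨min (1/12) (e / (2 * (C1 + 1))), by positivity, min_le_left _ _, ?_⟩
    calc _ ≤ (e / (2 * (C1 + 1))) * C1 := by gcongr; exact min_le_right _ _
      _ ≤ e / 2 := by
        rw [div_mul_eq_mul_div, div_le_div_iff₀ (by positivity) (by positivity)]; nlinarith
  set N : ℝ := Fintype.card ι + 1 with hN
  obtain ⟨om, hom0, hom⟩ : ∃ om : ℝ, 0 < om ∧ (4 / t) * (N * (om ^ 2 * C2)) ≤ e / 2 := by
    set D := (4 / t) * (N * C2) with hD
    have hD0 : 0 ≤ D := by positivity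
    refine ⟨Real.sqrt (e / (2 * (D + 1))), by positivity, ?_⟩
    rw [Real.sq_sqrt (by positivity)]
    calc _ = (e / (2 * (D + 1))) * D := by rw [hD]; ring
      _ ≤ e / 2 := by
        rw [div_mul_eq_mul_div, div_le_div_iff₀ (by positivity) (by positivity)]; nlinarith
  have hmod1 : ∀ᶠ n : ℕ in Filter.atTop, ∀ j, ∀ x ∈ Metric.closedBall (0 : ι → ℂ) R, ∀ y, dist x y ≤ 1 / ((n:ℝ) + 1) → ‖wz ψ j y - wz ψ j x‖ ≤ om :=
    Filter.eventually_all.2 fun j => modulus (sm_wz hψ j).cont R hom0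
  have hq : Sm (fun x => ∑ j, Lev ψ j j x) := Sm.sum fun j _ => sm_lev hψ j j
  have hmod2 := modulus hq.cont R hom0
  have hmod3 := modulus hψ.continuous R (Real.log_pos (by norm_num : (1:ℝ) < 2))
  filter_upwards [hmod1, hmod2, hmod3] with n m1 m2 m3
  have hW : Sm (mol (rho n) w) := sm_mol (sm_rho n) (hcs_rho n) hwl
  have hwj : ∀ j, LocallyIntegrable (fun y => wz ψ j y * w y) := fun j => hwl.continuous_mul (sm_wz hψ j).cont
  have hrj : ∀ j, Sm (fun x => mol (rho n) (fun y => wz ψ j y * w y) x - wz ψ j x * mol (rho n) w x) := fun j =>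
    (sm_mol (sm_rho n) (hcs_rho n) (hwj j)).sub ((sm_wz hψ j).mul hW)
  have hs : Sm (fun x => mol (rho n) (fun y => (∑ j, Lev ψ j j y) * w y) x - (∑ j, Lev ψ j j x) * mol (rho n) w x) :=
    (sm_mol (sm_rho n) (hcs_rho n) (hwl.continuous_mul hq.cont)).sub (hq.mul hW)
  have h := hest _ _ _ hW hs hrj (mol_fun_eq hψ hwl hbox (sm_rho n) (hcs_rho n)) t ht0 ht12
  refine h.trans ?_
  have hM : 0 ≤ ∫ x, ‖w x‖ ^ 2 * Real.exp (-ψ x) := integral_nonneg fun x => by positivity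
  have b1 : ∫ x, (∑ j, ‖db j (fun x => (κ x : ℂ)) x‖ ^ 2) * ‖mol (rho n) w x‖ ^ 2 * Real.exp (-ψ x) ≤
      2 * δ * ∫ x, ‖w x‖ ^ 2 * Real.exp (-ψ x) := by
    have hδ0 : 0 ≤ δ := le_trans (by positivity) (hδ 0)
    have := jensen n (f := mol (rho n) w) hm (H := fun x => (∑ j, ‖db j (fun x => (κ x : ℂ)) x‖ ^ 2) * Real.exp (-ψ x))
      (H' := fun y => 2 * δ * Real.exp (-ψ y))
      ((continuous_finset_sum _ fun j _ => (hk.db j).cont.norm.pow 2).mul hexp) (fun x => by positivity) (fun x => by positivity) ?_ ?_ hW.cont zero_le_one (fun x _ => by simpa using mol_le_Pn n w x)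
    · rw [one_pow, one_mul] at this
      calc _ = ∫ x, (∑ j, ‖db j (fun x => (κ x : ℂ)) x‖ ^ 2) * Real.exp (-ψ x) * ‖mol (rho n) w x‖ ^ 2 := by
            congr 1; ext x; ring
        _ ≤ _ := this
        _ = _ := by rw [← integral_const_mul]; congr 1; ext x; ring
    · intro x y hxy
      by_cases hx : x ∈ tsupport κ
      · have hxR : x ∈ Metric.closedBall (0 : ι → ℂ) R :=
          (closure_minimal (fun x hx => hR x hx) Metric.isClosed_closedBall) hx
        have := m3 x hxR y hxy
        have h2 : Real.exp (-ψ x) ≤ 2 * Real.exp (-ψ y) := by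
          calc _ ≤ Real.exp (Real.log 2 + -ψ y) := Real.exp_le_exp.2 (by
                  rw [Real.norm_eq_abs] at this; linarith [le_abs_self (ψ y - ψ x)])
            _ = _ := by rw [Real.exp_add, Real.exp_log (by norm_num)]
        calc _ ≤ δ * (2 * Real.exp (-ψ y)) := by gcongr; exact hδ x
          _ = _ := by ring
      · have : ∀ j, db j (fun x => (κ x : ℂ)) x = 0 := by
          intro j
          have e1 : (fun x => (κ x : ℂ)) =ᶠ[𝓝 x] fun _ => 0 := by
            filter_upwards [notMem_tsupport_iff_eventuallyEq.1 hx] with y hy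
            simp [hy]
          unfold db
          rw [e1.fderiv_eq]; simp
        simp only [this]; simp; positivity
    · refine (hw.const_mul (2 * δ)).congr (Filter.Eventually.of_forall fun x => ?_)
      simp only; ring
  have b2 : ∫ x, H x * ‖mol (rho n) w x‖ ^ 2 ≤ C1 := by
    simpa using hj1 n (mol (rho n) w) 1 hW.cont zero_le_one (fun x _ => by simpa using mol_le_Pn n w x)
  have hIn2 : ∀ f : (ι → ℂ) → ℂ, Sm f → Integrable (fun x => H2 x * ‖f x‖ ^ 2) := fun f hf =>
    (hH2c.mul (hf.cont.norm.pow 2)).integrable_of_hasCompactSupport hH2cs.mul_right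
  have hκH : ∀ x, H2 x ≠ 0 → x ∈ Metric.closedBall (0 : ι → ℂ) R := by
    intro x hx; apply hR; intro h0; apply hx; simp [hH2, h0]
  have b3 : ∫ x, κ x ^ 2 * (∑ j, ‖mol (rho n) (fun y => wz ψ j y * w y) x - wz ψ j x * mol (rho n) w x‖ ^ 2 +
      ‖mol (rho n) (fun y => (∑ j, Lev ψ j j y) * w y) x - (∑ j, Lev ψ j j x) * mol (rho n) w x‖ ^ 2) * Real.exp (-ψ x)
      ≤ N * (om ^ 2 * C2) := by
    calc _ = ∫ x, ((∑ j, H2 x * ‖mol (rho n) (fun y => wz ψ j y * w y) x - wz ψ j x * mol (rho n) w x‖ ^ 2) +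
        H2 x * ‖mol (rho n) (fun y => (∑ j, Lev ψ j j y) * w y) x - (∑ j, Lev ψ j j x) * mol (rho n) w x‖ ^ 2) := by
          congr 1; ext x; rw [← Finset.mul_sum]; simp only [hH2]; ring
      _ = (∑ j, ∫ x, H2 x * ‖mol (rho n) (fun y => wz ψ j y * w y) x - wz ψ j x * mol (rho n) w x‖ ^ 2) +
        ∫ x, H2 x * ‖mol (rho n) (fun y => (∑ j, Lev ψ j j y) * w y) x - (∑ j, Lev ψ j j x) * mol (rho n) w x‖ ^ 2 := by
          rw [integral_add (integrable_finset_sum _ fun j _ => hIn2 _ (hrj j)) (hIn2 _ hs),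
            integral_finsetSum _ fun j _ => hIn2 _ (hrj j)]
      _ ≤ (∑ j : ι, om ^ 2 * C2) + om ^ 2 * C2 := by
          refine add_le_add (Finset.sum_le_sum fun j _ => ?_) ?_
          · exact hj2 n _ om (hrj j).cont hom0.le fun x hx => comm_le_Pn n hwl (sm_wz hψ j).cont x (m1 j x (hκH x hx))
          · exact hj2 n _ om hs.cont hom0.le fun x hx => comm_le_Pn n hwl hq.cont x (m2 x (hκH x hx))
      _ = _ := by simp [hN]; ring
  calc _ ≤ 8 * (2 * δ * ∫ x, ‖w x‖ ^ 2 * Real.exp (-ψ x)) + t * C1 + (4 / t) * (N * (om ^ 2 * C2)) := by gcongr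
    _ ≤ _ := by linarith

end OT

namespace OT
set_option linter.all false
open scoped ContDiff ComplexConjugate Convolution Topology
open Complex (I)
variable {ι : Type} [Fintype ι] [DecidableEq ι]

/-- entire functions -/
structure Hol (h : (ι → ℂ) → ℂ) : Prop where
  sm : Sm h
  db : ∀ j x, db j h x = 0

lemma Hol.lin {h : (ι → ℂ) → ℂ} (hh : Hol h) (x v : ι → ℂ) : fderiv ℝ h x (I • v) = I * fderiv ℝ h x v := by
  have key : ∀ j, fderiv ℝ h x (Pi.single j I) = I * fderiv ℝ h x (Pi.single j 1) := by
    intro j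
    have := hh.db j x
    unfold OT.db at this
    have h2 : fderiv ℝ h x (Pi.single j 1) + I * fderiv ℝ h x (Pi.single j I) = 0 := by
      simpa using this
    linear_combination (-I) * h2 + fderiv ℝ h x (Pi.single j I) * Complex.I_mul_I
  have hs : ∀ (j : ι) (z : ℂ), (Pi.single j z : ι → ℂ) = z.re • (Pi.single j (1:ℂ) : ι → ℂ) + z.im • (Pi.single j I : ι → ℂ) := by
    intro j z
    rw [← Pi.single_smul, ← Pi.single_smul, ← Pi.single_add]
    congr 1
    simp [Complex.re_add_im]
  have hsingle : ∀ (j : ι) (z : ℂ), fderiv ℝ h x (Pi.single j z) = z * fderiv ℝ h x (Pi.single j 1) := by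
    intro j z
    rw [hs j z, map_add, map_smul, map_smul, key]
    simp only [Complex.real_smul]
    conv_rhs => rw [← Complex.re_add_im z]
    ring
  have hv : ∀ v : ι → ℂ, fderiv ℝ h x v = ∑ j, v j * fderiv ℝ h x (Pi.single j 1) := by
    intro v
    conv_lhs => rw [← Finset.univ_sum_single v]
    rw [map_sum]
    exact Finset.sum_congr rfl fun j _ => hsingle j (v j)
  rw [hv, hv v, Finset.mul_sum]
  refine Finset.sum_congr rfl fun j _ => ?_
  simp; ring

lemma Hol.diff {h : (ι → ℂ) → ℂ} (hh : Hol h) : Differentiable ℂ h := by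
  intro x
  rw [differentiableAt_iff_restrictScalars ℝ (hh.sm.diff x)]
  refine ⟨{ toFun := fderiv ℝ h x, map_add' := map_add _, map_smul' := ?_, cont := (fderiv ℝ h x).continuous }, ?_⟩
  · intro c v
    have : c • v = c.re • v + c.im • (I • v) := by
      ext j; simp only [Pi.add_apply, Pi.smul_apply, smul_eq_mul, Complex.real_smul]
      conv_lhs => rw [← Complex.re_add_im c]
      ring
    rw [this, map_add, map_smul, map_smul, hh.lin]
    simp only [Complex.real_smul, RingHom.id_apply, smul_eq_mul]
    conv_rhs => rw [← Complex.re_add_im c]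
    ring
  · ext v; rfl

lemma db_of_cdiff {h : (ι → ℂ) → ℂ} {x} (hh : DifferentiableAt ℂ h x) (j) : db j h x = 0 := by
  unfold db
  rw [(hh.hasFDerivAt.restrictScalars ℝ).fderiv]
  have : (Pi.single j I : ι → ℂ) = I • Pi.single j 1 := by rw [← Pi.single_smul]; simp
  rw [this]
  simp only [ContinuousLinearMap.coe_restrictScalars', map_smul, smul_eq_mul]
  rw [← mul_assoc, Complex.I_mul_I]; ring

lemma hol_of_cdiff {h : (ι → ℂ) → ℂ} (hs : Sm h) (hh : Differentiable ℂ h) : Hol h :=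
  ⟨hs, fun j x => db_of_cdiff (hh x) j⟩

lemma Hol.sub {f g : (ι → ℂ) → ℂ} (hf : Hol f) (hg : Hol g) : Hol (fun x => f x - g x) :=
  hol_of_cdiff (hf.sm.sub hg.sm) (hf.diff.sub hg.diff)
lemma Hol.const (c : ℂ) : Hol (fun _ : ι → ℂ => c) := hol_of_cdiff (Sm.const c) (differentiable_const c)
lemma Hol.refl {f : (ι → ℂ) → ℂ} (hf : Hol f) (x) : Hol (fun y => f (x - y)) :=
  hol_of_cdiff (sm_refl hf.sm x) (hf.diff.comp (differentiable_const x |>.sub differentiable_id))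

lemma rot_mp (u : ℂ) (hu : ‖u‖ = 1) : MeasurePreserving (fun y : ι → ℂ => u • y) := by
  have h1 : MeasurePreserving (fun z : ℂ => u * z) := by
    have := (rotation (⟨u, by simp [Submonoid.unitSphere, hu]⟩ : Circle)).measurePreserving
    exact this
  have := volume_preserving_pi (ι := ι) (f := fun _ => fun z : ℂ => u * z) (fun _ => h1)
  exact this

lemma rot_int {F : Type} [NormedAddCommGroup F] [NormedSpace ℝ F] (u : ℂ) (hu : ‖u‖ = 1) (f : (ι → ℂ) → F) :
    ∫ y, f (u • y) = ∫ y, f y := by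
  have hu0 : u ≠ 0 := by intro h; simp [h] at hu
  exact (rot_mp u hu).integral_comp (Homeomorph.smulOfNeZero u hu0).measurableEmbedding f

lemma mean_value {W : (ι → ℂ) → ℂ} (hW : Hol W) {k : (ι → ℂ) → ℂ} (hk : Continuous k) (hkc : HasCompactSupport k)
    (hrot : ∀ u : ℂ, ‖u‖ = 1 → ∀ y, k (u • y) = k y) :
    ∫ y, W y * k y = W 0 * ∫ y, k y := by
  have hc : ∀ θ : ℝ, ‖circleMap 0 1 θ‖ = 1 := fun θ => by simp [circleMap]
  have e1 : ∀ θ : ℝ, ∫ y, W (circleMap 0 1 θ • y) * k y = ∫ y, W y * k y := by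
    intro θ
    rw [← rot_int (circleMap 0 1 θ) (hc θ) (fun y => W y * k y)]
    simp only [hrot _ (hc θ)]
  have e2 : ∀ y, ∫ θ in (0:ℝ)..(2 * Real.pi), W (circleMap 0 1 θ • y) = (2 * Real.pi) * W 0 := by
    intro y
    have hd : Differentiable ℂ (fun z : ℂ => W (z • y)) := hW.diff.comp (differentiable_id.smul_const y)
    have := (hd.diffContOnCl (s := Metric.ball 0 |1|)).circleAverage
    rw [Real.circleAverage] at this
    simp only [zero_smul] at this
    rw [← this]
    have hp : (2 * (Real.pi:ℂ)) ≠ 0 := by simp [Real.pi_ne_zero]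
    rw [Complex.real_smul]; push_cast
    field_simp
  have hcont : Continuous (Function.uncurry fun (θ : ℝ) (y : ι → ℂ) => W (circleMap 0 1 θ • y) * k y) := by
    have : Continuous (fun p : ℝ × (ι → ℂ) => circleMap 0 1 p.1 • p.2) :=
      ((continuous_circleMap 0 1).comp continuous_fst).smul continuous_snd
    exact (hW.sm.cont.comp this).mul (hk.comp continuous_snd)
  have e3 := intervalIntegral_integral_swap (a := 0) (b := 2 * Real.pi) (μ := (volume : Measure (ι → ℂ)))
    (f := fun θ y => W (circleMap 0 1 θ • y) * k y) (by
      have hKc : IsCompact (Set.Icc (0:ℝ) (2 * Real.pi) ×ˢ tsupport k) := isCompact_Icc.prod hkc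
      have h1 := hcont.continuousOn.integrableOn_compact (μ := volume.prod volume) hKc
      rw [IntegrableOn, ← Measure.prod_restrict] at h1
      have h2 : Integrable (Function.uncurry fun (θ : ℝ) (y : ι → ℂ) => W (circleMap 0 1 θ • y) * k y)
          ((volume.restrict (Set.Icc (0:ℝ) (2 * Real.pi))).prod volume) := by
        have e : (volume.restrict (Set.Icc (0:ℝ) (2 * Real.pi))).prod (volume.restrict (tsupport k)) =
          ((volume.restrict (Set.Icc (0:ℝ) (2 * Real.pi))).prod volume).restrict (Set.univ ×ˢ tsupport k) := by
          rw [← Measure.prod_restrict, Measure.restrict_univ]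
        rw [e] at h1
        refine (integrableOn_iff_integrable_of_support_subset ?_).1 h1
        intro p hp
        refine ⟨trivial, subset_tsupport _ ?_⟩
        intro h0; apply hp; simp [Function.uncurry, h0]
      refine h2.mono_measure ?_
      refine Measure.prod_mono (Measure.restrict_mono ?_ le_rfl) le_rfl
      rw [Set.uIoc_of_le (by positivity)]; exact Set.Ioc_subset_Icc_self)
  simp only [e1] at e3
  have e4 : ∀ y, ∫ θ in (0:ℝ)..(2 * Real.pi), W (circleMap 0 1 θ • y) * k y = (2 * Real.pi) * W 0 * k y := by
    intro y; rw [intervalIntegral.integral_mul_const, e2]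
  simp only [e4] at e3
  rw [integral_const_mul, intervalIntegral.integral_const] at e3
  have hp : (2 * (Real.pi:ℂ)) ≠ 0 := by simp [Real.pi_ne_zero]
  rw [Complex.real_smul] at e3
  push_cast at e3
  rw [sub_zero] at e3
  refine mul_left_cancel₀ hp (e3.trans ?_)
  ring

/-- radial bump -/
noncomputable def rad (x : ι → ℂ) : ℝ := expNegInvGlue (1 - ∑ i, ‖x i‖ ^ 2)

lemma sm_nsq (i : ι) : ContDiff ℝ ∞ (fun x : ι → ℂ => ‖x i‖ ^ 2) :=
  (contDiff_norm_sq ℝ (E := ℂ)).comp (contDiff_apply ℝ ℂ i)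
lemma sm_nsqs : ContDiff ℝ ∞ (fun x : ι → ℂ => ∑ i, ‖x i‖ ^ 2) := ContDiff.sum fun i _ => sm_nsq i
lemma sm_rad : ContDiff ℝ ∞ (rad : (ι → ℂ) → ℝ) := expNegInvGlue.contDiff.comp (contDiff_const.sub sm_nsqs)
lemma rad_nonneg (x : ι → ℂ) : 0 ≤ rad x := expNegInvGlue.nonneg _
lemma rad_supp (x : ι → ℂ) (h : rad x ≠ 0) : x ∈ Metric.closedBall (0 : ι → ℂ) 1 := by
  rw [mem_closedBall_zero_iff, pi_norm_le_iff_of_nonneg zero_le_one]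
  intro i
  by_contra hi
  push Not at hi
  apply h
  refine expNegInvGlue.zero_of_nonpos ?_
  have := Finset.single_le_sum (f := fun i => ‖x i‖ ^ 2) (fun i _ => by positivity) (Finset.mem_univ i)
  nlinarith
lemma hcs_rad : HasCompactSupport (rad : (ι → ℂ) → ℝ) :=
  HasCompactSupport.intro (isCompact_closedBall 0 1) fun x hx => by
    by_contra h; exact hx (rad_supp x h)
lemma rad_rot (u : ℂ) (hu : ‖u‖ = 1) (x : ι → ℂ) : rad (u • x) = rad x := by
  simp [rad, hu]
lemma rad_int_pos : 0 < ∫ x : ι → ℂ, rad x := by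
  refine (sm_rad.continuous).integral_pos_of_hasCompactSupport_nonneg_nonzero hcs_rad rad_nonneg (x := 0) ?_
  simp only [rad]
  exact (expNegInvGlue.pos_of_pos (by simp)).ne'

/-- normalized radial bump -/
noncomputable def rt (x : ι → ℂ) : ℂ := ((rad x / ∫ y : ι → ℂ, rad y : ℝ) : ℂ)
lemma sm_rt : Sm (rt : (ι → ℂ) → ℂ) := Sm.ofReal (sm_rad.div_const _)
lemma hcs_rt : HasCompactSupport (rt : (ι → ℂ) → ℂ) :=
  hcs_rad.comp_left (g := fun t : ℝ => ((t / ∫ y : ι → ℂ, rad y : ℝ) : ℂ)) (by simp)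
lemma rt_rot (u : ℂ) (hu : ‖u‖ = 1) (x : ι → ℂ) : rt (u • x) = rt x := by simp [rt, rad_rot u hu]
lemma int_rt : ∫ x : ι → ℂ, rt x = 1 := by
  unfold rt
  rw [integral_complex_ofReal, integral_div, div_self rad_int_pos.ne']; simp

lemma mol_rt {W : (ι → ℂ) → ℂ} (hW : Hol W) (x) : mol rt W x = W x := by
  have := mean_value (hW.refl x) sm_rt.cont hcs_rt rt_rot
  rw [int_rt] at this
  simp only [sub_zero, mul_one] at this
  rw [← this, mol]
  rw [← integral_sub_left_eq_self _ volume x]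
  simp

end OT

namespace OT
set_option linter.all false
open scoped ContDiff ComplexConjugate Convolution Topology
open Complex (I)
variable {ι : Type} [Fintype ι] [DecidableEq ι]

lemma inv_succ_le (n : ℕ) : 1 / ((n:ℝ) + 1) ≤ 1 := by
  rw [div_le_one (by positivity)]; linarith [n.cast_nonneg (α := ℝ)]

lemma weak_lim {w : (ι → ℂ) → ℂ} (hw : LocallyIntegrable w) {k : (ι → ℂ) → ℂ} (hk : Continuous k) (hkc : HasCompactSupport k) :
    Filter.Tendsto (fun n => ∫ x, mol (rho n) w x * k x) Filter.atTop (𝓝 (∫ x, w x * k x)) := by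
  obtain ⟨R, hR⟩ := hcs_ball hkc
  set B := Metric.closedBall (0 : ι → ℂ) (R + 1) with hB
  have hBm : MeasurableSet B := Metric.isClosed_closedBall.measurableSet
  have hwB : Integrable (B.indicator w) := by
    rw [integrable_indicator_iff hBm]; exact hw.integrableOn_isCompact (isCompact_closedBall _ _)
  have hki : Integrable k := hk.integrable_of_hasCompactSupport hkc
  have hy : ∀ n x y, k x ≠ 0 → rho n (x - y) ≠ 0 → y ∈ B := by
    intro n x y h1 h2
    have h3 := hR x h1
    have h4 : ‖x - y‖ < 1 / ((n:ℝ) + 1) := by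
      by_contra h; push Not at h; exact h2 (by rw [rho, rh_zero n _ h]; simp)
    rw [Metric.mem_closedBall] at h3
    rw [hB, Metric.mem_closedBall]
    have := dist_triangle y x 0
    rw [dist_comm y x, dist_eq_norm x y] at this
    linarith [inv_succ_le n]
  have e1 : ∀ n, ∫ x, mol (rho n) w x * k x = ∫ y, B.indicator w y * ∫ x, rho n (x - y) * k x := by
    intro n
    have a1 : ∀ x, mol (rho n) w x * k x = ∫ y, B.indicator w y * (rho n (x - y) * k x) := by
      intro x
      rw [mol, ← integral_mul_const]
      congr 1; ext y
      by_cases h1 : k x = 0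
      · simp [h1]
      by_cases h2 : rho n (x - y) = 0
      · simp [h2]
      rw [Set.indicator_of_mem (hy n x y h1 h2)]; ring
    simp only [a1]
    rw [integral_integral_swap]
    · simp only [integral_const_mul]
    · obtain ⟨M, hM⟩ := (hcs_rho (ι := ι) n).exists_bound_of_continuous (sm_rho n).cont
      have h1 : Integrable (fun p : (ι → ℂ) × (ι → ℂ) => k p.1 * B.indicator w p.2) (volume.prod volume) := hki.mul_prod hwB
      have h2 := h1.bdd_mul (c := M) (f := fun p : (ι → ℂ) × (ι → ℂ) => rho n (p.1 - p.2))
        ((sm_rho n).cont.comp (continuous_fst.sub continuous_snd)).aestronglyMeasurable (Filter.Eventually.of_forall fun p => hM _)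
      refine h2.congr (Filter.Eventually.of_forall fun p => ?_)
      simp only [Function.uncurry]; ring
  have e2 : ∫ x, w x * k x = ∫ y, B.indicator w y * k y := by
    congr 1; ext x
    by_cases h1 : k x = 0
    · simp [h1]
    rw [Set.indicator_of_mem]
    exact Metric.closedBall_subset_closedBall (by linarith) (hR x h1)
  rw [e2]
  simp only [e1]
  have hri : ∀ n y, ∫ x : ι → ℂ, rho n (x - y) = 1 := by
    intro n y
    rw [integral_sub_right_eq_self (fun x => rho n x) y]
    unfold rho
    rw [integral_complex_ofReal, int_rh]; simp
  have hrI : ∀ n y, Integrable (fun x : ι → ℂ => rho n (x - y)) := fun n y =>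
    ((sm_rho n).cont.integrable_of_hasCompactSupport (hcs_rho n)).comp_sub_right y
  have hnorm : ∀ n y, ∫ x : ι → ℂ, ‖rho n (x - y)‖ = 1 := by
    intro n y
    rw [integral_sub_right_eq_self (fun x : ι → ℂ => ‖rho n x‖) y]
    rw [← int_rh (ι := ι) n]
    congr 1; ext x
    rw [rho, Complex.norm_real, Real.norm_of_nonneg (rh_nonneg _ _)]
  have key : ∀ e > 0, ∀ᶠ n : ℕ in Filter.atTop, ∀ y ∈ B, ‖(∫ x, rho n (x - y) * k x) - k y‖ ≤ e := by
    intro e he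
    filter_upwards [modulus hk (R + 1) he] with n hn y hyB
    have : (∫ x, rho n (x - y) * k x) - k y = ∫ x, rho n (x - y) * (k x - k y) := by
      simp only [mul_sub]
      rw [integral_sub, integral_mul_const, hri, one_mul]
      · refine (hk.integrable_of_hasCompactSupport hkc).bdd_mul (c := _)
          ((sm_rho n).cont.comp (continuous_id.sub continuous_const)).aestronglyMeasurable (Filter.Eventually.of_forall fun p => ((hcs_rho (ι := ι) n).exists_bound_of_continuous (sm_rho n).cont).choose_spec _)
      · exact (hrI n y).mul_const _
    rw [this]
    calc _ ≤ ∫ x, ‖rho n (x - y)‖ * e := by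
          refine norm_integral_le_of_norm_le ((hrI n y).norm.mul_const e) (Filter.Eventually.of_forall fun x => ?_)
          rw [norm_mul]
          by_cases h : dist y x ≤ 1 / ((n:ℝ) + 1)
          · exact mul_le_mul_of_nonneg_left (hn y hyB x h) (norm_nonneg _)
          · have : rho n (x - y) = 0 := by
              rw [rho, rh_zero n _ (by rw [← dist_eq_norm, dist_comm]; linarith)]; simp
            simp [this]
      _ = e := by rw [integral_mul_const, hnorm, one_mul]
  have hmolk : ∀ n y, (∫ x, rho n (x - y) * k x) = mol (rho n) k y := by
    intro n y
    rw [mol]; congr 1; ext x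
    rw [mul_comm, rho, rho, ← rh_neg, neg_sub]
  refine tendsto_integral_filter_of_dominated_convergence (fun y => ‖B.indicator w y‖ * (‖k y‖ + 1)) ?_ ?_ ?_ ?_
  · refine Filter.Eventually.of_forall fun n => hwB.1.mul ?_
    simp only [hmolk]
    exact (sm_mol (sm_rho n) (hcs_rho n) (hk.locallyIntegrable)).cont.aestronglyMeasurable
  · filter_upwards [key 1 one_pos] with n hn
    refine Filter.Eventually.of_forall fun y => ?_
    rw [norm_mul]
    by_cases hyB : y ∈ B
    · refine mul_le_mul_of_nonneg_left ?_ (norm_nonneg _)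
      have h1 := hn y hyB
      have h2 := norm_sub_norm_le (∫ x, rho n (x - y) * k x) (k y)
      linarith
    · simp [hyB]
  · obtain ⟨M, hM⟩ := hkc.exists_bound_of_continuous hk
    have h1 := hwB.norm.bdd_mul (c := M + 1) (f := fun y => ‖k y‖ + 1) (hk.norm.add continuous_const).aestronglyMeasurable
      (Filter.Eventually.of_forall fun y => by rw [Real.norm_of_nonneg (by positivity)]; linarith [hM y])
    refine h1.congr (Filter.Eventually.of_forall fun y => by simp only; ring)
  · refine Filter.Eventually.of_forall fun y => ?_
    by_cases hyB : y ∈ B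
    · refine Filter.Tendsto.const_mul _ ?_
      rw [Metric.tendsto_nhds]
      intro e he
      filter_upwards [key (e/2) (by linarith)] with n hn
      rw [dist_eq_norm]
      linarith [hn y hyB]
    · simp [hyB]

lemma cutoff (R : ℝ) {δ : ℝ} (hδ : 0 < δ) : ∃ κ : (ι → ℂ) → ℝ, ContDiff ℝ ∞ κ ∧ HasCompactSupport κ ∧
    (∀ x ∈ Metric.closedBall (0 : ι → ℂ) R, κ x = 1) ∧ (∀ x, ∑ j, ‖db j (fun x => (κ x : ℂ)) x‖ ^ 2 ≤ δ) ∧ (∀ x, 0 ≤ κ x ∧ κ x ≤ 1) := by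
  let b : ContDiffBump (0 : ι → ℂ) := ⟨1, 2, one_pos, one_lt_two⟩
  have hb : Sm (fun x => (b x : ℂ)) := Sm.ofReal b.contDiff
  have hbc : HasCompactSupport (fun x => (b x : ℂ)) := b.hasCompactSupport.comp_left (g := fun t : ℝ => (t : ℂ)) (by simp)
  have hbd : ∃ M, ∀ x, ‖∑ j, ‖db j (fun x => (b x : ℂ)) x‖ ^ 2‖ ≤ M := by
    refine HasCompactSupport.exists_bound_of_continuous ?_ (continuous_finset_sum _ fun j _ => (hb.db j).cont.norm.pow 2)
    refine HasCompactSupport.intro hbc fun x hx => ?_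
    refine Finset.sum_eq_zero fun j _ => ?_
    have : db j (fun x => (b x : ℂ)) x = 0 := by
      unfold db
      rw [(notMem_tsupport_iff_eventuallyEq.1 hx).fderiv_eq]; simp
    simp [this]
  obtain ⟨M, hM⟩ := hbd
  have hM0 : 0 ≤ M := (norm_nonneg _).trans (hM 0)
  set S : ℝ := max (max R 1) (Real.sqrt (M / δ)) with hS
  have hS1 : 1 ≤ S := (le_max_right R 1).trans (le_max_left _ _)
  have hS0 : 0 < S := by linarith
  refine ⟨fun x => b (S⁻¹ • x), ?_, ?_, ?_, ?_, ?_⟩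
  · exact b.contDiff.comp (contDiff_const_smul _)
  · exact b.hasCompactSupport.comp_homeomorph (Homeomorph.smulOfNeZero S⁻¹ (by positivity))
  · intro x hx
    refine b.one_of_mem_closedBall ?_
    rw [mem_closedBall_zero_iff] at hx ⊢
    rw [norm_smul, Real.norm_of_nonneg (by positivity), inv_mul_le_iff₀ hS0]
    have : R ≤ S := (le_max_left R 1).trans (le_max_left _ _)
    show ‖x‖ ≤ S * 1
    linarith
  · intro x
    have e : ∀ j, db j (fun x => (b (S⁻¹ • x) : ℂ)) x = S⁻¹ * db j (fun x => (b x : ℂ)) (S⁻¹ • x) := by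
      intro j
      have := fderiv_comp_smul (𝕜 := ℝ) (f := fun x => (b x : ℂ)) (x := x) (S⁻¹)
      unfold db
      rw [this]
      simp only [ContinuousLinearMap.smul_apply, Complex.real_smul]
      push_cast; ring
    simp only [e, norm_mul, mul_pow]
    rw [← Finset.mul_sum]
    have h1 := hM (S⁻¹ • x)
    rw [Real.norm_of_nonneg (by positivity)] at h1
    have h2 : ‖((S:ℂ))⁻¹‖ ^ 2 = (S ^ 2)⁻¹ := by
      rw [norm_inv, Complex.norm_real, Real.norm_of_nonneg hS0.le, inv_pow]
    rw [show (((S⁻¹ : ℝ)) : ℂ) = (S:ℂ)⁻¹ by push_cast; rfl] at *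
    rw [h2, inv_mul_le_iff₀ (by positivity)]
    refine h1.trans ?_
    have h3 : Real.sqrt (M / δ) ≤ S := le_max_right _ _
    have h4 : M / δ ≤ S ^ 2 := by
      rw [← Real.sqrt_le_left hS0.le]; exact h3
    rw [div_le_iff₀ hδ] at h4
    linarith
  · intro x; exact ⟨b.nonneg, b.le_one⟩

variable {ψ : (ι → ℂ) → ℝ}

lemma weak_hol (hψ : ContDiff ℝ ∞ ψ) {w : (ι → ℂ) → ℂ} (hm : AEStronglyMeasurable w)
    (hw : Integrable (fun x => ‖w x‖ ^ 2 * Real.exp (-ψ x)))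
    (hbox : ∀ v, Sm v → HasCompactSupport v → ∫ x, w x * conj (box ψ v x) * wt ψ x = 0)
    {k : (ι → ℂ) → ℂ} (hk : Sm k) (hkc : HasCompactSupport k) (j : ι) : ∫ x, w x * db j k x = 0 := by
  have hwl := locInt_of hψ.continuous hm hw
  have hexp : Continuous (fun x => Real.exp (-ψ x)) := Real.continuous_exp.comp hψ.continuous.neg
  have hexp' : Continuous (fun x => Real.exp (ψ x)) := Real.continuous_exp.comp hψ.continuous
  have hlim := (weak_lim hwl (hk.db j).cont (hcs_db j hkc)).norm
  rw [← norm_le_zero_iff]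
  refine le_of_forall_pos_le_add fun e he => ?_
  rw [zero_add]
  refine le_of_tendsto hlim ?_
  set M := ∫ x, ‖w x‖ ^ 2 * Real.exp (-ψ x) with hM
  have hM0 : 0 ≤ M := integral_nonneg fun x => by positivity
  set B := ∫ x, ‖k x‖ ^ 2 * Real.exp (ψ x) with hB
  have hB0 : 0 ≤ B := integral_nonneg fun x => by positivity
  set s : ℝ := 2 * (B + 1) / e with hs
  have hs0 : 0 < s := by positivity
  obtain ⟨R, hR⟩ := hcs_ball hkc
  set δ : ℝ := e / (4 * s * (16 * (M + 1))) with hδ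
  have hδ0 : 0 < δ := by positivity
  obtain ⟨κ, hκ, hκc, hκ1, hκδ, -⟩ := cutoff (ι := ι) R hδ0
  have h4 : 0 < e / (4 * s) := by positivity
  filter_upwards [lim_est hψ hm hw hbox hκ hκc hκδ h4] with n hn
  have hW : Sm (mol (rho n) w) := sm_mol (sm_rho n) (hcs_rho n) hwl
  have hI : ∫ x, mol (rho n) w x * db j k x = - ∫ x, db j (mol (rho n) w) x * k x := by
    rw [ibp_db j hW hk hkc, neg_neg]
  rw [hI, norm_neg]
  have i1 : Integrable (fun x => κ x ^ 2 * (∑ j, ‖db j (mol (rho n) w) x‖ ^ 2) * Real.exp (-ψ x)) := by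
    refine Continuous.integrable_of_hasCompactSupport (((hκ.continuous.pow 2).mul (continuous_finset_sum _ fun j _ => (hW.db j).cont.norm.pow 2)).mul hexp) ?_
    have : HasCompactSupport (fun x => κ x ^ 2) := hκc.comp_left (g := fun t : ℝ => t ^ 2) (by simp)
    exact this.mul_right.mul_right
  have i2 : Integrable (fun x => ‖k x‖ ^ 2 * Real.exp (ψ x)) := by
    refine Continuous.integrable_of_hasCompactSupport ((hk.cont.norm.pow 2).mul hexp') ?_
    have : HasCompactSupport (fun x => ‖k x‖ ^ 2) := hkc.comp_left (g := fun t : ℂ => ‖t‖ ^ 2) (by simp)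
    exact this.mul_right
  calc _ ≤ ∫ x, (s * (κ x ^ 2 * (∑ j, ‖db j (mol (rho n) w) x‖ ^ 2) * Real.exp (-ψ x)) + s⁻¹ * (‖k x‖ ^ 2 * Real.exp (ψ x))) := by
        refine norm_integral_le_of_norm_le ((i1.const_mul s).add (i2.const_mul s⁻¹)) (Filter.Eventually.of_forall fun x => ?_)
        rw [norm_mul]
        by_cases hx : k x = 0
        · rw [hx]; simp; positivity
        rw [hκ1 x (hR x hx)]
        have h1 := Finset.single_le_sum (f := fun j => ‖db j (mol (rho n) w) x‖ ^ 2) (fun i _ => by positivity) (Finset.mem_univ j)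
        set a := ‖db j (mol (rho n) w) x‖
        set b := ‖k x‖
        have h2 : a * b ≤ s * (a ^ 2 * Real.exp (-ψ x)) + s⁻¹ * (b ^ 2 * Real.exp (ψ x)) := by
          rw [Real.exp_neg]
          have hE := Real.exp_pos (ψ x)
          set E := Real.exp (ψ x)
          set r := s * E⁻¹ with hr
          have hr0 : 0 < r := by positivity
          have : s * (a ^ 2 * E⁻¹) + s⁻¹ * (b ^ 2 * E) = r * a ^ 2 + r⁻¹ * b ^ 2 := by
            rw [hr, mul_inv, inv_inv]; ring
          rw [this]
          have h5 : r * a ^ 2 + r⁻¹ * b ^ 2 - 2 * (a * b) = r⁻¹ * (r * a - b) ^ 2 := by field_simp; ring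
          have h6 : 0 ≤ r⁻¹ * (r * a - b) ^ 2 := by positivity
          have h7 : 0 ≤ a * b := by positivity
          linarith
        refine h2.trans ?_
        have h8 : a ^ 2 ≤ ∑ j, ‖db j (mol (rho n) w) x‖ ^ 2 := h1
        gcongr
        linarith
    _ = s * (∫ x, κ x ^ 2 * (∑ j, ‖db j (mol (rho n) w) x‖ ^ 2) * Real.exp (-ψ x)) + s⁻¹ * B := by
        rw [integral_add (i1.const_mul s) (i2.const_mul s⁻¹), integral_const_mul, integral_const_mul]
    _ ≤ s * (16 * δ * M + e / (4 * s)) + s⁻¹ * B := by gcongr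
    _ ≤ e := by
        have h1 : s * (e / (4 * s)) = e / 4 := by field_simp
        have h2 : s * (16 * δ * M) ≤ e / 4 := by
          have : s * (16 * δ * (M + 1)) = e / 4 := by rw [hδ]; field_simp
          nlinarith [mul_pos hs0 hδ0]
        have h3 : s⁻¹ * B ≤ e / 2 := by
          rw [hs, inv_div, div_mul_eq_mul_div, div_le_div_iff₀ (by positivity) (by positivity)]
          nlinarith
        rw [mul_add]; linarith

/-- **Lemma R**. -/
lemma lemR (hψ : ContDiff ℝ ∞ ψ) {w : (ι → ℂ) → ℂ} (hm : AEStronglyMeasurable w)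
    (hw : Integrable (fun x => ‖w x‖ ^ 2 * Real.exp (-ψ x)))
    (hbox : ∀ v, Sm v → HasCompactSupport v → ∫ x, w x * conj (box ψ v x) * wt ψ x = 0) :
    ∃ h, Hol h ∧ w =ᵐ[volume] h := by
  have hwl := locInt_of hψ.continuous hm hw
  have hhol : ∀ {ρ : (ι → ℂ) → ℂ}, Sm ρ → HasCompactSupport ρ → Hol (mol ρ w) := by
    intro ρ hρ hρc
    refine ⟨sm_mol hρ hρc hwl, fun j x => ?_⟩
    rw [db_mol hρ hρc hwl, mol]
    have := weak_hol hψ hm hw hbox (sm_refl hρ x) (hcs_refl hρc x) j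
    simp only [db_refl hρ, mul_neg, integral_neg, neg_eq_zero] at this
    exact this
  refine ⟨mol rt w, hhol sm_rt hcs_rt, ?_⟩
  have hae := ContDiffBump.ae_convolution_tendsto_right_of_locallyIntegrable (φ := fun n : ℕ => bn ι n) (l := Filter.atTop) (K := 2) (μ := volume)
    (by exact tendsto_one_div_add_atTop_nhds_zero_nat (𝕜 := ℝ)) (Filter.Eventually.of_forall fun n => by
      show 1 / ((n:ℝ) + 1) ≤ 2 * (1 / (2 * ((n:ℝ) + 1)))
      apply le_of_eq; field_simp) hwl
  filter_upwards [hae] with x hx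
  have h1 : ∀ n, mol (rho n) w x = ((bn ι n).normed volume ⋆[ContinuousLinearMap.lsmul ℝ ℝ, volume] w) x := by
    intro n
    rw [convolution_lsmul_swap, mol]
    congr 1; ext y
    rw [rho, rh, Complex.real_smul, mul_comm]
  simp only [← h1] at hx
  have h2 : Filter.Tendsto (fun n => mol (rho n) w x) Filter.atTop (𝓝 (mol rt w x)) := by
    have := weak_lim hwl (sm_refl sm_rt x).cont (hcs_refl hcs_rt x)
    refine this.congr fun n => ?_
    exact mol_rt (hhol (sm_rho n) (hcs_rho n)) x
  exact tendsto_nhds_unique hx h2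

end OT

namespace OT
set_option linter.all false
open scoped ContDiff ComplexConjugate Convolution Topology
open Complex (I)
variable {ι : Type} [Fintype ι] [DecidableEq ι]

/-- weighted square integrability -/
def InL (ψ : (ι → ℂ) → ℝ) (u : (ι → ℂ) → ℂ) : Prop :=
  AEStronglyMeasurable u volume ∧ Integrable (fun x => ‖u x‖ ^ 2 * Real.exp (-ψ x))

/-- half weight -/
noncomputable def hf (ψ : (ι → ℂ) → ℝ) (x : ι → ℂ) : ℂ := ((Real.exp (-ψ x / 2) : ℝ) : ℂ)

variable {ψ : (ι → ℂ) → ℝ} (hψ : ContDiff ℝ ∞ ψ)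

lemma hf_sq (x) : hf ψ x * hf ψ x = wt ψ x := by
  unfold hf wt; rw [← Complex.ofReal_mul, ← Real.exp_add]; congr 2; ring
lemma hf_conj (x) : conj (hf ψ x) = hf ψ x := Complex.conj_ofReal _
lemma hf_ne (x) : hf ψ x ≠ 0 := by unfold hf; exact_mod_cast (Real.exp_pos _).ne'
lemma hf_norm (u : (ι → ℂ) → ℂ) (x) : ‖u x * hf ψ x‖ ^ 2 = ‖u x‖ ^ 2 * Real.exp (-ψ x) := by
  rw [norm_mul, mul_pow, hf, Complex.norm_real, Real.norm_of_nonneg (Real.exp_pos _).le, pow_two (Real.exp _), ← Real.exp_add]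
  congr 2; ring

include hψ
lemma hf_cont : Continuous (hf ψ) := by
  unfold hf
  exact Complex.continuous_ofReal.comp (Real.continuous_exp.comp (hψ.continuous.neg.div_const _))

lemma InL.memLp {u} (h : InL ψ u) : MemLp (fun x => u x * hf ψ x) 2 volume := by
  have hm : AEStronglyMeasurable (fun x => u x * hf ψ x) volume := h.1.mul (hf_cont hψ).aestronglyMeasurable
  rw [memLp_two_iff_integrable_sq_norm hm]
  simp only [hf_norm]; exact h.2

lemma inL_of_memLp {u} (h : MemLp (fun x => u x * hf ψ x) 2 volume) : InL ψ u := by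
  constructor
  · have := h.1.mul ((hf_cont hψ).inv₀ hf_ne).aestronglyMeasurable
    refine this.congr (Filter.Eventually.of_forall fun x => ?_)
    simp only [Pi.mul_apply, Pi.inv_apply]
    rw [mul_assoc, mul_inv_cancel₀ (hf_ne x), mul_one]
  · rw [memLp_two_iff_integrable_sq_norm h.1] at h
    simpa only [hf_norm] using h

lemma InL.of_hcs {u} (hu : Continuous u) (hc : HasCompactSupport u) : InL ψ u := by
  refine ⟨hu.aestronglyMeasurable, ?_⟩
  have hexp : Continuous (fun x => Real.exp (-ψ x)) := Real.continuous_exp.comp hψ.continuous.neg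
  refine Continuous.integrable_of_hasCompactSupport ((hu.norm.pow 2).mul hexp) ?_
  have : HasCompactSupport (fun x => ‖u x‖ ^ 2) := hc.comp_left (g := fun t : ℂ => ‖t‖ ^ 2) (by simp)
  exact this.mul_right

lemma InL.sub {u v} (hu : InL ψ u) (hv : InL ψ v) : InL ψ (fun x => u x - v x) := by
  refine inL_of_memLp hψ ?_
  refine ((hu.memLp hψ).sub (hv.memLp hψ)).ae_eq (Filter.Eventually.of_forall fun x => ?_)
  simp only [Pi.sub_apply]; ring

lemma InL.ip_int {u v} (hu : InL ψ u) (hv : InL ψ v) : Integrable (fun x => u x * conj (v x) * wt ψ x) := by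
  have h := (hu.memLp hψ).integrable_mul ((hv.memLp hψ).star)
  refine h.congr (Filter.Eventually.of_forall fun x => ?_)
  simp only [Pi.mul_apply, Pi.star_apply, star_mul', ← hf_sq, RCLike.star_def, hf_conj]; ring

lemma inner_eq {u v : (ι → ℂ) → ℂ} {f g : Lp ℂ 2 (volume : Measure (ι → ℂ))}
    (hf' : f =ᵐ[volume] fun x => u x * hf ψ x) (hg : g =ᵐ[volume] fun x => v x * hf ψ x) :
    inner ℂ g f = ∫ x, u x * conj (v x) * wt ψ x := by
  rw [L2.inner_def]
  refine integral_congr_ae ?_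
  filter_upwards [hf', hg] with x h1 h2
  rw [h1, h2, RCLike.inner_apply, map_mul, hf_conj, ← hf_sq]; ring

omit hψ in
lemma box_add {u v : (ι → ℂ) → ℂ} (hu : Sm u) (hv : Sm v) (x) : box ψ (fun x => u x + v x) x = box ψ u x + box ψ v x := by
  unfold box del
  rw [← neg_add, ← Finset.sum_add_distrib]
  congr 1
  refine Finset.sum_congr rfl fun j _ => ?_
  have e : db j (fun x => u x + v x) = fun x => db j u x + db j v x := by
    ext x; exact db_add j hu hv x
  rw [e, dz_add j (hu.db j) (hv.db j)]; ring
omit hψ in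
lemma box_smul {v : (ι → ℂ) → ℂ} (c : ℂ) (hv : Sm v) (x) : box ψ (fun x => c * v x) x = c * box ψ v x := by
  unfold box del
  rw [mul_neg, Finset.mul_sum]
  congr 1
  refine Finset.sum_congr rfl fun j _ => ?_
  have e : db j (fun x => c * v x) = fun x => c * db j v x := by
    ext x; exact db_const_mul j c hv x
  rw [e, dz_const_mul j c (hv.db j)]; ring

/-- the submodule of `box v` -/
noncomputable def MM (ψ : (ι → ℂ) → ℝ) : Submodule ℂ (Lp ℂ 2 (volume : Measure (ι → ℂ))) where
  carrier := {g | ∃ v, Sm v ∧ HasCompactSupport v ∧ g =ᵐ[volume] fun x => box ψ v x * hf ψ x}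
  add_mem' := by
    rintro a b ⟨u, hu, huc, ha⟩ ⟨v, hv, hvc, hb⟩
    refine ⟨fun x => u x + v x, hu.add hv, huc.add hvc, ?_⟩
    filter_upwards [Lp.coeFn_add a b, ha, hb] with x h1 h2 h3
    rw [h1, Pi.add_apply, h2, h3, box_add hu hv]; ring
  zero_mem' := by
    refine ⟨fun x => 0, Sm.const 0, HasCompactSupport.zero, ?_⟩
    filter_upwards [Lp.coeFn_zero ℂ 2 (volume : Measure (ι → ℂ))] with x h1
    have : box ψ (fun _ => (0:ℂ)) x = 0 := by
      have := box_smul (ψ := ψ) 0 (Sm.const (ι := ι) 0) x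
      simpa using this
    rw [h1, this]; simp
  smul_mem' := by
    rintro c a ⟨u, hu, huc, ha⟩
    refine ⟨fun x => c * u x, (Sm.const c).mul hu, huc.mul_left (f := fun _ => c), ?_⟩
    filter_upwards [Lp.coeFn_smul c a, ha] with x h1 h2
    rw [h1, Pi.smul_apply, h2, box_smul c hu]; simp; ring

lemma mem_orth_iff_hol (g : Lp ℂ 2 (volume : Measure (ι → ℂ))) :
    g ∈ (MM ψ)ᗮ ↔ ∃ h, Hol h ∧ InL ψ h ∧ g =ᵐ[volume] fun x => h x * hf ψ x := by
  constructor
  · intro hg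
    set w : (ι → ℂ) → ℂ := fun x => g x * (hf ψ x)⁻¹ with hw
    have hgw : g =ᵐ[volume] fun x => w x * hf ψ x := Filter.Eventually.of_forall fun x => by
      simp only [hw]; rw [mul_assoc, inv_mul_cancel₀ (hf_ne x), mul_one]
    have hwL : InL ψ w := inL_of_memLp hψ ((Lp.memLp g).ae_eq hgw)
    obtain ⟨h, hh, hwh⟩ := lemR hψ hwL.1 hwL.2 (fun v hv hvc => by
      have hb : InL ψ (box ψ v) := InL.of_hcs hψ (sm_box hψ hv).cont (hcs_box hvc)
      have := (Submodule.mem_orthogonal _ _).1 hg ((hb.memLp hψ).toLp) ⟨v, hv, hvc, MemLp.coeFn_toLp _⟩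
      rw [inner_eq hψ hgw (MemLp.coeFn_toLp _)] at this
      exact this)
    have hgh : g =ᵐ[volume] fun x => h x * hf ψ x := by
      filter_upwards [hgw, hwh] with x h1 h2
      rw [h1, h2]
    exact ⟨h, hh, inL_of_memLp hψ ((Lp.memLp g).ae_eq hgh), hgh⟩
  · rintro ⟨h, hh, hL, hg⟩
    rw [Submodule.mem_orthogonal]
    rintro f ⟨v, hv, hvc, hfv⟩
    rw [inner_eq hψ hg hfv, ibp_box hψ hh.sm hv hvc]
    simp [hh.db]

/-- projection -/
lemma proj {χ : (ι → ℂ) → ℂ} (hχ : InL ψ χ) : ∃ h, Hol h ∧ InL ψ h ∧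
    ∀ k, Hol k → InL ψ k → ∫ x, (χ x - h x) * conj (k x) * wt ψ x = 0 := by
  set X := (hχ.memLp hψ).toLp with hX
  have hXe : X =ᵐ[volume] fun x => χ x * hf ψ x := MemLp.coeFn_toLp _
  obtain ⟨h, hh, hL, he⟩ := (mem_orth_iff_hol hψ _).1 (((MM ψ)ᗮ.orthogonalProjection X).2)
  refine ⟨h, hh, hL, fun k hk hkL => ?_⟩
  set Y := (hkL.memLp hψ).toLp with hY
  have hYe : Y =ᵐ[volume] fun x => k x * hf ψ x := MemLp.coeFn_toLp _
  have hYm : Y ∈ (MM ψ)ᗮ := (mem_orth_iff_hol hψ _).2 ⟨k, hk, hkL, hYe⟩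
  have h1 : inner ℂ Y (X - ((MM ψ)ᗮ.orthogonalProjection X : Lp ℂ 2 (volume : Measure (ι → ℂ)))) = 0 := by
    exact (Submodule.mem_orthogonal _ _).1 (Submodule.sub_starProjection_mem_orthogonal X) Y hYm
  rw [inner_eq hψ (u := fun x => χ x - h x) ?_ hYe] at h1
  · exact h1
  · filter_upwards [Lp.coeFn_sub X ((MM ψ)ᗮ.orthogonalProjection X : Lp ℂ 2 (volume : Measure (ι → ℂ))), hXe, he] with x a1 a2 a3
    rw [a1, Pi.sub_apply, a2, a3]; ring

lemma norm_eq {u : (ι → ℂ) → ℂ} {f : Lp ℂ 2 (volume : Measure (ι → ℂ))}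
    (hf' : f =ᵐ[volume] fun x => u x * hf ψ x) : ‖f‖ ^ 2 = ∫ x, ‖u x‖ ^ 2 * Real.exp (-ψ x) := by
  have h1 := inner_self_eq_norm_sq_to_K (𝕜 := ℂ) f
  rw [inner_eq hψ hf' hf'] at h1
  have : ∀ x, u x * conj (u x) * wt ψ x = ((‖u x‖ ^ 2 * Real.exp (-ψ x) : ℝ) : ℂ) := by
    intro x; rw [Complex.mul_conj, Complex.normSq_eq_norm_sq]; simp [wt]
  simp only [this] at h1
  rw [integral_complex_ofReal] at h1
  have h2 : ((∫ x, ‖u x‖ ^ 2 * Real.exp (-ψ x) : ℝ) : ℂ) = ((‖f‖ ^ 2 : ℝ) : ℂ) := by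
    rw [h1]; push_cast; rfl
  exact (Complex.ofReal_injective h2).symm

/-- approximation by `box v` -/
lemma approx {u : (ι → ℂ) → ℂ} (hu : InL ψ u)
    (hperp : ∀ k, Hol k → InL ψ k → ∫ x, u x * conj (k x) * wt ψ x = 0) {e : ℝ} (he : 0 < e) :
    ∃ v, Sm v ∧ HasCompactSupport v ∧ ∫ x, ‖u x - box ψ v x‖ ^ 2 * Real.exp (-ψ x) ≤ e := by
  set X := (hu.memLp hψ).toLp with hX
  have hXe : X =ᵐ[volume] fun x => u x * hf ψ x := MemLp.coeFn_toLp _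
  have hXm : X ∈ (MM ψ).topologicalClosure := by
    rw [← Submodule.orthogonal_orthogonal_eq_closure, Submodule.mem_orthogonal]
    intro g hg
    obtain ⟨h, hh, hL, hge⟩ := (mem_orth_iff_hol hψ g).1 hg
    rw [inner_eq hψ hXe hge]
    exact hperp h hh hL
  have hXc : X ∈ closure ((MM ψ : Submodule ℂ (Lp ℂ 2 (volume : Measure (ι → ℂ)))) : Set (Lp ℂ 2 (volume : Measure (ι → ℂ)))) := hXm
  obtain ⟨g, ⟨v, hv, hvc, hg⟩, hd⟩ := Metric.mem_closure_iff.1 hXc (Real.sqrt e) (by positivity)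
  refine ⟨v, hv, hvc, ?_⟩
  rw [← norm_eq hψ (f := X - g) (u := fun x => u x - box ψ v x)]
  · rw [dist_eq_norm] at hd
    have := pow_le_pow_left₀ (norm_nonneg _) hd.le 2
    rwa [Real.sq_sqrt he.le] at this
  · filter_upwards [Lp.coeFn_sub X g, hXe, hg] with x a1 a2 a3
    rw [a1, Pi.sub_apply, a2, a3]; ring

lemma cs {u v : (ι → ℂ) → ℂ} (hu : InL ψ u) (hv : InL ψ v) :
    ‖∫ x, u x * conj (v x) * wt ψ x‖ ≤ Real.sqrt (∫ x, ‖u x‖ ^ 2 * Real.exp (-ψ x)) * Real.sqrt (∫ x, ‖v x‖ ^ 2 * Real.exp (-ψ x)) := by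
  have h1 := norm_inner_le_norm (𝕜 := ℂ) ((hv.memLp hψ).toLp) ((hu.memLp hψ).toLp)
  rw [inner_eq hψ (MemLp.coeFn_toLp (hu.memLp hψ)) (MemLp.coeFn_toLp (hv.memLp hψ)), mul_comm] at h1
  rw [← norm_eq hψ (MemLp.coeFn_toLp (hu.memLp hψ)), ← norm_eq hψ (MemLp.coeFn_toLp (hv.memLp hψ)),
    Real.sqrt_sq (norm_nonneg _), Real.sqrt_sq (norm_nonneg _)]
  exact h1

/-- Brascamp–Lieb / Hörmander type inequality -/
lemma BL {u : (ι → ℂ) → ℂ} (hus : Sm u) (hu : InL ψ u)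
    (hperp : ∀ k, Hol k → InL ψ k → ∫ x, u x * conj (k x) * wt ψ x = 0) (i0 : ι) (hdb : ∀ j, j ≠ i0 → ∀ x, db j u x = 0)
    {b : (ι → ℂ) → ℝ} (hb : Continuous b) (hb0 : ∀ x, 0 < b x)
    (hL : ∀ x (a : ι → ℂ), b x * ‖a i0‖ ^ 2 ≤ (∑ j, ∑ k, Lev ψ j k x * a j * conj (a k)).re)
    (hA : Integrable (fun x => ‖db i0 u x‖ ^ 2 / b x * Real.exp (-ψ x))) :
    ∫ x, ‖u x‖ ^ 2 * Real.exp (-ψ x) ≤ ∫ x, ‖db i0 u x‖ ^ 2 / b x * Real.exp (-ψ x) := by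
  set N := ∫ x, ‖u x‖ ^ 2 * Real.exp (-ψ x) with hN
  set A := ∫ x, ‖db i0 u x‖ ^ 2 / b x * Real.exp (-ψ x) with hAdef
  have hN0 : 0 ≤ N := integral_nonneg fun x => by positivity
  have hA0 : 0 ≤ A := integral_nonneg fun x => by have := hb0 x; positivity
  have key : ∀ e > 0, N ≤ Real.sqrt A * (Real.sqrt N + Real.sqrt e) + Real.sqrt N * Real.sqrt e := by
    intro e he
    obtain ⟨v, hv, hvc, hve⟩ := approx hψ hu hperp he
    have hbL : InL ψ (box ψ v) := InL.of_hcs hψ (sm_box hψ hv).cont (hcs_box hvc)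
    have hdL : InL ψ (fun x => u x - box ψ v x) := hu.sub hψ hbL
    set P := ∫ x, ‖box ψ v x‖ ^ 2 * Real.exp (-ψ x) with hP
    have hP0 : 0 ≤ P := integral_nonneg fun x => by positivity
    have e1 : (N : ℂ) = (∫ x, u x * conj (box ψ v x) * wt ψ x) + ∫ x, u x * conj (u x - box ψ v x) * wt ψ x := by
      rw [← integral_add (hu.ip_int hψ hbL) (hu.ip_int hψ hdL), hN, ← integral_complex_ofReal]
      congr 1; ext x
      have : ((‖u x‖ ^ 2 * Real.exp (-ψ x) : ℝ) : ℂ) = u x * conj (u x) * wt ψ x := by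
        rw [Complex.mul_conj, Complex.normSq_eq_norm_sq]; simp [wt]
      rw [this, map_sub]; ring
    have e2 : ‖∫ x, u x * conj (u x - box ψ v x) * wt ψ x‖ ≤ Real.sqrt N * Real.sqrt e :=
      (cs hψ hu hdL).trans (mul_le_mul_of_nonneg_left (Real.sqrt_le_sqrt hve) (Real.sqrt_nonneg _))
    have e3 : ‖∫ x, u x * conj (box ψ v x) * wt ψ x‖ ≤ Real.sqrt A * Real.sqrt P := by
      rw [ibp_box hψ hus hv hvc]
      have : ∀ x, ∑ j, db j u x * conj (db j v x) * wt ψ x = (db i0 u x / (Real.sqrt (b x) : ℂ)) * conj ((Real.sqrt (b x) : ℂ) * db i0 v x) * wt ψ x := by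
        intro x
        rw [Finset.sum_eq_single i0 (fun j _ hj => by rw [hdb j hj]; simp) (by simp)]
        rw [map_mul, Complex.conj_ofReal]
        have : (Real.sqrt (b x) : ℂ) ≠ 0 := by exact_mod_cast (Real.sqrt_pos.2 (hb0 x)).ne'
        field_simp
      simp only [this]
      have hsq : Continuous (fun x => (Real.sqrt (b x) : ℂ)) := Complex.continuous_ofReal.comp hb.sqrt
      have n1 : ∀ x, ‖db i0 u x / (Real.sqrt (b x) : ℂ)‖ ^ 2 = ‖db i0 u x‖ ^ 2 / b x := by
        intro x; rw [norm_div, div_pow, Complex.norm_real, Real.norm_of_nonneg (Real.sqrt_nonneg _), Real.sq_sqrt (hb0 x).le]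
      have n2 : ∀ x, ‖(Real.sqrt (b x) : ℂ) * db i0 v x‖ ^ 2 = b x * ‖db i0 v x‖ ^ 2 := by
        intro x; rw [norm_mul, mul_pow, Complex.norm_real, Real.norm_of_nonneg (Real.sqrt_nonneg _), Real.sq_sqrt (hb0 x).le]
      have L1 : InL ψ (fun x => db i0 u x / (Real.sqrt (b x) : ℂ)) := by
        refine ⟨((hus.db i0).cont.div hsq fun x => by exact_mod_cast (Real.sqrt_pos.2 (hb0 x)).ne').aestronglyMeasurable, ?_⟩
        simpa only [n1] using hA
      have L2 : InL ψ (fun x => (Real.sqrt (b x) : ℂ) * db i0 v x) :=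
        InL.of_hcs hψ (hsq.mul (hv.db i0).cont) ((hcs_db i0 hvc).mul_left (f := fun x => (Real.sqrt (b x) : ℂ)))
      have := cs hψ L1 L2
      simp only [n1, n2] at this
      refine this.trans (mul_le_mul_of_nonneg_left (Real.sqrt_le_sqrt ?_) (Real.sqrt_nonneg _))
      exact box_ineq hψ hv hvc i0 hb hL
    have e4 : Real.sqrt P ≤ Real.sqrt N + Real.sqrt e := by
      have a1 := norm_eq hψ (MemLp.coeFn_toLp (hbL.memLp hψ))
      have a2 := norm_eq hψ (MemLp.coeFn_toLp (hu.memLp hψ))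
      have a3 := norm_eq hψ (MemLp.coeFn_toLp (hdL.memLp hψ))
      have a4 : (hbL.memLp hψ).toLp = (hu.memLp hψ).toLp - (hdL.memLp hψ).toLp := by
        rw [← MemLp.toLp_sub]
        refine MemLp.toLp_congr _ _ (Filter.Eventually.of_forall fun x => ?_)
        simp only [Pi.sub_apply]; ring
      have a5 := norm_sub_le ((hu.memLp hψ).toLp) ((hdL.memLp hψ).toLp)
      rw [← a4] at a5
      rw [hP, hN, ← a1, ← a2, Real.sqrt_sq (norm_nonneg _), Real.sqrt_sq (norm_nonneg _)]
      refine a5.trans (add_le_add le_rfl ?_)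
      refine Real.le_sqrt_of_sq_le ?_
      rw [a3]; exact hve
    calc N = ‖(N : ℂ)‖ := by rw [Complex.norm_real, Real.norm_of_nonneg hN0]
      _ ≤ Real.sqrt A * Real.sqrt P + Real.sqrt N * Real.sqrt e := by
          rw [e1]; exact (norm_add_le _ _).trans (add_le_add e3 e2)
      _ ≤ _ := by gcongr
  have lim : Filter.Tendsto (fun e : ℝ => Real.sqrt A * (Real.sqrt N + Real.sqrt e) + Real.sqrt N * Real.sqrt e) (𝓝[>] 0)
      (𝓝 (Real.sqrt A * (Real.sqrt N + Real.sqrt 0) + Real.sqrt N * Real.sqrt 0)) := by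
    refine Filter.Tendsto.mono_left (Continuous.tendsto ?_ 0) nhdsWithin_le_nhds
    fun_prop
  have h1 := ge_of_tendsto lim (by filter_upwards [self_mem_nhdsWithin] with e he using key e he)
  simp only [Real.sqrt_zero, add_zero, mul_zero] at h1
  have s1 := Real.mul_self_sqrt hN0
  have s2 := Real.mul_self_sqrt hA0
  have s3 := Real.sqrt_nonneg N
  have s4 := Real.sqrt_nonneg A
  by_contra hcon
  push Not at hcon
  have h5 := Real.sqrt_lt_sqrt hA0 hcon
  nlinarith
end OT

namespace OT
set_option linter.all false
open scoped ContDiff ComplexConjugate Convolution Topology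
open Complex (I)
variable {ι : Type} [Fintype ι] [DecidableEq ι]

lemma wz_comp {v : (ι → ℂ) → ℝ} {g g' : ℝ → ℝ} (hv : ContDiff ℝ ∞ v)
    (hg : ∀ x, HasDerivAt g (g' (v x)) (v x)) (j x) :
    wz (fun x => g (v x)) j x = g' (v x) * wz v j x :=
  dz_comp_real j hv (hg x)

lemma lev_comp {v : (ι → ℂ) → ℝ} {g g' g'' : ℝ → ℝ} (hv : ContDiff ℝ ∞ v)
    (hg : ∀ x, HasDerivAt g (g' (v x)) (v x)) (hg' : ∀ x, HasDerivAt g' (g'' (v x)) (v x))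
    (hs : ContDiff ℝ ∞ (fun x => g' (v x))) (j k x) :
    Lev (fun x => g (v x)) j k x = g' (v x) * Lev v j k x + g'' (v x) * wz v j x * conj (wz v k x) := by
  unfold Lev
  have : wz (fun x => g (v x)) j = fun x => ((g' (v x) : ℝ) : ℂ) * wz v j x := by
    ext x; exact wz_comp hv hg j x
  rw [this, db_mul k (Sm.ofReal hs) (sm_wz hv j), db_comp_real k hv (hg' x)]
  have : conj (wz v k x) = db k (fun x => (v x : ℂ)) x := conj_dz_real k hv x
  rw [this]; ring

lemma wz_add {u v : (ι → ℂ) → ℝ} (hu : ContDiff ℝ ∞ u) (hv : ContDiff ℝ ∞ v) (j x) :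
    wz (fun x => u x + v x) j x = wz u j x + wz v j x := by
  unfold wz; rw [← dz_add j (Sm.ofReal hu) (Sm.ofReal hv)]; congr 1; ext x; simp
lemma lev_add {u v : (ι → ℂ) → ℝ} (hu : ContDiff ℝ ∞ u) (hv : ContDiff ℝ ∞ v) (j k x) :
    Lev (fun x => u x + v x) j k x = Lev u j k x + Lev v j k x := by
  unfold Lev
  have : wz (fun x => u x + v x) j = fun x => wz u j x + wz v j x := by ext x; exact wz_add hu hv j x
  rw [this, db_add k (sm_wz hu j) (sm_wz hv j)]
lemma wz_cmul {u : (ι → ℂ) → ℝ} (c : ℝ) (hu : ContDiff ℝ ∞ u) (j x) :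
    wz (fun x => c * u x) j x = c * wz u j x := by
  unfold wz; rw [← dz_const_mul j c (Sm.ofReal hu)]; congr 1; ext x; simp
lemma lev_cmul {u : (ι → ℂ) → ℝ} (c : ℝ) (hu : ContDiff ℝ ∞ u) (j k x) :
    Lev (fun x => c * u x) j k x = c * Lev u j k x := by
  unfold Lev
  have : wz (fun x => c * u x) j = fun x => c * wz u j x := by ext x; exact wz_cmul c hu j x
  rw [this, db_const_mul k c (sm_wz hu j)]
lemma lev_addc {u : (ι → ℂ) → ℝ} (c : ℝ) (hu : ContDiff ℝ ∞ u) (j k x) :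
    Lev (fun x => c + u x) j k x = Lev u j k x := by
  rw [lev_add contDiff_const hu]
  have : Lev (fun _ : ι → ℂ => c) j k x = 0 := by
    unfold Lev wz
    have : dz j (fun _ : ι → ℂ => (c : ℂ)) = fun _ => 0 := by ext x; exact dz_const j _ x
    rw [this, db_const]
  rw [this, zero_add]

lemma sm_nsqP {P : (ι → ℂ) → ℂ} (hP : Sm P) : ContDiff ℝ ∞ (fun x => ‖P x‖ ^ 2) :=
  (contDiff_norm_sq ℝ (E := ℂ)).comp hP

lemma wz_nsqP {P : (ι → ℂ) → ℂ} (hP : Hol P) (j x) : wz (fun x => ‖P x‖ ^ 2) j x = dz j P x * conj (P x) := by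
  unfold wz
  have : (fun x => ((‖P x‖ ^ 2 : ℝ) : ℂ)) = fun x => P x * conj (P x) := by
    ext x; rw [Complex.mul_conj, Complex.normSq_eq_norm_sq]
  rw [this, dz_mul j hP.sm hP.sm.conj, dz_conj j hP.sm, hP.db]; simp

lemma lev_nsqP {P : (ι → ℂ) → ℂ} (hP : Hol P) (j k x) :
    Lev (fun x => ‖P x‖ ^ 2) j k x = dz j P x * conj (dz k P x) := by
  unfold Lev
  have : wz (fun x => ‖P x‖ ^ 2) j = fun x => dz j P x * conj (P x) := by ext x; exact wz_nsqP hP j x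
  rw [this, db_mul k (hP.sm.dz j) hP.sm.conj, db_conj k hP.sm, db_dz_comm k j hP.sm]
  have : db k P = fun _ => 0 := by ext x; exact hP.db k x
  rw [this, dz_const]; simp

lemma sm_logP {P : (ι → ℂ) → ℂ} (hP : Sm P) {c : ℝ} (hc : 0 < c) : ContDiff ℝ ∞ (fun x => Real.log (‖P x‖ ^ 2 + c)) := by
  refine ContDiff.log ((sm_nsqP hP).add contDiff_const) fun x => ?_
  positivity

lemma wz_logP {P : (ι → ℂ) → ℂ} (hP : Hol P) {c : ℝ} (hc : 0 < c) (j x) :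
    wz (fun x => Real.log (‖P x‖ ^ 2 + c)) j x = dz j P x * conj (P x) / ((‖P x‖ ^ 2 + c : ℝ) : ℂ) := by
  have h := wz_comp (v := fun x => ‖P x‖ ^ 2) (g := fun s => Real.log (s + c)) (g' := fun s => 1 / (s + c)) (sm_nsqP hP.sm)
    (fun x => by
      have h0 : ‖P x‖ ^ 2 + c ≠ 0 := by positivity
      exact ((hasDerivAt_id' (‖P x‖ ^ 2)).add_const c).log h0) j x
  rw [h, wz_nsqP hP]; push_cast; ring

lemma lev_logP {P : (ι → ℂ) → ℂ} (hP : Hol P) {c : ℝ} (hc : 0 < c) (j k x) :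
    Lev (fun x => Real.log (‖P x‖ ^ 2 + c)) j k x =
      ((c / (‖P x‖ ^ 2 + c) ^ 2 : ℝ) : ℂ) * (dz j P x * conj (dz k P x)) := by
  have h := lev_comp (v := fun x => ‖P x‖ ^ 2) (g := fun s => Real.log (s + c)) (g' := fun s => 1 / (s + c))
    (g'' := fun s => - 1 / (s + c) ^ 2) (sm_nsqP hP.sm)
    (fun x => by
      have h0 : ‖P x‖ ^ 2 + c ≠ 0 := by positivity
      exact ((hasDerivAt_id' (‖P x‖ ^ 2)).add_const c).log h0)
    (fun x => by
      have h0 : ‖P x‖ ^ 2 + c ≠ 0 := by positivity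
      have := ((hasDerivAt_id' (‖P x‖ ^ 2)).add_const c).inv h0
      simp only [one_div]; exact this)
    (by
      refine ContDiff.div contDiff_const ((sm_nsqP hP.sm).add contDiff_const) fun x => ?_
      positivity) j k x
  rw [h, lev_nsqP hP, wz_nsqP hP, wz_nsqP hP]
  have h0 : ‖P x‖ ^ 2 + c ≠ 0 := by positivity
  have e : conj (dz k P x * conj (P x)) = conj (dz k P x) * P x := by simp
  have e2 : P x * conj (P x) = ((‖P x‖ ^ 2 : ℝ) : ℂ) := by rw [Complex.mul_conj, Complex.normSq_eq_norm_sq]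
  rw [e]
  have h1 : ((c / (‖P x‖ ^ 2 + c) ^ 2 : ℝ) : ℂ) = ((1 / (‖P x‖ ^ 2 + c) : ℝ) : ℂ) + ((-1 / (‖P x‖ ^ 2 + c) ^ 2 : ℝ) : ℂ) * ((‖P x‖ ^ 2 : ℝ) : ℂ) := by
    rw [← Complex.ofReal_mul, ← Complex.ofReal_add]; congr 1; field_simp; ring
  rw [h1, ← e2]; ring

lemma hol_proj (i : ι) : Hol (fun x : ι → ℂ => x i) := ⟨Sm.proj i, fun j x => db_proj j i x⟩

/-- sum of squares form -/
noncomputable def LF (ψ : (ι → ℂ) → ℝ) (x a : ι → ℂ) : ℂ := ∑ j, ∑ k, Lev ψ j k x * a j * conj (a k)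

lemma LF_rank1 {ψ : (ι → ℂ) → ℝ} {x : ι → ℂ} {r : ℝ} {p : ι → ℂ} (h : ∀ j k, Lev ψ j k x = (r : ℂ) * (p j * conj (p k))) (a : ι → ℂ) :
    LF ψ x a = ((r * ‖∑ j, p j * a j‖ ^ 2 : ℝ) : ℂ) := by
  have : ((‖∑ j, p j * a j‖ ^ 2 : ℝ) : ℂ) = (∑ j, p j * a j) * conj (∑ k, p k * a k) := by
    rw [Complex.mul_conj, Complex.normSq_eq_norm_sq]
  rw [Complex.ofReal_mul, this, map_sum, Finset.sum_mul_sum, Finset.mul_sum]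
  unfold LF
  refine Finset.sum_congr rfl fun j _ => ?_
  rw [Finset.mul_sum]
  refine Finset.sum_congr rfl fun k _ => ?_
  rw [h, map_mul]; ring

lemma LF_add {u v : (ι → ℂ) → ℝ} (hu : ContDiff ℝ ∞ u) (hv : ContDiff ℝ ∞ v) (x a) :
    LF (fun x => u x + v x) x a = LF u x a + LF v x a := by
  unfold LF
  simp only [lev_add hu hv, add_mul, Finset.sum_add_distrib]
lemma LF_cmul {u : (ι → ℂ) → ℝ} (c : ℝ) (hu : ContDiff ℝ ∞ u) (x a) :
    LF (fun x => c * u x) x a = c * LF u x a := by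
  unfold LF
  simp only [lev_cmul c hu, Finset.mul_sum, mul_assoc]
lemma LF_addc {u : (ι → ℂ) → ℝ} (c : ℝ) (hu : ContDiff ℝ ∞ u) (x a) :
    LF (fun x => c + u x) x a = LF u x a := by
  unfold LF
  simp only [lev_addc c hu]

lemma LF_sum {κ : Type} (s : Finset κ) {u : κ → (ι → ℂ) → ℝ} (hu : ∀ i, ContDiff ℝ ∞ (u i)) (x a) :
    LF (fun x => ∑ i ∈ s, u i x) x a = ∑ i ∈ s, LF (u i) x a := by
  classical
  induction s using Finset.induction_on with
  | empty =>
    simp only [Finset.sum_empty]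
    have := LF_cmul (u := fun _ : ι → ℂ => (0:ℝ)) 0 contDiff_const x a
    simpa using this
  | insert i s hi ih =>
    simp only [Finset.sum_insert hi]
    rw [LF_add (hu i) (ContDiff.sum fun i _ => hu i), ih]

lemma LF_nsqs (x a : ι → ℂ) : LF (fun x : ι → ℂ => ∑ i, ‖x i‖ ^ 2) x a = ((∑ i, ‖a i‖ ^ 2 : ℝ) : ℂ) := by
  rw [LF_sum _ (fun i => sm_nsq i), Complex.ofReal_sum]
  refine Finset.sum_congr rfl fun i _ => ?_
  rw [LF_rank1 (r := 1) (p := fun j => if j = i then 1 else 0)]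
  · simp
  · intro j k
    rw [lev_nsqP (hol_proj i), dz_proj, dz_proj]; simp

lemma LF_logP {P : (ι → ℂ) → ℂ} (hP : Hol P) {c : ℝ} (hc : 0 < c) (x a) :
    LF (fun x => Real.log (‖P x‖ ^ 2 + c)) x a = ((c / (‖P x‖ ^ 2 + c) ^ 2 * ‖∑ j, dz j P x * a j‖ ^ 2 : ℝ) : ℂ) :=
  LF_rank1 (fun j k => lev_logP hP hc j k x) a

lemma LF_logt (i0 : ι) {c : ℝ} (hc : 0 < c) (x a : ι → ℂ) :
    LF (fun x : ι → ℂ => Real.log (‖x i0‖ ^ 2 + c)) x a = ((c / (‖x i0‖ ^ 2 + c) ^ 2 * ‖a i0‖ ^ 2 : ℝ) : ℂ) := by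
  rw [LF_logP (hol_proj i0) hc]
  simp [dz_proj]

lemma LF_comp {v : (ι → ℂ) → ℝ} {g g' g'' : ℝ → ℝ} (hv : ContDiff ℝ ∞ v)
    (hg : ∀ x, HasDerivAt g (g' (v x)) (v x)) (hg' : ∀ x, HasDerivAt g' (g'' (v x)) (v x))
    (hs : ContDiff ℝ ∞ (fun x => g' (v x))) (x a) :
    LF (fun x => g (v x)) x a = g' (v x) * LF v x a + ((g'' (v x) * ‖∑ j, wz v j x * a j‖ ^ 2 : ℝ) : ℂ) := by
  have : ((‖∑ j, wz v j x * a j‖ ^ 2 : ℝ) : ℂ) = (∑ j, wz v j x * a j) * conj (∑ k, wz v k x * a k) := by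
    rw [Complex.mul_conj, Complex.normSq_eq_norm_sq]
  rw [Complex.ofReal_mul, this, map_sum, Finset.sum_mul_sum, Finset.mul_sum]
  unfold LF
  rw [Finset.mul_sum, ← Finset.sum_add_distrib]
  refine Finset.sum_congr rfl fun j _ => ?_
  rw [Finset.mul_sum, Finset.mul_sum, ← Finset.sum_add_distrib]
  refine Finset.sum_congr rfl fun k _ => ?_
  rw [lev_comp hv hg hg' hs, map_mul]; ring

section weights
variable (i0 : ι) (e : ℝ)
/-- the auxiliary function `z` -/
noncomputable def zz (x : ι → ℂ) : ℝ := 1 + (Real.log (‖x i0‖ ^ 2 + 1) + (-1) * Real.log (‖x i0‖ ^ 2 + e ^ 2))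
/-- the twist -/
noncomputable def tht (x : ι → ℂ) : ℝ := - Real.log (zz i0 e x)

variable {e} (he : 0 < e) (he1 : e ≤ 1)
include he
lemma sm_zz : ContDiff ℝ ∞ (zz i0 e) :=
  contDiff_const.add ((sm_logP (Sm.proj i0) one_pos).add (contDiff_const.mul (sm_logP (Sm.proj i0) (by positivity))))

lemma LF_zz (x a) : LF (zz i0 e) x a = (((1 / (‖x i0‖ ^ 2 + 1) ^ 2 - e ^ 2 / (‖x i0‖ ^ 2 + e ^ 2) ^ 2) * ‖a i0‖ ^ 2 : ℝ) : ℂ) := by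
  have h1 := sm_logP (Sm.proj i0) one_pos
  have h2 := sm_logP (Sm.proj i0) (c := e ^ 2) (by positivity)
  have h3 : ContDiff ℝ ∞ (fun x : ι → ℂ => (-1) * Real.log (‖x i0‖ ^ 2 + e ^ 2)) := contDiff_const.mul h2
  unfold zz
  rw [LF_addc 1 (h1.add h3), LF_add h1 h3, LF_cmul _ h2, LF_logt i0 one_pos, LF_logt i0 (by positivity)]
  push_cast; ring

lemma wz_zz (j) (x) : wz (zz i0 e) j x = if j = i0 then conj (x i0) * ((1 / (‖x i0‖ ^ 2 + 1) - 1 / (‖x i0‖ ^ 2 + e ^ 2) : ℝ) : ℂ) else 0 := by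
  have h1 := sm_logP (Sm.proj i0) one_pos
  have h2 := sm_logP (Sm.proj i0) (c := e ^ 2) (by positivity)
  have h3 : ContDiff ℝ ∞ (fun x : ι → ℂ => (-1) * Real.log (‖x i0‖ ^ 2 + e ^ 2)) := contDiff_const.mul h2
  unfold zz
  rw [wz_add contDiff_const (h1.add h3), wz_add h1 h3, wz_cmul _ h2, wz_logP (hol_proj i0) one_pos, wz_logP (hol_proj i0) (by positivity),
    dz_proj]
  have : wz (fun _ : ι → ℂ => (1:ℝ)) j x = 0 := dz_const j _ x
  rw [this]
  split_ifs <;> push_cast <;> ring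

include he1
lemma zz_ge (x) : 1 ≤ zz i0 e x := by
  unfold zz
  have : Real.log (‖x i0‖ ^ 2 + e ^ 2) ≤ Real.log (‖x i0‖ ^ 2 + 1) := Real.log_le_log (by positivity) (by nlinarith)
  linarith
lemma zz_le (x) : zz i0 e x * (‖x i0‖ ^ 2 + e ^ 2) ≤ 1 + ‖x i0‖ ^ 2 := by
  have ha : 0 < ‖x i0‖ ^ 2 + e ^ 2 := by positivity
  have hb : 0 < ‖x i0‖ ^ 2 + 1 := by positivity
  rw [← le_div_iff₀ ha]
  unfold zz
  have := Real.log_le_sub_one_of_pos (div_pos hb ha)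
  rw [Real.log_div hb.ne' ha.ne'] at this
  rw [add_comm 1 (‖x i0‖ ^ 2)]; linarith
lemma sm_tht : ContDiff ℝ ∞ (tht i0 e) :=
  ((sm_zz i0 he).log fun x => by have := zz_ge i0 he he1 x; positivity).neg
lemma exp_tht (x) : Real.exp (tht i0 e x) = (zz i0 e x)⁻¹ := by
  rw [tht, Real.exp_neg, Real.exp_log (by have := zz_ge i0 he he1 x; positivity)]

lemma wz_tht (j) (x) : wz (tht i0 e) j x = -(wz (zz i0 e) j x) / (zz i0 e x : ℂ) := by
  have h := wz_comp (v := zz i0 e) (g := fun s => - Real.log s) (g' := fun s => - s⁻¹) (sm_zz i0 he)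
    (fun x => (Real.hasDerivAt_log (by have := zz_ge i0 he he1 x; positivity)).neg) j x
  have h' : wz (tht i0 e) j x = _ := h
  rw [h']; push_cast; ring

lemma LF_tht (x a) : LF (tht i0 e) x a = (((e ^ 2 / (‖x i0‖ ^ 2 + e ^ 2) ^ 2 - 1 / (‖x i0‖ ^ 2 + 1) ^ 2) / zz i0 e x * ‖a i0‖ ^ 2
      + ‖wz (tht i0 e) i0 x‖ ^ 2 * ‖a i0‖ ^ 2 : ℝ) : ℂ) := by
  have hz : ∀ x, zz i0 e x ≠ 0 := fun x => by have := zz_ge i0 he he1 x; positivity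
  have h := LF_comp (v := zz i0 e) (g := fun s => - Real.log s) (g' := fun s => - s⁻¹) (g'' := fun s => (s ^ 2)⁻¹) (sm_zz i0 he)
    (fun x => (Real.hasDerivAt_log (hz x)).neg)
    (fun x => by have := (hasDerivAt_inv (hz x)).neg; rw [neg_neg] at this; exact this) ((sm_zz i0 he).inv hz).neg x a
  have h' : LF (tht i0 e) x a = _ := h
  rw [h', LF_zz i0 he, ← Complex.ofReal_mul, ← Complex.ofReal_add, wz_tht i0 he he1]
  congr 1
  have : ∑ j, wz (zz i0 e) j x * a j = wz (zz i0 e) i0 x * a i0 := by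
    refine Finset.sum_eq_single i0 (fun j _ hj => ?_) (by simp)
    rw [wz_zz i0 he, if_neg hj, zero_mul]
  rw [this, norm_mul, norm_div, norm_neg, Complex.norm_real, Real.norm_of_nonneg (by have := zz_ge i0 he he1 x; positivity)]
  have := hz x
  field_simp; ring

lemma tht_T (x) : ‖wz (tht i0 e) i0 x‖ ^ 2 * (zz i0 e x * (‖x i0‖ ^ 2 + e ^ 2)) ^ 2 ≤ ‖x i0‖ ^ 2 := by
  have hz := zz_ge i0 he he1 x
  have ha : 0 < ‖x i0‖ ^ 2 + e ^ 2 := by positivity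
  rw [wz_tht i0 he he1, norm_div, norm_neg, Complex.norm_real, Real.norm_of_nonneg (by positivity), wz_zz i0 he, if_pos rfl, norm_mul,
    RCLike.norm_conj, Complex.norm_real]
  have h1 : |1 / (‖x i0‖ ^ 2 + 1) - 1 / (‖x i0‖ ^ 2 + e ^ 2)| ≤ 1 / (‖x i0‖ ^ 2 + e ^ 2) := by
    have : 0 < 1 / (‖x i0‖ ^ 2 + 1) := by positivity
    have h2 : 1 / (‖x i0‖ ^ 2 + 1) ≤ 1 / (‖x i0‖ ^ 2 + e ^ 2) := one_div_le_one_div_of_le ha (by nlinarith)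
    rw [abs_le]; constructor <;> linarith
  rw [Real.norm_eq_abs]
  set A := |1 / (‖x i0‖ ^ 2 + 1) - 1 / (‖x i0‖ ^ 2 + e ^ 2)|
  have hA : A * (‖x i0‖ ^ 2 + e ^ 2) ≤ 1 := by rwa [le_div_iff₀ ha] at h1
  have hA0 : 0 ≤ A * (‖x i0‖ ^ 2 + e ^ 2) := mul_nonneg (abs_nonneg _) ha.le
  have hzz : zz i0 e x ≠ 0 := by positivity
  have : (‖x i0‖ * A / zz i0 e x) ^ 2 * (zz i0 e x * (‖x i0‖ ^ 2 + e ^ 2)) ^ 2 = ‖x i0‖ ^ 2 * (A * (‖x i0‖ ^ 2 + e ^ 2)) ^ 2 := by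
    field_simp
  rw [this]
  exact mul_le_of_le_one_right (by positivity) (pow_le_one₀ hA0 hA)
end weights
end OT

namespace OT
set_option linter.all false
open scoped ContDiff ComplexConjugate Convolution Topology
open Complex (I)
variable {ι : Type} [Fintype ι] [DecidableEq ι]


lemma gauss1 : Integrable (fun z : ℂ => Real.exp (-(2 * ‖z‖ ^ 2))) := by
  have h := GaussianFourier.integrable_cexp_neg_mul_sq_norm_add (V := ℂ) (b := 2) (by simp) 0 0
  refine h.norm.congr (Filter.Eventually.of_forall fun z => ?_)
  simp only [Complex.norm_exp]
  congr 1
  simp [← Complex.ofReal_pow]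

lemma gauss_eq (x : ι → ℂ) : Real.exp (-(2 * ∑ i, ‖x i‖ ^ 2)) = ∏ i, Real.exp (-(2 * ‖x i‖ ^ 2)) := by
  rw [← Real.exp_sum, Finset.mul_sum, Finset.sum_neg_distrib]

lemma gauss_int : Integrable (fun x : ι → ℂ => Real.exp (-(2 * ∑ i, ‖x i‖ ^ 2))) := by
  simp only [gauss_eq]
  exact Integrable.fintype_prod (fun i => gauss1)

/-- the weight -/
noncomputable def ph (F : (ι → ℂ) → ℂ) (lam η : ℝ) (x : ι → ℂ) : ℝ := lam * Real.log (‖F x‖ ^ 2 + η) + 2 * ∑ i, ‖x i‖ ^ 2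

section
variable {F : (ι → ℂ) → ℂ} {lam η : ℝ}
lemma sm_ph (hF : Sm F) (hη : 0 < η) : ContDiff ℝ ∞ (ph F lam η) :=
  (contDiff_const.mul (sm_logP hF hη)).add (contDiff_const.mul sm_nsqs)

lemma exp_ph (hη : 0 < η) (x) : Real.exp (-ph F lam η x) = (‖F x‖ ^ 2 + η) ^ (-lam) * Real.exp (-(2 * ∑ i, ‖x i‖ ^ 2)) := by
  rw [Real.rpow_def_of_pos (by positivity), ← Real.exp_add, ph]; congr 1; ring

lemma int_ph (hF : Sm F) (hlam : 0 ≤ lam) (hη : 0 < η) : Integrable (fun x => Real.exp (-ph F lam η x)) := by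
  refine Integrable.mono' (gauss_int.const_mul (η ^ (-lam))) ?_ (Filter.Eventually.of_forall fun x => ?_)
  · exact (Real.continuous_exp.comp (sm_ph hF hη).continuous.neg).aestronglyMeasurable
  · rw [Real.norm_of_nonneg (Real.exp_pos _).le, exp_ph hη]
    refine mul_le_mul_of_nonneg_right ?_ (Real.exp_pos _).le
    rw [Real.rpow_neg (by positivity), Real.rpow_neg hη.le]
    exact inv_anti₀ (Real.rpow_pos_of_pos hη _) (Real.rpow_le_rpow hη.le (by nlinarith [sq_nonneg ‖F x‖]) hlam)
end

lemma real1 {s a z T b : ℝ} (hs : 0 ≤ s) (ha : 0 < a) (hz : 1 ≤ z) (hT : 0 ≤ T) (hb : 1 ≤ b) (h1 : z * a ≤ 1 + s)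
    (h2 : T * (z * a) ^ 2 ≤ s) (h3 : s ≤ a) : a / (3 + s) ≤ z⁻¹ * ((b / 2) / (b / 2 + T)) := by
  have hza : 0 < z * a := by positivity
  have h4 : T * (z * a) ≤ 1 := by
    have : T * (z * a) * (z * a) ≤ 1 * (z * a) := by
      calc T * (z * a) * (z * a) = T * (z * a) ^ 2 := by ring
        _ ≤ s := h2
        _ ≤ a := h3
        _ ≤ 1 * (z * a) := by nlinarith
    exact le_of_mul_le_mul_right this hza
  have : z⁻¹ * ((b / 2) / (b / 2 + T)) = (b / 2) / (z * (b / 2 + T)) := by field_simp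
  rw [this, div_le_div_iff₀ (by positivity) (by positivity)]
  nlinarith [mul_le_mul_of_nonneg_right h1 (by positivity : 0 ≤ b/2)]

lemma real2 (x y : ℂ) {b T : ℝ} (hb : 0 < b) (hT : 0 ≤ T) :
    ‖x + y‖ ^ 2 / (b + T) ≤ 2 / b * ‖x‖ ^ 2 + ‖y‖ ^ 2 / (b / 2 + T) := by
  have h1 := norm_add_le x y
  have h2 : ‖x + y‖ ^ 2 ≤ (‖x‖ + ‖y‖) ^ 2 := pow_le_pow_left₀ (norm_nonneg _) h1 2
  refine (div_le_div_of_nonneg_right h2 (by positivity)).trans ?_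
  have e : 2 / b * ‖x‖ ^ 2 + ‖y‖ ^ 2 / (b / 2 + T) - (‖x‖ + ‖y‖) ^ 2 / (b + T) =
      ((b / 2 + T) * ‖x‖ - b / 2 * ‖y‖) ^ 2 / ((b / 2) * (b / 2 + T) * (b + T)) := by
    have h3 : b / 2 + T ≠ 0 := by positivity
    have h4 : b + T ≠ 0 := by positivity
    have h5 : b + 2 * T ≠ 0 := by positivity
    have h6 : b / 2 + T = (b + 2 * T) / 2 := by ring
    rw [h6]
    field_simp; ring
  have : 0 ≤ ((b / 2 + T) * ‖x‖ - b / 2 * ‖y‖) ^ 2 / ((b / 2) * (b / 2 + T) * (b + T)) := by positivity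
  linarith

set_option maxHeartbeats 2000000 in
/-- twisted estimate -/
lemma OT1 {F : (ι → ℂ) → ℂ} (hF : Hol F) {lam η : ℝ} (hlam : 0 ≤ lam) (hη : 0 < η) (i0 : ι) {d e C : ℝ} (hd : 0 < d) (hde : d ≤ e) (he1 : e ≤ 1)
    {χ : (ι → ℂ) → ℂ} (hχ : Sm χ) (hχ1 : ∀ x, ‖χ x‖ ≤ 1) (hχj : ∀ j, j ≠ i0 → ∀ x, db j χ x = 0)
    (hχs : ∀ x, db i0 χ x ≠ 0 → e / 2 ≤ ‖x i0‖ ∧ ‖x i0‖ ≤ e) (hχC : ∀ x, ‖db i0 χ x‖ ≤ C / e) :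
    ∃ h, Hol h ∧ Integrable (fun x => ‖χ x - h x‖ ^ 2 * ((‖x i0‖ ^ 2 + e ^ 2) / (3 + ‖x i0‖ ^ 2) / (‖x i0‖ ^ 2 + d ^ 2)) * Real.exp (-ph F lam η x)) ∧
      ∫ x, ‖χ x - h x‖ ^ 2 * ((‖x i0‖ ^ 2 + e ^ 2) / (3 + ‖x i0‖ ^ 2) / (‖x i0‖ ^ 2 + d ^ 2)) * Real.exp (-ph F lam η x) ≤
        32 * C ^ 2 / e ^ 2 * ∫ x in {x : ι → ℂ | ‖x i0‖ ≤ e}, Real.exp (-ph F lam η x) := by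
  have he : 0 < e := hd.trans_le hde
  have sph : ContDiff ℝ ∞ (ph F lam η) := sm_ph hF.sm hη
  have iph := int_ph (η := η) hF.sm hlam hη
  have sG : ContDiff ℝ ∞ (fun x : ι → ℂ => Real.log (‖x i0‖ ^ 2 + d ^ 2)) := sm_logP (Sm.proj i0) (by positivity)
  have sT := sm_tht i0 he he1
  set p0 : (ι → ℂ) → ℝ := fun x => ph F lam η x + Real.log (‖x i0‖ ^ 2 + d ^ 2) with hp0
  have sp0 : ContDiff ℝ ∞ p0 := sph.add sG
  set p1 : (ι → ℂ) → ℝ := fun x => p0 x + tht i0 e x with hp1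
  have sp1 : ContDiff ℝ ∞ p1 := sp0.add sT
  have zge := zz_ge i0 he he1
  have zpos : ∀ x, 0 < zz i0 e x := fun x => one_pos.trans_le (zge x)
  have zc : Continuous (zz i0 e) := (sm_zz i0 he).continuous
  have ep0 : ∀ x, Real.exp (-p0 x) = Real.exp (-ph F lam η x) / (‖x i0‖ ^ 2 + d ^ 2) := by
    intro x
    simp only [hp0]
    rw [neg_add, Real.exp_add, Real.exp_neg (Real.log _), Real.exp_log (by positivity)]; rfl
  have ep1 : ∀ x, Real.exp (-p1 x) = Real.exp (-p0 x) * zz i0 e x := by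
    intro x
    simp only [hp1]
    rw [neg_add, Real.exp_add, Real.exp_neg (tht i0 e x), exp_tht i0 he he1, inv_inv]
  have i0e : Continuous (fun x => Real.exp (-p0 x)) := Real.continuous_exp.comp sp0.continuous.neg
  have ep0le : ∀ x, Real.exp (-p0 x) ≤ (d ^ 2)⁻¹ * Real.exp (-ph F lam η x) := by
    intro x
    rw [ep0, div_eq_inv_mul]
    exact mul_le_mul_of_nonneg_right (inv_anti₀ (by positivity) (by nlinarith [sq_nonneg ‖x i0‖])) (Real.exp_pos _).le
  have ip0 : Integrable (fun x => Real.exp (-p0 x)) := by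
    refine Integrable.mono' (iph.const_mul (d ^ 2)⁻¹) i0e.aestronglyMeasurable (Filter.Eventually.of_forall fun x => ?_)
    rw [Real.norm_of_nonneg (Real.exp_pos _).le]; exact ep0le x
  have hχL : InL p0 χ := by
    refine ⟨hχ.cont.aestronglyMeasurable, Integrable.mono' ip0 ((hχ.cont.norm.pow 2).mul i0e).aestronglyMeasurable (Filter.Eventually.of_forall fun x => ?_)⟩
    rw [Real.norm_of_nonneg (by positivity)]
    exact mul_le_of_le_one_left (Real.exp_pos _).le (pow_le_one₀ (norm_nonneg _) (hχ1 x))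
  obtain ⟨h, hh, hhL, hperp⟩ := proj sp0 hχL
  set u : (ι → ℂ) → ℂ := fun x => χ x - h x with hu
  have su : Sm u := hχ.sub hh.sm
  have uL : InL p0 u := hχL.sub sp0 hhL
  have dbu : ∀ j x, db j u x = db j χ x := fun j x => by
    rw [hu, db_sub j hχ hh.sm, hh.db, sub_zero]
  set E : (ι → ℂ) → ℝ := fun x => Real.exp (tht i0 e x) with hE
  have sE : ContDiff ℝ ∞ E := Real.contDiff_exp.comp sT
  have eE : ∀ x, E x = (zz i0 e x)⁻¹ := exp_tht i0 he he1
  set U : (ι → ℂ) → ℂ := fun x => u x * (E x : ℂ) with hU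
  have sU : Sm U := su.mul (Sm.ofReal sE)
  -- the weight W
  set W : (ι → ℂ) → ℝ := fun x => Real.exp (-p0 x) * (zz i0 e x)⁻¹ with hW
  have Wc : Continuous W := i0e.mul (zc.inv₀ fun x => (zpos x).ne')
  have W0 : ∀ x, 0 ≤ W x := fun x => mul_nonneg (Real.exp_pos _).le (inv_nonneg.2 (zpos x).le)
  have Wle : ∀ x, W x ≤ Real.exp (-p0 x) := fun x => mul_le_of_le_one_right (Real.exp_pos _).le (inv_le_one_of_one_le₀ (zge x))
  have EW : ∀ x, E x ^ 2 * Real.exp (-p1 x) = W x := by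
    intro x; rw [ep1, eE, hW]; have := (zpos x).ne'; field_simp
  have nU : ∀ x, ‖U x‖ ^ 2 * Real.exp (-p1 x) = ‖u x‖ ^ 2 * W x := by
    intro x
    rw [hU, norm_mul, Complex.norm_real, Real.norm_eq_abs, mul_pow, sq_abs, mul_assoc, EW]
  have iuW : Integrable (fun x => ‖u x‖ ^ 2 * W x) := by
    refine Integrable.mono' uL.2 ((su.cont.norm.pow 2).mul Wc).aestronglyMeasurable (Filter.Eventually.of_forall fun x => ?_)
    rw [Real.norm_of_nonneg (mul_nonneg (by positivity) (W0 x))]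
    exact mul_le_mul_of_nonneg_left (Wle x) (by positivity)
  have UL : InL p1 U := ⟨sU.cont.aestronglyMeasurable, by simpa only [nU] using iuW⟩
  have Uperp : ∀ k, Hol k → InL p1 k → ∫ x, U x * conj (k x) * wt p1 x = 0 := by
    intro k hk hkL
    have hk0 : InL p0 k := by
      refine ⟨hkL.1, Integrable.mono' hkL.2 ((hk.sm.cont.norm.pow 2).mul i0e).aestronglyMeasurable (Filter.Eventually.of_forall fun x => ?_)⟩
      rw [Real.norm_of_nonneg (by positivity), ep1]
      exact mul_le_mul_of_nonneg_left (le_mul_of_one_le_right (Real.exp_pos _).le (zge x)) (by positivity)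
    rw [← hperp k hk hk0]
    congr 1; ext x
    have : (E x : ℂ) * wt p1 x = wt p0 x := by
      simp only [wt]; rw [← Complex.ofReal_mul, ep1, eE]; congr 1
      have := (zpos x).ne'; field_simp
    rw [← this, hU]; ring
  set T : (ι → ℂ) → ℝ := fun x => ‖wz (tht i0 e) i0 x‖ ^ 2 with hT
  have Tc : Continuous T := (sm_wz sT i0).cont.norm.pow 2
  have T0 : ∀ x, 0 ≤ T x := fun x => by positivity
  set b1 : (ι → ℂ) → ℝ := fun x => 1 + e ^ 2 / (zz i0 e x * (‖x i0‖ ^ 2 + e ^ 2) ^ 2) with hb1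
  have nc : Continuous (fun x : ι → ℂ => ‖x i0‖ ^ 2) := (sm_nsq i0).continuous
  have b1c : Continuous b1 := continuous_const.add (continuous_const.div (zc.mul ((nc.add continuous_const).pow 2)) fun x => by
    have := zpos x; positivity)
  have b1ge : ∀ x, 1 ≤ b1 x := fun x => by
    have := zpos x; simp only [hb1]; rw [le_add_iff_nonneg_right]; positivity
  have b1pos : ∀ x, 0 < b1 x := fun x => one_pos.trans_le (b1ge x)
  have dbE : ∀ j x, db j (fun x => (E x : ℂ)) x = E x * conj (wz (tht i0 e) j x) := by
    intro j x
    have := db_comp_real j (φ := Real.exp) sT (Real.hasDerivAt_exp (tht i0 e x))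
    rw [← conj_dz_real j sT] at this
    exact this
  have dbU : ∀ j x, db j U x = (db j χ x + u x * conj (wz (tht i0 e) j x)) * E x := by
    intro j x; rw [hU, db_mul j su (Sm.ofReal sE), dbE, dbu]; ring
  have dbU0 : ∀ j, j ≠ i0 → ∀ x, db j U x = 0 := by
    intro j hj x
    rw [dbU, hχj j hj, wz_tht i0 he he1, wz_zz i0 he, if_neg hj]; simp
  have ndbU : ∀ x, ‖db i0 U x‖ ^ 2 / (b1 x + T x) * Real.exp (-p1 x) = ‖db i0 χ x + u x * conj (wz (tht i0 e) i0 x)‖ ^ 2 / (b1 x + T x) * W x := by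
    intro x
    rw [dbU, norm_mul, Complex.norm_real, Real.norm_eq_abs, mul_pow, sq_abs, ← EW]; ring
  set K : ℝ := 32 * C ^ 2 / e ^ 2 with hK
  set S : Set (ι → ℂ) := {x | ‖x i0‖ ≤ e} with hS
  have Sm' : MeasurableSet S := (isClosed_le (continuous_apply i0).norm continuous_const).measurableSet
  set g1 : (ι → ℂ) → ℝ := fun x => 2 / b1 x * ‖db i0 χ x‖ ^ 2 * W x with hg1
  set g2 : (ι → ℂ) → ℝ := fun x => ‖u x‖ ^ 2 * W x * (T x / (b1 x / 2 + T x)) with hg2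
  set g3 : (ι → ℂ) → ℝ := fun x => ‖u x‖ ^ 2 * W x * ((b1 x / 2) / (b1 x / 2 + T x)) with hg3
  have bTne : ∀ x, b1 x / 2 + T x ≠ 0 := fun x => by have := b1pos x; have := T0 x; positivity
  have g1c : Continuous g1 := ((continuous_const.div b1c fun x => (b1pos x).ne').mul ((hχ.db i0).cont.norm.pow 2)).mul Wc
  have g2c : Continuous g2 := ((su.cont.norm.pow 2).mul Wc).mul (Tc.div ((b1c.div_const 2).add Tc) bTne)
  have g3c : Continuous g3 := ((su.cont.norm.pow 2).mul Wc).mul ((b1c.div_const 2).div ((b1c.div_const 2).add Tc) bTne)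
  have g10 : ∀ x, 0 ≤ g1 x := fun x => by have := b1pos x; have := W0 x; simp only [hg1]; positivity
  have g20 : ∀ x, 0 ≤ g2 x := fun x => by have := b1pos x; have := W0 x; have := T0 x; simp only [hg2]; positivity
  have g30 : ∀ x, 0 ≤ g3 x := fun x => by have := b1pos x; have := W0 x; have := T0 x; simp only [hg3]; positivity
  have g23 : ∀ x, g2 x + g3 x = ‖u x‖ ^ 2 * W x := by
    intro x; simp only [hg2, hg3]; have := bTne x; rw [← mul_add, ← add_div, add_comm (T x), div_self this, mul_one]
  have g1b : ∀ x, g1 x ≤ S.indicator (fun x => K * Real.exp (-ph F lam η x)) x := by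
    intro x
    by_cases hx : db i0 χ x = 0
    · simp only [hg1, hx, norm_zero]
      simp only [ne_eq, OfNat.ofNat_ne_zero, not_false_eq_true, zero_pow, mul_zero, zero_mul]
      exact Set.indicator_nonneg (fun x _ => by positivity) x
    · obtain ⟨h1, h2⟩ := hχs x hx
      rw [Set.indicator_of_mem (show x ∈ S from h2)]
      simp only [hg1, hW]
      rw [ep0]
      have hz := zpos x
      set s := ‖x i0‖ ^ 2 with hs
      have hs1 : e ^ 2 / 4 ≤ s := by rw [hs]; nlinarith
      have hs2 : s ≤ e ^ 2 := by rw [hs]; nlinarith [norm_nonneg (x i0)]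
      have q1 : (1 : ℝ) / b1 x ≤ zz i0 e x * (s + e ^ 2) ^ 2 / e ^ 2 := by
        rw [div_le_iff₀ (b1pos x)]
        simp only [hb1]
        rw [mul_add]
        have : zz i0 e x * (s + e ^ 2) ^ 2 / e ^ 2 * (e ^ 2 / (zz i0 e x * (s + e ^ 2) ^ 2)) = 1 := by
          have : s + e ^ 2 ≠ 0 := by positivity
          field_simp
        rw [this]
        have : 0 ≤ zz i0 e x * (s + e ^ 2) ^ 2 / e ^ 2 * 1 := by positivity
        linarith
      have q2 : 1 / b1 x * (zz i0 e x)⁻¹ ≤ 4 * e ^ 2 := by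
        calc 1 / b1 x * (zz i0 e x)⁻¹ ≤ zz i0 e x * (s + e ^ 2) ^ 2 / e ^ 2 * (zz i0 e x)⁻¹ := by gcongr
          _ = (s + e ^ 2) ^ 2 / e ^ 2 := by field_simp
          _ ≤ 4 * e ^ 2 := by
            rw [div_le_iff₀ (by positivity)]
            have : 0 ≤ s := by positivity
            nlinarith
      have q3 : ‖db i0 χ x‖ ^ 2 ≤ (C / e) ^ 2 := pow_le_pow_left₀ (norm_nonneg _) (hχC x) 2
      have q4 : (s + d ^ 2)⁻¹ ≤ 4 / e ^ 2 := by
        rw [inv_le_comm₀ (by positivity) (by positivity), inv_div]; nlinarith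
      calc 2 / b1 x * ‖db i0 χ x‖ ^ 2 * (Real.exp (-ph F lam η x) / (s + d ^ 2) * (zz i0 e x)⁻¹)
          = 2 * (1 / b1 x * (zz i0 e x)⁻¹) * ‖db i0 χ x‖ ^ 2 * (s + d ^ 2)⁻¹ * Real.exp (-ph F lam η x) := by ring
        _ ≤ 2 * (4 * e ^ 2) * (C / e) ^ 2 * (4 / e ^ 2) * Real.exp (-ph F lam η x) := by
            have := b1pos x
            gcongr
        _ = K * Real.exp (-ph F lam η x) := by simp only [hK]; field_simp; ring
  have iK : Integrable (S.indicator (fun x => K * Real.exp (-ph F lam η x))) := (iph.const_mul K).indicator Sm'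
  have ig1 : Integrable g1 := Integrable.mono' iK g1c.aestronglyMeasurable (Filter.Eventually.of_forall fun x => by
    rw [Real.norm_of_nonneg (g10 x)]; exact g1b x)
  have ig2 : Integrable g2 := Integrable.mono' iuW g2c.aestronglyMeasurable (Filter.Eventually.of_forall fun x => by
    rw [Real.norm_of_nonneg (g20 x)]; have := g23 x; have := g30 x; linarith)
  have ig3 : Integrable g3 := Integrable.mono' iuW g3c.aestronglyMeasurable (Filter.Eventually.of_forall fun x => by
    rw [Real.norm_of_nonneg (g30 x)]; have := g23 x; have := g20 x; linarith)
  have pw : ∀ x, ‖db i0 U x‖ ^ 2 / (b1 x + T x) * Real.exp (-p1 x) ≤ g1 x + g2 x := by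
    intro x
    rw [ndbU]
    have := mul_le_mul_of_nonneg_right (real2 (db i0 χ x) (u x * conj (wz (tht i0 e) i0 x)) (b1pos x) (T0 x)) (W0 x)
    refine this.trans (le_of_eq ?_)
    rw [norm_mul, RCLike.norm_conj, mul_pow]
    simp only [hg1, hg2, hT]; ring
  have bT0 : ∀ x, 0 < b1 x + T x := fun x => by have := b1pos x; have := T0 x; positivity
  have p1c : Continuous (fun x => Real.exp (-p1 x)) := Real.continuous_exp.comp sp1.continuous.neg
  have hA : Integrable (fun x => ‖db i0 U x‖ ^ 2 / (b1 x + T x) * Real.exp (-p1 x)) := by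
    refine Integrable.mono' (ig1.add ig2) ?_ (Filter.Eventually.of_forall fun x => ?_)
    · exact ((((sU.db i0).cont.norm.pow 2).div (b1c.add Tc) fun x => (bT0 x).ne').mul p1c).aestronglyMeasurable
    · rw [Real.norm_of_nonneg (by have := bT0 x; positivity)]; exact pw x
  have hL : ∀ x (a : ι → ℂ), (b1 x + T x) * ‖a i0‖ ^ 2 ≤ (∑ j, ∑ k, Lev p1 j k x * a j * conj (a k)).re := by
    intro x a
    change _ ≤ (LF p1 x a).re
    simp only [hp1, hp0]
    have s1 : ContDiff ℝ ∞ (fun x => lam * Real.log (‖F x‖ ^ 2 + η)) := contDiff_const.mul (sm_logP hF.sm hη)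
    have s2 : ContDiff ℝ ∞ (fun x : ι → ℂ => 2 * ∑ i, ‖x i‖ ^ 2) := contDiff_const.mul sm_nsqs
    rw [LF_add sp0 sT, LF_add sph sG]
    have : LF (ph F lam η) x a = LF (fun x => lam * Real.log (‖F x‖ ^ 2 + η)) x a + LF (fun x : ι → ℂ => 2 * ∑ i, ‖x i‖ ^ 2) x a := LF_add s1 s2 x a
    rw [this, LF_cmul lam (sm_logP hF.sm hη), LF_cmul 2 sm_nsqs, LF_nsqs, LF_logP hF hη, LF_logt i0 (by positivity), LF_tht i0 he he1]
    rw [← Complex.ofReal_mul, ← Complex.ofReal_mul, ← Complex.ofReal_add, ← Complex.ofReal_add, ← Complex.ofReal_add, Complex.ofReal_re]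
    have k1 : 0 ≤ lam * (η / (‖F x‖ ^ 2 + η) ^ 2 * ‖∑ j, dz j F x * a j‖ ^ 2) := by positivity
    have k2 : 0 ≤ d ^ 2 / (‖x i0‖ ^ 2 + d ^ 2) ^ 2 * ‖a i0‖ ^ 2 := by positivity
    have k3 : ‖a i0‖ ^ 2 ≤ ∑ i, ‖a i‖ ^ 2 := Finset.single_le_sum (f := fun i => ‖a i‖ ^ 2) (fun i _ => by positivity) (Finset.mem_univ i0)
    have k4 : 1 / (‖x i0‖ ^ 2 + 1) ^ 2 / zz i0 e x ≤ 1 := by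
      rw [div_div, div_le_one (by have := zpos x; positivity)]
      have := zge x
      have h5 : 1 ≤ (‖x i0‖ ^ 2 + 1) ^ 2 := one_le_pow₀ (by nlinarith [sq_nonneg ‖x i0‖])
      nlinarith
    have k5 : e ^ 2 / (‖x i0‖ ^ 2 + e ^ 2) ^ 2 / zz i0 e x = e ^ 2 / (zz i0 e x * (‖x i0‖ ^ 2 + e ^ 2) ^ 2) := by
      rw [div_div, mul_comm]
    have k6 : (1 + e ^ 2 / (zz i0 e x * (‖x i0‖ ^ 2 + e ^ 2) ^ 2)) * ‖a i0‖ ^ 2 ≤ 2 * ‖a i0‖ ^ 2 + (e ^ 2 / (‖x i0‖ ^ 2 + e ^ 2) ^ 2 - 1 / (‖x i0‖ ^ 2 + 1) ^ 2) / zz i0 e x * ‖a i0‖ ^ 2 := by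
      rw [sub_div, k5]
      have k7 := mul_le_mul_of_nonneg_right k4 (sq_nonneg ‖a i0‖)
      rw [sub_mul, add_mul]
      linarith only [k7]
    rw [add_mul]
    linarith only [k1, k2, k3, k6]
  have fin := BL sp1 sU UL Uperp i0 dbU0 (b1c.add Tc) bT0 hL hA
  simp only [nU] at fin
  have fin2 : ∫ x, ‖u x‖ ^ 2 * W x ≤ ∫ x, (g1 x + g2 x) := fin.trans (integral_mono hA (ig1.add ig2) pw)
  have e23 : ∫ x, ‖u x‖ ^ 2 * W x = (∫ x, g2 x) + ∫ x, g3 x := by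
    rw [← integral_add ig2 ig3]; congr 1; ext x; exact (g23 x).symm
  rw [integral_add ig1 ig2, e23] at fin2
  have hcoef : ∀ x, ‖χ x - h x‖ ^ 2 * ((‖x i0‖ ^ 2 + e ^ 2) / (3 + ‖x i0‖ ^ 2) / (‖x i0‖ ^ 2 + d ^ 2)) * Real.exp (-ph F lam η x) ≤ g3 x := by
    intro x
    have r := real1 (s := ‖x i0‖ ^ 2) (a := ‖x i0‖ ^ 2 + e ^ 2) (by positivity) (by positivity) (zge x) (T0 x) (b1ge x) (zz_le i0 he he1 x)
      (tht_T i0 he he1 x) (by nlinarith)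
    simp only [hg3, hW]
    rw [ep0]
    calc _ = ‖χ x - h x‖ ^ 2 * (Real.exp (-ph F lam η x) / (‖x i0‖ ^ 2 + d ^ 2)) * ((‖x i0‖ ^ 2 + e ^ 2) / (3 + ‖x i0‖ ^ 2)) := by ring
      _ ≤ ‖χ x - h x‖ ^ 2 * (Real.exp (-ph F lam η x) / (‖x i0‖ ^ 2 + d ^ 2)) * ((zz i0 e x)⁻¹ * ((b1 x / 2) / (b1 x / 2 + T x))) := by gcongr
      _ = _ := by ring
  have hc' : Continuous (fun x => ‖χ x - h x‖ ^ 2 * ((‖x i0‖ ^ 2 + e ^ 2) / (3 + ‖x i0‖ ^ 2) / (‖x i0‖ ^ 2 + d ^ 2)) * Real.exp (-ph F lam η x)) := by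
    refine ((su.cont.norm.pow 2).mul (((nc.add continuous_const).div (continuous_const.add nc) fun x => (by positivity : (3 + ‖x i0‖ ^ 2 : ℝ) ≠ 0)).div (nc.add continuous_const) fun x => (by positivity : (‖x i0‖ ^ 2 + d ^ 2 : ℝ) ≠ 0))).mul
      (Real.continuous_exp.comp sph.continuous.neg)
  have hi : Integrable (fun x => ‖χ x - h x‖ ^ 2 * ((‖x i0‖ ^ 2 + e ^ 2) / (3 + ‖x i0‖ ^ 2) / (‖x i0‖ ^ 2 + d ^ 2)) * Real.exp (-ph F lam η x)) :=
    Integrable.mono' ig3 hc'.aestronglyMeasurable (Filter.Eventually.of_forall fun x => by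
      rw [Real.norm_of_nonneg (by positivity)]; exact hcoef x)
  refine ⟨h, hh, hi, ?_⟩
  calc _ ≤ ∫ x, g3 x := integral_mono hi ig3 hcoef
    _ ≤ ∫ x, g1 x := by linarith
    _ ≤ ∫ x, S.indicator (fun x => K * Real.exp (-ph F lam η x)) x := integral_mono ig1 iK g1b
    _ = K * ∫ x in S, Real.exp (-ph F lam η x) := by rw [integral_indicator Sm', integral_const_mul]
end OT

namespace OT
set_option linter.all false
open scoped ContDiff ComplexConjugate Convolution Topology
open Complex (I)
variable {ι : Type} [Fintype ι] [DecidableEq ι]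


lemma db_congr {f g : (ι → ℂ) → ℂ} {x} (h : f =ᶠ[𝓝 x] g) (j) : db j f x = db j g x := by
  unfold db; rw [h.fderiv_eq]

lemma chi_ex : ∃ C : ℝ, 0 ≤ C ∧ ∀ (i0 : ι) (e : ℝ), 0 < e → ∃ χ : (ι → ℂ) → ℂ, Sm χ ∧ (∀ x, ‖χ x‖ ≤ 1) ∧
    (∀ j, j ≠ i0 → ∀ x, db j χ x = 0) ∧ (∀ x, db i0 χ x ≠ 0 → e / 2 ≤ ‖x i0‖ ∧ ‖x i0‖ ≤ e) ∧
    (∀ x, ‖db i0 χ x‖ ≤ C / e) ∧ (∀ x, ‖x i0‖ ≤ e / 2 → χ x = 1) ∧ (∀ x, e < ‖x i0‖ → χ x = 0) := by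
  let κ : ContDiffBump (0 : ℂ) := ⟨1/2, 1, by norm_num, by norm_num⟩
  have κs : ContDiff ℝ ∞ κ := κ.contDiff
  have κd : Continuous (fderiv ℝ κ) := κs.continuous_fderiv (by simp)
  obtain ⟨M, hM⟩ := κd.bounded_above_of_compact_support (κ.hasCompactSupport.fderiv (𝕜 := ℝ))
  have hM0 : 0 ≤ M := (norm_nonneg _).trans (hM 0)
  refine ⟨M, hM0, fun i0 e he => ?_⟩
  let L : (ι → ℂ) →L[ℝ] ℂ := e⁻¹ • ContinuousLinearMap.proj (R := ℝ) (φ := fun _ : ι => ℂ) i0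
  have hL : ∀ x, L x = e⁻¹ • x i0 := fun x => rfl
  have nL : ∀ x, ‖L x‖ = ‖x i0‖ / e := fun x => by
    rw [hL, norm_smul, norm_inv, Real.norm_of_nonneg he.le]; field_simp
  set χ : (ι → ℂ) → ℂ := fun x => (κ (L x) : ℂ) with hχ
  have sχ : Sm χ := Sm.ofReal (κs.comp L.contDiff)
  have h1 : ∀ x, ‖x i0‖ ≤ e / 2 → χ x = 1 := by
    intro x hx
    have : κ (L x) = 1 := κ.one_of_mem_closedBall (by
      rw [mem_closedBall_zero_iff, nL]; change _ ≤ (1/2 : ℝ); rw [div_le_iff₀ he]; linarith)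
    simp only [hχ, this]; simp
  have h0 : ∀ x, e ≤ ‖x i0‖ → χ x = 0 := by
    intro x hx
    have : κ (L x) = 0 := κ.zero_of_le_dist (by
      rw [dist_zero_right, nL]; change (1 : ℝ) ≤ _; rw [le_div_iff₀ he]; linarith)
    simp only [hχ, this]; simp
  have fd : ∀ x v, fderiv ℝ χ x v = ((fderiv ℝ κ (L x) (L v) : ℝ) : ℂ) := by
    intro x v
    have a1 : HasFDerivAt κ (fderiv ℝ κ (L x)) (L x) := (κs.differentiable (by simp) _).hasFDerivAt
    have a2 := a1.comp x L.hasFDerivAt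
    have a3 := (Complex.ofRealCLM.hasFDerivAt (x := κ (L x))).comp x a2
    have a4 : HasFDerivAt χ _ x := a3
    rw [a4.fderiv]; rfl
  have fdb : ∀ x v, ‖fderiv ℝ χ x v‖ ≤ M * (‖v i0‖ / e) := by
    intro x v
    rw [fd, Complex.norm_real, ← nL]
    exact (ContinuousLinearMap.le_opNorm _ _).trans (mul_le_mul_of_nonneg_right (hM _) (norm_nonneg _))
  refine ⟨χ, sχ, ?_, ?_, ?_, ?_, h1, fun x hx => h0 x hx.le⟩
  · intro x
    simp only [hχ, Complex.norm_real]
    rw [Real.norm_of_nonneg κ.nonneg]; exact κ.le_one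
  · intro j hj x
    have z1 : fderiv ℝ χ x (Pi.single j 1) = 0 := by
      have := fdb x (Pi.single j 1); rw [Pi.single_eq_of_ne hj.symm] at this
      simpa using this
    have z2 : fderiv ℝ χ x (Pi.single j I) = 0 := by
      have := fdb x (Pi.single j I); rw [Pi.single_eq_of_ne hj.symm] at this
      simpa using this
    unfold db; rw [z1, z2]; simp
  · intro x hx
    by_contra hcon
    apply hx
    rw [not_and_or, not_le, not_le] at hcon
    rcases hcon with hc | hc
    · have : χ =ᶠ[𝓝 x] fun _ => 1 := by
        filter_upwards [(isOpen_lt ((continuous_apply i0).norm : Continuous (fun y : ι → ℂ => ‖y i0‖)) (continuous_const (y := e / 2))).mem_nhds hc] with y hy using h1 y (le_of_lt hy)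
      rw [db_congr this, db_const]
    · have : χ =ᶠ[𝓝 x] fun _ => 0 := by
        filter_upwards [(isOpen_lt (continuous_const (y := e)) ((continuous_apply i0).norm : Continuous (fun y : ι → ℂ => ‖y i0‖))).mem_nhds hc] with y hy using h0 y (le_of_lt hy)
      rw [db_congr this, db_const]
  · intro x
    have z1 := fdb x (Pi.single i0 1)
    have z2 := fdb x (Pi.single i0 I)
    simp only [Pi.single_eq_same, norm_one, Complex.norm_I] at z1 z2
    unfold db
    rw [norm_div, Complex.norm_ofNat]
    have := norm_add_le (fderiv ℝ χ x (Pi.single i0 1)) (I * fderiv ℝ χ x (Pi.single i0 I))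
    rw [norm_mul, Complex.norm_I, one_mul] at this
    rw [div_le_iff₀ two_pos]
    calc _ ≤ _ := this
      _ ≤ M * (1 / e) + M * (1 / e) := add_le_add z1 z2
      _ = M / e * 2 := by ring

/-- the kernel integral diverges -/
lemma big (i0 : ι) {κ : (ι → ℂ) → ℝ} (hk : Continuous κ) (hkc : HasCompactSupport κ) (h0 : ∀ x, 0 ≤ κ x) (hk0 : 0 < κ 0) (M : ℝ) :
    ∃ d0 > 0, ∀ d, 0 < d → d ≤ d0 → M ≤ ∫ x, κ x / (‖x i0‖ ^ 2 + d ^ 2) := by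
  obtain ⟨r, hr, hrk⟩ := Metric.eventually_nhds_iff_ball.1 (hk.continuousAt.eventually (lt_mem_nhds (half_lt_self hk0)))
  set R : ℕ → ℝ := fun k => r * (1/2) ^ k with hR
  have Rpos : ∀ k, 0 < R k := fun k => by positivity
  have Rs : ∀ k, R (k+1) = R k / 2 := fun k => by simp only [hR]; rw [pow_succ]; ring
  have Ranti : Antitone R := antitone_nat_of_succ_le fun k => by rw [Rs]; linarith [Rpos k]
  let S : ℕ → ι → Set ℂ := fun k i => if i = i0 then Metric.ball 0 (R k) \ Metric.ball 0 (R (k+1)) else Metric.ball 0 r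
  let A : ℕ → Set (ι → ℂ) := fun k => Set.univ.pi (S k)
  have Sm' : ∀ k i, MeasurableSet (S k i) := fun k i => by
    simp only [S]; split_ifs
    · exact measurableSet_ball.diff measurableSet_ball
    · exact measurableSet_ball
  have Am : ∀ k, MeasurableSet (A k) := fun k => MeasurableSet.univ_pi (Sm' k)
  have Ai0 : ∀ k x, x ∈ A k → ‖x i0‖ < R k ∧ R (k+1) ≤ ‖x i0‖ := by
    intro k x hx
    have := hx i0 (Set.mem_univ _)
    simp only [S, if_true] at this
    simpa using this
  have Aball : ∀ k x, x ∈ A k → x ∈ Metric.ball (0 : ι → ℂ) r := by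
    intro k x hx
    rw [mem_ball_zero_iff, pi_norm_lt_iff hr]
    intro i
    by_cases hi : i = i0
    · subst hi
      have := (Ai0 k x hx).1
      have h2 := Ranti (Nat.zero_le k)
      simp only [hR, pow_zero, mul_one] at h2 this
      linarith
    · have := hx i (Set.mem_univ _)
      simp only [S, if_neg hi] at this
      simpa using this
  set V : ℝ := (∏ i ∈ Finset.univ.erase i0, (volume (Metric.ball (0:ℂ) r)).toReal) with hV
  have Vpos : 0 < V := Finset.prod_pos fun i _ => ENNReal.toReal_pos (Metric.measure_ball_pos _ _ hr).ne' measure_ball_lt_top.ne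
  have volA : ∀ k, volume.real (A k) = Real.pi * (3/4) * R k ^ 2 * V := by
    intro k
    rw [Measure.real, volume_pi_pi, ENNReal.toReal_prod, ← Finset.mul_prod_erase _ _ (Finset.mem_univ i0)]
    congr 1
    · simp only [S, if_true]
      have hsub : Metric.ball (0:ℂ) (R (k+1)) ⊆ Metric.ball 0 (R k) := Metric.ball_subset_ball (Ranti (Nat.le_succ k))
      rw [measure_diff hsub measurableSet_ball.nullMeasurableSet measure_ball_lt_top.ne,
        ENNReal.toReal_sub_of_le (measure_mono hsub) measure_ball_lt_top.ne, Complex.volume_ball, Complex.volume_ball, Rs]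
      simp only [ENNReal.toReal_mul, ENNReal.toReal_pow, ENNReal.toReal_ofReal (Rpos k).le, ENNReal.toReal_ofReal (half_pos (Rpos k)).le]
      simp; ring
    · refine Finset.prod_congr rfl fun i hi => ?_
      simp only [S, if_neg (Finset.ne_of_mem_erase hi)]
  have volfin : ∀ k, volume (A k) ≠ ⊤ := fun k => by
    intro h
    have h1 := volA k
    rw [Measure.real, h, ENNReal.toReal_top] at h1
    have : 0 < Real.pi * (3/4) * R k ^ 2 * V := by have := Rpos k; positivity
    linarith
  have Adisj : ∀ k l x, x ∈ A k → x ∈ A l → k = l := by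
    have : ∀ k l x, x ∈ A k → x ∈ A l → ¬ k < l := by
      intro k l x hk hl hkl
      have h1 := (Ai0 k x hk).2
      have h2 := (Ai0 l x hl).1
      have h3 := Ranti (Nat.succ_le_of_lt hkl)
      simp only [Nat.succ_eq_add_one] at h3
      linarith
    intro k l x hk hl
    have h1 := this k l x hk hl
    have h2 := this l k x hl hk
    omega
  set c0 : ℝ := κ 0 / 2 * (Real.pi * (3/4) * V / 2) with hc0
  have c0pos : 0 < c0 := by positivity
  obtain ⟨N, hN⟩ := exists_nat_gt (M / c0)
  refine ⟨R N, Rpos N, fun d hd hdN => ?_⟩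
  have hfc : Continuous (fun x => κ x / (‖x i0‖ ^ 2 + d ^ 2)) :=
    hk.div ((sm_nsq i0).continuous.add continuous_const) fun x => by positivity
  have hfi : Integrable (fun x => κ x / (‖x i0‖ ^ 2 + d ^ 2)) := by
    refine hfc.integrable_of_hasCompactSupport ?_
    simp only [div_eq_mul_inv]; exact hkc.mul_right
  have hgi : ∀ k, Integrable ((A k).indicator (fun _ => κ 0 / 2 / (2 * R k ^ 2))) := fun k =>
    (integrable_indicator_iff (Am k)).2 (integrableOn_const (volfin k))
  have pw : ∀ x, ∑ k ∈ Finset.range N, (A k).indicator (fun _ => κ 0 / 2 / (2 * R k ^ 2)) x ≤ κ x / (‖x i0‖ ^ 2 + d ^ 2) := by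
    intro x
    by_cases hx : ∃ k ∈ Finset.range N, x ∈ A k
    · obtain ⟨k, hkN, hk⟩ := hx
      rw [Finset.sum_eq_single_of_mem k hkN (fun l _ hl => Set.indicator_of_notMem (fun hxl => hl (Adisj l k x hxl hk)) _), Set.indicator_of_mem hk]
      have h1 := (hrk x (Aball k x hk)).le
      have h2 := (Ai0 k x hk).1
      have h3 : d ≤ R k := hdN.trans (Ranti (Finset.mem_range.1 hkN).le)
      have h4 : ‖x i0‖ ^ 2 + d ^ 2 ≤ 2 * R k ^ 2 := by nlinarith [norm_nonneg (x i0), pow_le_pow_left₀ hd.le h3 2, pow_le_pow_left₀ (norm_nonneg (x i0)) h2.le 2]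
      exact div_le_div₀ (h0 x) h1 (by positivity) h4
    · push Not at hx
      rw [Finset.sum_eq_zero fun k hk => Set.indicator_of_notMem (hx k hk) _]
      have := h0 x; positivity
  calc M ≤ N * c0 := by rw [div_lt_iff₀ c0pos] at hN; exact hN.le
    _ = ∑ k ∈ Finset.range N, c0 := by simp
    _ = ∑ k ∈ Finset.range N, ∫ x, (A k).indicator (fun _ => κ 0 / 2 / (2 * R k ^ 2)) x := by
        refine Finset.sum_congr rfl fun k _ => ?_
        rw [integral_indicator (Am k), setIntegral_const, volA, smul_eq_mul, hc0]
        have := (Rpos k).ne'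
        field_simp
    _ = ∫ x, ∑ k ∈ Finset.range N, (A k).indicator (fun _ => κ 0 / 2 / (2 * R k ^ 2)) x := (integral_finsetSum _ fun k _ => hgi k).symm
    _ ≤ _ := integral_mono (integrable_finset_sum _ fun k _ => hgi k) hfi pw
end OT

namespace OT
set_option linter.all false
open scoped ContDiff ComplexConjugate Convolution Topology
open Complex (I)
variable {ι : Type} [Fintype ι] [DecidableEq ι]


lemma Hol.mul {f g : (ι → ℂ) → ℂ} (hf : Hol f) (hg : Hol g) : Hol (fun x => f x * g x) :=
  hol_of_cdiff (hf.sm.mul hg.sm) (hf.diff.mul hg.diff)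

lemma force {h : (ι → ℂ) → ℂ} (hh : Hol h) {k : (ι → ℂ) → ℝ} (hk : Continuous k) (hkc : HasCompactSupport k)
    (hrot : ∀ u : ℂ, ‖u‖ = 1 → ∀ y, k (u • y) = k y) (h0 : ∀ x, 0 ≤ k x) :
    ‖1 - h 0‖ ^ 2 * ∫ x, k x ≤ ∫ x, ‖1 - h x‖ ^ 2 * k x := by
  have h1 : Hol (fun x => 1 - h x) := (Hol.const 1).sub hh
  have mv := mean_value (h1.mul h1) (k := fun x => (k x : ℂ)) (Complex.continuous_ofReal.comp hk)
    (hkc.comp_left (g := fun t : ℝ => (t : ℂ)) (by simp)) (fun u hu y => by simp only [hrot u hu y])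
  have h2 := norm_integral_le_integral_norm (μ := volume) (fun x => (1 - h x) * (1 - h x) * (k x : ℂ))
  rw [mv, integral_complex_ofReal, norm_mul, norm_mul, Complex.norm_real, Real.norm_of_nonneg (integral_nonneg h0)] at h2
  rw [pow_two]
  refine h2.trans (le_of_eq ?_)
  congr 1; ext x
  rw [norm_mul, norm_mul, Complex.norm_real, Real.norm_of_nonneg (h0 x), pow_two]

lemma sc1 {a b t : ℝ} (ha : 0 ≤ a) (hb : 0 ≤ b) (h : 1 / 7 ≤ t) : a * b ≤ 7 * (a * t * b) := by
  have := mul_le_mul_of_nonneg_left h (mul_nonneg ha hb)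
  linarith [mul_right_comm a t b]
lemma sc2 {a b t : ℝ} (ha : 0 ≤ a) (h : a ≤ t + b) : a ^ 2 ≤ 2 * t ^ 2 + 2 * b ^ 2 := by
  nlinarith [sq_nonneg (t - b)]
lemma sc3 {a d e : ℝ} (ha : 0 ≤ a) (ha2 : a ≤ 2) (hd : 0 < d) (hde : d ≤ e) :
    1 / 7 ≤ (a ^ 2 + e ^ 2) / (3 + a ^ 2) / (a ^ 2 + d ^ 2) := by
  have : d ^ 2 ≤ e ^ 2 := pow_le_pow_left₀ hd.le hde 2
  have h4 : a ^ 2 ≤ 4 := by nlinarith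
  rw [div_div, div_le_div_iff₀ (by positivity) (by positivity)]
  nlinarith [sq_nonneg a, sq_nonneg e, sq_nonneg d, mul_nonneg (sq_nonneg d) (sub_nonneg.2 h4), mul_nonneg (sq_nonneg a) (sub_nonneg.2 h4)]
lemma sc4 {a e : ℝ} (he : 0 < e) (ha : a ^ 2 ≤ 1) : e ^ 2 / 4 ≤ (a ^ 2 + e ^ 2) / (3 + a ^ 2) := by
  apply div_le_div₀ <;> nlinarith [sq_nonneg a, sq_nonneg e]

set_option maxHeartbeats 400000 in
lemma OT2 : ∃ C : ℝ, 0 ≤ C ∧ ∀ (i0 : ι) (F : (ι → ℂ) → ℂ) (lam η e C0 : ℝ), Hol F → 0 ≤ lam → 0 < η → 0 < e → e ≤ 1 →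
    ∫ x in {x : ι → ℂ | ‖x i0‖ ≤ e}, Real.exp (-ph F lam η x) ≤ C0 * e ^ 2 →
    ∃ h, Hol h ∧ 1 / 2 ≤ ‖h 0‖ ∧ IntegrableOn (fun x => ‖h x‖ ^ 2 * Real.exp (-ph F lam η x)) {x : ι → ℂ | ‖x i0‖ ≤ 2} ∧
      ∫ x in {x : ι → ℂ | ‖x i0‖ ≤ 2}, ‖h x‖ ^ 2 * Real.exp (-ph F lam η x) ≤ C * C0 := by
  obtain ⟨C, hC, hchi⟩ := chi_ex (ι := ι)
  refine ⟨448 * C ^ 2 + 2, by positivity, fun i0 F lam η e C0 hF hlam hη he he1 hC0 => ?_⟩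
  obtain ⟨χ, sχ, χ1, χj, χs, χC, χone, χzero⟩ := hchi i0 e he
  have sph : ContDiff ℝ ∞ (ph F lam η) := sm_ph hF.sm hη
  have iph := int_ph (η := η) hF.sm hlam hη
  have phc : Continuous (fun x => Real.exp (-ph F lam η x)) := Real.continuous_exp.comp sph.continuous.neg
  obtain ⟨B, hB⟩ : ∃ B, B = 32 * C ^ 2 * C0 := ⟨_, rfl⟩
  have hBle : 32 * C ^ 2 / e ^ 2 * ∫ x in {x : ι → ℂ | ‖x i0‖ ≤ e}, Real.exp (-ph F lam η x) ≤ B := by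
    calc _ ≤ 32 * C ^ 2 / e ^ 2 * (C0 * e ^ 2) := mul_le_mul_of_nonneg_left hC0 (by positivity)
      _ = B := by simp only [hB]; field_simp
  -- kernel
  obtain ⟨κ, hκ⟩ : ∃ κ : (ι → ℂ) → ℝ, κ = fun x => rad ((2 / e : ℝ) • x) := ⟨_, rfl⟩
  have κc : Continuous κ := hκ ▸ sm_rad.continuous.comp (continuous_const_smul _)
  have κsup : ∀ x, κ x ≠ 0 → ‖x‖ ≤ e / 2 := by
    intro x hx
    rw [hκ] at hx
    have := rad_supp _ hx
    rw [mem_closedBall_zero_iff, norm_smul, Real.norm_of_nonneg (by positivity)] at this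
    rw [div_mul_eq_mul_div, div_le_one he] at this
    linarith
  have κcs : HasCompactSupport κ := HasCompactSupport.intro (isCompact_closedBall 0 (e/2)) fun x hx => by
    by_contra h; exact hx (by rw [mem_closedBall_zero_iff]; exact κsup x h)
  have κ0 : ∀ x, 0 ≤ κ x := fun x => hκ ▸ rad_nonneg _
  have κpos : 0 < κ 0 := by
    simp only [hκ, smul_zero, rad]; apply expNegInvGlue.pos_of_pos; simp
  have κrot : ∀ u : ℂ, ‖u‖ = 1 → ∀ y, κ (u • y) = κ y := by
    intro u hu y; simp only [hκ]; rw [smul_comm, rad_rot u hu]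
  obtain ⟨K1, hK1⟩ := κc.bounded_above_of_compact_support κcs
  have hK10 : 0 ≤ K1 := (norm_nonneg _).trans (hK1 0)
  obtain ⟨xm, hxm, hmin⟩ := (isCompact_closedBall (0 : ι → ℂ) 1).exists_isMinOn ⟨0, by simp⟩ phc.continuousOn
  obtain ⟨m, hm⟩ : ∃ m, m = Real.exp (-ph F lam η xm) := ⟨_, rfl⟩
  have mpos : 0 < m := hm ▸ Real.exp_pos _
  obtain ⟨Q, hQ⟩ : ∃ Q, Q = K1 * (4 / (e ^ 2 * m)) * B := ⟨_, rfl⟩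
  have hI0 : 0 ≤ ∫ x in {x : ι → ℂ | ‖x i0‖ ≤ e}, Real.exp (-ph F lam η x) := integral_nonneg fun x => (Real.exp_pos _).le
  have hB0 : 0 ≤ B := le_trans (by positivity) hBle
  have hQ0 : 0 ≤ Q := by rw [hQ]; positivity
  obtain ⟨d0, hd0, hd⟩ := big i0 κc κcs κ0 κpos (4 * Q + 1)
  obtain ⟨d, hdd⟩ : ∃ d, d = min d0 e := ⟨_, rfl⟩
  have dpos : 0 < d := hdd ▸ lt_min hd0 he
  obtain ⟨h, hh, hi, hle⟩ := OT1 hF hlam hη i0 dpos (hdd ▸ min_le_right _ _) he1 sχ χ1 χj χs χC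
  have hle' := hle.trans hBle
  have nc : Continuous (fun x : ι → ℂ => ‖x i0‖ ^ 2) := (sm_nsq i0).continuous
  obtain ⟨k, hk⟩ : ∃ k : (ι → ℂ) → ℝ, k = fun x => κ x / (‖x i0‖ ^ 2 + d ^ 2) := ⟨_, rfl⟩
  have kc : Continuous k := by
    rw [hk]; exact κc.div (nc.add continuous_const) fun x => (by positivity : ‖x i0‖ ^ 2 + d ^ 2 ≠ 0)
  have kcs : HasCompactSupport k := by simp only [hk, div_eq_mul_inv]; exact κcs.mul_right
  have k0 : ∀ x, 0 ≤ k x := fun x => by have := κ0 x; simp only [hk]; positivity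
  have krot : ∀ u : ℂ, ‖u‖ = 1 → ∀ y, k (u • y) = k y := by
    intro u hu y; simp only [hk, κrot u hu]; simp [hu]
  have fo := force hh kc kcs krot k0
  have ki : Integrable (fun x => ‖1 - h x‖ ^ 2 * k x) := by
    refine (((continuous_const.sub hh.sm.cont).norm.pow 2).mul kc).integrable_of_hasCompactSupport ?_
    refine kcs.mono (fun x hx hx0 => hx ?_)
    show ‖1 - h x‖ ^ 2 * k x = 0
    rw [hx0, mul_zero]
  obtain ⟨G, hG⟩ : ∃ G : (ι → ℂ) → ℝ, G = fun x => ‖χ x - h x‖ ^ 2 * ((‖x i0‖ ^ 2 + e ^ 2) / (3 + ‖x i0‖ ^ 2) / (‖x i0‖ ^ 2 + d ^ 2)) * Real.exp (-ph F lam η x) := ⟨_, rfl⟩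
  have hi : Integrable G := by rw [hG]; exact hi
  have hle' : ∫ x, G x ≤ B := by rw [hG]; exact hle'
  have G0 : ∀ x, 0 ≤ G x := fun x => by simp only [hG]; positivity
  have pw : ∀ x, ‖1 - h x‖ ^ 2 * k x ≤ K1 * (4 / (e ^ 2 * m)) * G x := by
    intro x
    by_cases hx : κ x = 0
    · simp only [hk, hx, zero_div, mul_zero]; exact mul_nonneg (by positivity) (G0 x)
    · have n1 := κsup x hx
      have n2 : ‖x i0‖ ≤ e / 2 := (norm_le_pi_norm x i0).trans n1
      have n3 : ‖x i0‖ ^ 2 ≤ 1 := pow_le_one₀ (norm_nonneg _) (by linarith)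
      have n4 : m ≤ Real.exp (-ph F lam η x) := hm ▸ hmin (by rw [mem_closedBall_zero_iff]; linarith)
      have n5 : κ x ≤ K1 := (le_abs_self _).trans (hK1 x)
      simp only [hk, hG]
      rw [χone x n2]
      have n6 : e ^ 2 / 4 ≤ (‖x i0‖ ^ 2 + e ^ 2) / (3 + ‖x i0‖ ^ 2) := sc4 he n3
      calc ‖1 - h x‖ ^ 2 * (κ x / (‖x i0‖ ^ 2 + d ^ 2)) ≤ ‖1 - h x‖ ^ 2 * (K1 / (‖x i0‖ ^ 2 + d ^ 2)) := by gcongr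
        _ = K1 * (4 / (e ^ 2 * m)) * (‖1 - h x‖ ^ 2 * ((e ^ 2 / 4) / (‖x i0‖ ^ 2 + d ^ 2)) * m) := by field_simp
        _ ≤ _ := by gcongr
  have hQle : ∫ x, ‖1 - h x‖ ^ 2 * k x ≤ Q := by
    calc _ ≤ ∫ x, K1 * (4 / (e ^ 2 * m)) * G x := integral_mono ki (hi.const_mul _) pw
      _ = K1 * (4 / (e ^ 2 * m)) * ∫ x, G x := integral_const_mul _ _
      _ ≤ Q := hQ ▸ mul_le_mul_of_nonneg_left hle' (by positivity)
  have hbig := hd d dpos (hdd ▸ min_le_left _ _)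
  have hbig : 4 * Q + 1 ≤ ∫ x, k x := by rw [hk]; exact hbig
  have hq : ‖1 - h 0‖ ≤ 1 / 2 := by
    by_contra hcon
    push Not at hcon
    have c1 : 1 / 4 < ‖1 - h 0‖ ^ 2 := by nlinarith
    have c2 : ‖1 - h 0‖ ^ 2 * (4 * Q + 1) ≤ Q := (mul_le_mul_of_nonneg_left hbig (by positivity)).trans (fo.trans hQle)
    nlinarith
  have h12 : 1 / 2 ≤ ‖h 0‖ := by
    have := norm_sub_norm_le (1 : ℂ) (h 0)
    rw [norm_one] at this; linarith
  have Se : MeasurableSet {x : ι → ℂ | ‖x i0‖ ≤ e} := (isClosed_le (continuous_apply i0).norm continuous_const).measurableSet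
  have S2 : MeasurableSet {x : ι → ℂ | ‖x i0‖ ≤ 2} := (isClosed_le (continuous_apply i0).norm continuous_const).measurableSet
  obtain ⟨G2, hG2⟩ : ∃ G2 : (ι → ℂ) → ℝ, G2 = Set.indicator {x : ι → ℂ | ‖x i0‖ ≤ e} (fun x => Real.exp (-ph F lam η x)) := ⟨_, rfl⟩
  have iG2 : Integrable G2 := hG2 ▸ iph.indicator Se
  have G20 : ∀ x, 0 ≤ G2 x := fun x => hG2 ▸ Set.indicator_nonneg (fun x _ => (Real.exp_pos _).le) x
  have pw2 : ∀ x ∈ {x : ι → ℂ | ‖x i0‖ ≤ 2}, ‖h x‖ ^ 2 * Real.exp (-ph F lam η x) ≤ 14 * G x + 2 * G2 x := by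
    intro x hx
    have hx' : ‖x i0‖ ≤ 2 := hx
    have a1 : ‖h x‖ ^ 2 ≤ 2 * ‖χ x - h x‖ ^ 2 + 2 * ‖χ x‖ ^ 2 := by
      have := norm_sub_norm_le (h x) (χ x)
      rw [norm_sub_rev] at this
      have h3 : ‖h x‖ ≤ ‖χ x - h x‖ + ‖χ x‖ := by linarith
      exact sc2 (norm_nonneg _) h3
    have a2 : ‖χ x‖ ^ 2 * Real.exp (-ph F lam η x) ≤ G2 x := by
      by_cases hxe : ‖x i0‖ ≤ e
      · rw [hG2, Set.indicator_of_mem (show x ∈ {x : ι → ℂ | ‖x i0‖ ≤ e} from hxe)]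
        exact mul_le_of_le_one_left (Real.exp_pos _).le (pow_le_one₀ (norm_nonneg _) (χ1 x))
      · rw [χzero x (not_le.1 hxe)]; simpa using G20 x
    have a3 : 1 / 7 ≤ (‖x i0‖ ^ 2 + e ^ 2) / (3 + ‖x i0‖ ^ 2) / (‖x i0‖ ^ 2 + d ^ 2) := by
      have hde : d ≤ e := hdd ▸ min_le_right _ _
      exact sc3 (norm_nonneg _) hx' dpos hde
    have a4 : ‖χ x - h x‖ ^ 2 * Real.exp (-ph F lam η x) ≤ 7 * G x := by
      simp only [hG]
      exact sc1 (by positivity) (Real.exp_pos _).le a3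
    have := mul_le_mul_of_nonneg_right a1 (Real.exp_pos (-ph F lam η x)).le
    linarith
  have iG3 : IntegrableOn (fun x => 14 * G x + 2 * G2 x) {x : ι → ℂ | ‖x i0‖ ≤ 2} := ((hi.const_mul 14).add (iG2.const_mul 2)).integrableOn
  have ih : IntegrableOn (fun x => ‖h x‖ ^ 2 * Real.exp (-ph F lam η x)) {x : ι → ℂ | ‖x i0‖ ≤ 2} := by
    refine Integrable.mono' iG3 ((hh.sm.cont.norm.pow 2).mul phc).aestronglyMeasurable ?_
    filter_upwards [ae_restrict_mem S2] with x hx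
    rw [Real.norm_of_nonneg (by positivity)]; exact pw2 x hx
  refine ⟨h, hh, h12, ih, ?_⟩
  have e2 : ∫ x, G2 x ≤ C0 := by
    rw [hG2, integral_indicator Se]
    refine hC0.trans ?_
    have : 0 ≤ C0 * e ^ 2 := hI0.trans hC0
    have h6 : 0 ≤ C0 := nonneg_of_mul_nonneg_left this (by positivity)
    exact mul_le_of_le_one_right h6 (pow_le_one₀ he.le he1)
  calc _ ≤ ∫ x in {x : ι → ℂ | ‖x i0‖ ≤ 2}, (14 * G x + 2 * G2 x) := setIntegral_mono_on ih iG3 S2 pw2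
    _ ≤ ∫ x, (14 * G x + 2 * G2 x) := setIntegral_le_integral ((hi.const_mul 14).add (iG2.const_mul 2)) (Filter.Eventually.of_forall fun x => by
        have := G0 x; have := G20 x; simp only [Pi.zero_apply]; positivity)
    _ = 14 * (∫ x, G x) + 2 * ∫ x, G2 x := by
        rw [integral_add (hi.const_mul 14) (iG2.const_mul 2), integral_const_mul, integral_const_mul]
    _ ≤ 14 * B + 2 * C0 := by linarith
    _ = (448 * C ^ 2 + 2) * C0 := by simp only [hB]; ring

end OT

namespace OT
set_option linter.all false
open scoped ContDiff ComplexConjugate Convolution Topology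
open Complex (I)
variable {ι : Type} [Fintype ι] [DecidableEq ι]

set_option maxHeartbeats 1000000 in
/-- Ohsawa–Takegoshi type theorem -/
lemma OT3 (i0 : ι) {F : (ι → ℂ) → ℂ} (hF : Hol F) {lam C0 : ℝ} (hlam : 0 ≤ lam)
    (H : ∀ η, 0 < η → η ≤ 1 → ∃ e, 0 < e ∧ e ≤ 1 ∧ ∫ x in {x : ι → ℂ | ‖x i0‖ ≤ e}, Real.exp (-ph F lam η x) ≤ C0 * e ^ 2) :
    ∃ r > 0, IntegrableOn (fun x => ‖F x‖ ^ (-(2 * lam))) (Metric.ball (0 : ι → ℂ) r) := by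
  obtain ⟨C, hC, hOT⟩ := OT2 (ι := ι)
  obtain ⟨M, hM⟩ := (isCompact_closedBall (0 : ι → ℂ) 2).exists_bound_of_continuousOn hF.sm.cont.continuousOn
  set n : ℝ := (Fintype.card ι : ℝ) with hn
  set c : ℝ := (M ^ 2 + 1) ^ (-lam) * Real.exp (-(8 * n)) with hc
  have cpos : 0 < c := mul_pos (Real.rpow_pos_of_pos (by positivity) _) (Real.exp_pos _)
  have gle : ∀ (x : ι → ℂ) (R : ℝ), ‖x‖ ≤ R → ∑ i, ‖x i‖ ^ 2 ≤ R ^ 2 * n := by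
    intro x R hx
    calc ∑ i, ‖x i‖ ^ 2 ≤ ∑ i : ι, R ^ 2 := Finset.sum_le_sum fun i _ => pow_le_pow_left₀ (norm_nonneg _) ((norm_le_pi_norm x i).trans hx) 2
      _ = R ^ 2 * n := by simp [hn]; ring
  have cle : ∀ η, 0 < η → η ≤ 1 → ∀ x ∈ Metric.closedBall (0 : ι → ℂ) 2, c ≤ Real.exp (-ph F lam η x) := by
    intro η h0 h1 x hx
    rw [exp_ph h0, hc]
    have a1 := hM x hx
    have a2 := gle x 2 (by simpa using hx)
    refine mul_le_mul ?_ (Real.exp_le_exp.2 (by linarith)) (Real.exp_pos _).le (Real.rpow_nonneg (by positivity) _)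
    exact Real.rpow_le_rpow_of_nonpos (by positivity) (by nlinarith [norm_nonneg (F x)]) (by linarith)
  have hsub : Metric.closedBall (0 : ι → ℂ) 2 ⊆ {x : ι → ℂ | ‖x i0‖ ≤ 2} := fun x hx =>
    (norm_le_pi_norm x i0).trans (by simpa using hx)
  set D : ℝ := volume.real (Metric.closedBall (0 : ι → ℂ) 2) + C * C0 / c with hD
  obtain ⟨r0, hr0, hr⟩ := Metric.uniformContinuous_iff.1 ((hcs_rt (ι := ι)).uniformContinuous_of_continuous sm_rt.cont) (1 / (4 * (|D| + 1))) (by positivity)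
  set r := min r0 1 with hrd
  have rpos : 0 < r := lt_min hr0 one_pos
  -- uniform bound
  have key : ∀ η, 0 < η → η ≤ 1 → ∫⁻ x in Metric.ball (0 : ι → ℂ) r, ENNReal.ofReal ((‖F x‖ ^ 2 + η) ^ (-lam)) ≤ ENNReal.ofReal (16 * Real.exp (2 * n) * (C * C0)) := by
    intro η hη hη1
    obtain ⟨e, he, he1, hle⟩ := H η hη hη1
    obtain ⟨h, hh, h12, hi, hb⟩ := hOT i0 F lam η e C0 hF hlam hη he he1 hle
    have sph : ContDiff ℝ ∞ (ph F lam η) := sm_ph hF.sm hη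
    have phc : Continuous (fun x => Real.exp (-ph F lam η x)) := Real.continuous_exp.comp sph.continuous.neg
    have S2 : MeasurableSet {x : ι → ℂ | ‖x i0‖ ≤ 2} := (isClosed_le (continuous_apply i0).norm continuous_const).measurableSet
    have i2 : IntegrableOn (fun x => ‖h x‖ ^ 2) (Metric.closedBall (0 : ι → ℂ) 2) :=
      (hh.sm.cont.norm.pow 2).continuousOn.integrableOn_compact (isCompact_closedBall 0 2)
    have i1 : IntegrableOn (fun x => ‖h x‖) (Metric.closedBall (0 : ι → ℂ) 2) :=
      hh.sm.cont.norm.continuousOn.integrableOn_compact (isCompact_closedBall 0 2)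
    have ic : IntegrableOn (fun x : ι → ℂ => (1 : ℝ)) (Metric.closedBall (0 : ι → ℂ) 2) :=
      continuous_const.continuousOn.integrableOn_compact (isCompact_closedBall 0 2)
    have b2 : ∫ x in Metric.closedBall (0 : ι → ℂ) 2, ‖h x‖ ^ 2 ≤ C * C0 / c := by
      rw [le_div_iff₀ cpos, ← integral_mul_const]
      calc _ ≤ ∫ x in Metric.closedBall (0 : ι → ℂ) 2, ‖h x‖ ^ 2 * Real.exp (-ph F lam η x) :=
            setIntegral_mono_on (i2.mul_const c) (hi.mono_set hsub) measurableSet_closedBall fun x hx =>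
              mul_le_mul_of_nonneg_left (cle η hη hη1 x hx) (by positivity)
        _ ≤ ∫ x in {x : ι → ℂ | ‖x i0‖ ≤ 2}, ‖h x‖ ^ 2 * Real.exp (-ph F lam η x) :=
            setIntegral_mono_set hi (Filter.Eventually.of_forall fun x => by simp only [Pi.zero_apply]; positivity) (Filter.Eventually.of_forall hsub)
        _ ≤ _ := hb
    have b1 : ∫ x in Metric.closedBall (0 : ι → ℂ) 2, ‖h x‖ ≤ D := by
      calc _ ≤ ∫ x in Metric.closedBall (0 : ι → ℂ) 2, (1 + ‖h x‖ ^ 2) := by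
            refine setIntegral_mono_on i1 (ic.add i2) measurableSet_closedBall fun x _ => ?_
            show ‖h x‖ ≤ 1 + ‖h x‖ ^ 2
            nlinarith [sq_nonneg (‖h x‖ - 1)]
        _ = (∫ x in Metric.closedBall (0 : ι → ℂ) 2, (1:ℝ)) + ∫ x in Metric.closedBall (0 : ι → ℂ) 2, ‖h x‖ ^ 2 := integral_add ic i2
        _ ≤ D := by rw [setIntegral_const, smul_eq_mul, mul_one, hD]; linarith
    have low : ∀ x ∈ Metric.ball (0 : ι → ℂ) r, 1 / 4 ≤ ‖h x‖ := by
      intro x hx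
      rw [mem_ball_zero_iff] at hx
      have x1 : ‖x‖ < 1 := hx.trans_le (min_le_right _ _)
      have li : LocallyIntegrable h := hh.sm.cont.locallyIntegrable
      have hd : h x - h 0 = ∫ y, h y * (rt (x - y) - rt (0 - y)) := by
        have a := mol_rt hh x
        have b := mol_rt hh 0
        unfold mol at a b
        calc h x - h 0 = (∫ y, h y * rt (x - y)) - ∫ y, h y * rt (0 - y) := by rw [a, b]
          _ = ∫ y, (h y * rt (x - y) - h y * rt (0 - y)) :=
            (integral_sub (mol_int sm_rt hcs_rt li x) (mol_int sm_rt hcs_rt li 0)).symm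
          _ = _ := by congr 1; ext y; ring
      have hz : ∀ y, y ∉ Metric.closedBall (0 : ι → ℂ) 2 → h y * (rt (x - y) - rt (0 - y)) = 0 := by
        intro y hy
        have hy2 : 2 < ‖y‖ := by simpa using hy
        have z : ∀ w : ι → ℂ, 1 < ‖w‖ → rt w = 0 := by
          intro w hw
          have : rad w = 0 := by
            by_contra hne
            have := rad_supp w hne
            rw [mem_closedBall_zero_iff] at this; linarith
          simp [rt, this]
        rw [z, z, sub_zero, mul_zero]
        · rw [zero_sub, norm_neg]; linarith
        · have := norm_sub_norm_le y x
          rw [norm_sub_rev] at this; linarith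
      have hdle : ‖h x - h 0‖ ≤ 1 / 4 := by
        have s1 : ∫ y, h y * (rt (x - y) - rt (0 - y)) = ∫ y in Metric.closedBall (0 : ι → ℂ) 2, h y * (rt (x - y) - rt (0 - y)) :=
          (setIntegral_eq_integral_of_forall_compl_eq_zero hz).symm
        rw [hd, s1]
        have s2 : ∀ y, ‖h y * (rt (x - y) - rt (0 - y))‖ ≤ ‖h y‖ * (1 / (4 * (|D| + 1))) := by
          intro y
          rw [norm_mul]
          refine mul_le_mul_of_nonneg_left ?_ (norm_nonneg _)
          rw [← dist_eq_norm]
          refine (hr ?_).le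
          rw [dist_eq_norm]
          have : x - y - (0 - y) = x := by abel
          rw [this]; exact hx.trans_le (min_le_left _ _)
        calc _ ≤ ∫ y in Metric.closedBall (0 : ι → ℂ) 2, ‖h y‖ * (1 / (4 * (|D| + 1))) :=
              norm_integral_le_of_norm_le (i1.mul_const _) (Filter.Eventually.of_forall s2)
          _ = (∫ y in Metric.closedBall (0 : ι → ℂ) 2, ‖h y‖) * (1 / (4 * (|D| + 1))) := integral_mul_const _ _
          _ ≤ (|D| + 1) * (1 / (4 * (|D| + 1))) := by
              refine mul_le_mul_of_nonneg_right ?_ (by positivity)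
              linarith [le_abs_self D]
          _ = 1 / 4 := by
              have : |D| + 1 ≠ 0 := by positivity
              field_simp
      have := norm_sub_norm_le (h 0) (h x)
      rw [norm_sub_rev] at this
      linarith
    have hbs : Metric.ball (0 : ι → ℂ) r ⊆ {x : ι → ℂ | ‖x i0‖ ≤ 2} := fun x hx => by
      rw [mem_ball_zero_iff] at hx
      have := norm_le_pi_norm x i0
      have h1 : r ≤ 1 := min_le_right _ _
      show ‖x i0‖ ≤ 2
      linarith
    calc ∫⁻ x in Metric.ball (0 : ι → ℂ) r, ENNReal.ofReal ((‖F x‖ ^ 2 + η) ^ (-lam))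
        ≤ ∫⁻ x in Metric.ball (0 : ι → ℂ) r, ENNReal.ofReal (16 * Real.exp (2 * n) * (‖h x‖ ^ 2 * Real.exp (-ph F lam η x))) := by
          refine setLIntegral_mono' measurableSet_ball fun x hx => ENNReal.ofReal_le_ofReal ?_
          have l1 := low x hx
          have hx1 : ‖x‖ ≤ 1 := by
            rw [mem_ball_zero_iff] at hx
            exact hx.le.trans (min_le_right _ _)
          have l2 := gle x 1 hx1
          rw [exp_ph hη]
          have p1 : 0 ≤ (‖F x‖ ^ 2 + η) ^ (-lam) := Real.rpow_nonneg (by positivity) _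
          have p2 : 1 ≤ Real.exp (2 * n) * Real.exp (-(2 * ∑ i, ‖x i‖ ^ 2)) := by
            rw [← Real.exp_add]; apply Real.one_le_exp; linarith
          have p3 : 1 ≤ 16 * ‖h x‖ ^ 2 := by nlinarith
          have p4 := one_le_mul_of_one_le_of_one_le p3 p2
          calc (‖F x‖ ^ 2 + η) ^ (-lam) ≤ (‖F x‖ ^ 2 + η) ^ (-lam) * (16 * ‖h x‖ ^ 2 * (Real.exp (2 * n) * Real.exp (-(2 * ∑ i, ‖x i‖ ^ 2)))) :=
                le_mul_of_one_le_right p1 p4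
            _ = _ := by ring
      _ ≤ ∫⁻ x in {x : ι → ℂ | ‖x i0‖ ≤ 2}, ENNReal.ofReal (16 * Real.exp (2 * n) * (‖h x‖ ^ 2 * Real.exp (-ph F lam η x))) :=
          lintegral_mono_set hbs
      _ = ENNReal.ofReal (∫ x in {x : ι → ℂ | ‖x i0‖ ≤ 2}, 16 * Real.exp (2 * n) * (‖h x‖ ^ 2 * Real.exp (-ph F lam η x))) :=
          (ofReal_integral_eq_lintegral_ofReal (hi.const_mul _) (Filter.Eventually.of_forall fun x => by
            simp only [Pi.zero_apply]; positivity)).symm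
      _ ≤ _ := by
          refine ENNReal.ofReal_le_ofReal ?_
          rw [integral_const_mul]
          exact mul_le_mul_of_nonneg_left hb (by positivity)
  refine ⟨r, rpos, ?_⟩
  have Fc := hF.sm.cont
  have meas : Measurable (fun x => ‖F x‖ ^ (-(2 * lam))) := Fc.norm.measurable.pow_const _
  refine ⟨meas.aestronglyMeasurable, ?_⟩
  rw [hasFiniteIntegral_iff_ofReal (Filter.Eventually.of_forall fun x => Real.rpow_nonneg (norm_nonneg _) _)]
  set f : ℕ → (ι → ℂ) → ENNReal := fun k x => ENNReal.ofReal ((‖F x‖ ^ 2 + 1 / ((k:ℝ) + 1)) ^ (-lam)) with hf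
  have fm : ∀ k, Measurable (f k) := fun k => ENNReal.measurable_ofReal.comp (((Fc.norm.pow 2).add continuous_const).measurable.pow_const _)
  have lim0 : Filter.Tendsto (fun k : ℕ => 1 / ((k:ℝ) + 1)) Filter.atTop (𝓝 0) := tendsto_one_div_add_atTop_nhds_zero_nat
  have pt : ∀ x, ENNReal.ofReal (‖F x‖ ^ (-(2 * lam))) ≤ Filter.liminf (fun k => f k x) Filter.atTop := by
    intro x
    by_cases h0 : F x = 0
    · rcases hlam.eq_or_lt with hl | hl
      · simp only [hf, ← hl]; simp
      · rw [h0, norm_zero, Real.zero_rpow (by linarith)]; simp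
    · have hp : 0 < ‖F x‖ := norm_pos_iff.2 h0
      have t1 : Filter.Tendsto (fun k : ℕ => (‖F x‖ ^ 2 + 1 / ((k:ℝ) + 1)) ^ (-lam)) Filter.atTop (𝓝 ((‖F x‖ ^ 2 + 0) ^ (-lam))) :=
        (tendsto_const_nhds.add lim0).rpow_const (Or.inl (by positivity))
      have t2 := (ENNReal.tendsto_ofReal t1).liminf_eq
      rw [hf]; simp only
      rw [t2, add_zero]
      apply le_of_eq; congr 1
      rw [← Real.rpow_natCast, ← Real.rpow_mul hp.le]; congr 1; push_cast; ring
  calc _ ≤ ∫⁻ x in Metric.ball (0 : ι → ℂ) r, Filter.liminf (fun k => f k x) Filter.atTop := lintegral_mono pt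
    _ ≤ Filter.liminf (fun k => ∫⁻ x in Metric.ball (0 : ι → ℂ) r, f k x) Filter.atTop := lintegral_liminf_le fm
    _ ≤ Filter.liminf (fun k : ℕ => ENNReal.ofReal (16 * Real.exp (2 * n) * (C * C0))) Filter.atTop :=
        Filter.liminf_le_liminf (Filter.Eventually.of_forall fun k => key _ (by positivity) (by
          rw [div_le_one (by positivity)]; linarith [Nat.cast_nonneg (α := ℝ) k]))
    _ = ENNReal.ofReal (16 * Real.exp (2 * n) * (C * C0)) := Filter.liminf_const _
    _ < ⊤ := ENNReal.ofReal_lt_top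

end OT

namespace OT
set_option linter.all false
open scoped ContDiff ComplexConjugate Convolution Topology
open Complex (I)
variable {ι : Type} [Fintype ι] [DecidableEq ι]

/-- coordinatewise scaling -/
noncomputable def dg {n : ℕ} (a : Fin n → ℂ) : (Fin n → ℂ) →ₗ[ℝ] (Fin n → ℂ) :=
  LinearMap.pi fun i => (LinearMap.mulLeft ℝ (a i)).comp (LinearMap.proj i)

lemma dg_apply {n : ℕ} (a y : Fin n → ℂ) : dg a y = fun i => a i * y i := by
  ext i; simp [dg]

lemma dg_det {n : ℕ} (a : Fin n → ℂ) : LinearMap.det (dg a) = ∏ i, ‖a i‖ ^ 2 := by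
  unfold dg
  rw [LinearMap.det_pi]
  refine Finset.prod_congr rfl fun i _ => ?_
  have := Algebra.norm_complex_apply (a i)
  rw [Algebra.norm_apply] at this
  rw [← Complex.normSq_eq_norm_sq, ← this]
  rfl

lemma lint_dg {n : ℕ} (a : Fin n → ℂ) (ha : ∀ i, a i ≠ 0) {g : (Fin n → ℂ) → ENNReal} (hg : Measurable g) :
    ∫⁻ y, g y = ENNReal.ofReal (∏ i, ‖a i‖ ^ 2) * ∫⁻ y, g (dg a y) := by
  have hP : 0 < ∏ i, ‖a i‖ ^ 2 := Finset.prod_pos fun i _ => by have := norm_pos_iff.2 (ha i); positivity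
  have hdet : LinearMap.det (dg a) ≠ 0 := by rw [dg_det]; exact hP.ne'
  have h := Measure.map_linearMap_addHaar_eq_smul_addHaar (volume : Measure (Fin n → ℂ)) hdet
  have hm : Measurable (dg a) := (LinearMap.continuous_of_finiteDimensional (dg a)).measurable
  rw [← lintegral_map hg hm, h, lintegral_smul_measure, dg_det, smul_eq_mul, ← mul_assoc, abs_of_pos (inv_pos.2 hP),
    ← ENNReal.ofReal_mul hP.le, mul_inv_cancel₀ hP.ne']
  simp

lemma poly_null : ∀ (n : ℕ) (f : MvPolynomial (Fin n) ℂ), f ≠ 0 → ∀ᵐ y : Fin n → ℂ, MvPolynomial.eval y f ≠ 0 := by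
  intro n
  induction n with
  | zero =>
    intro f hf
    refine Filter.Eventually.of_forall fun y hy => hf ?_
    apply MvPolynomial.funext
    intro x
    rw [Subsingleton.elim x y, hy, map_zero]
  | succ n ih =>
    intro f hf
    have hq : MvPolynomial.finSuccEquiv ℂ n f ≠ 0 := by simpa using hf
    obtain ⟨k, hk⟩ := Polynomial.support_nonempty.2 hq
    rw [Polynomial.mem_support_iff] at hk
    have h1 := ih _ hk
    have mp := volume_preserving_piFinSuccAbove (fun _ : Fin (n+1) => ℂ) 0
    have key : ∀ᵐ p : ℂ × (Fin n → ℂ), MvPolynomial.eval (Fin.cons p.1 p.2 : Fin (n+1) → ℂ) f ≠ 0 := by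
      have ms : MeasurableSet {p : ℂ × (Fin n → ℂ) | MvPolynomial.eval (Fin.cons p.1 p.2 : Fin (n+1) → ℂ) f ≠ 0} := by
        apply IsOpen.measurableSet
        apply isOpen_ne_fun _ continuous_const
        have : Continuous fun p : ℂ × (Fin n → ℂ) => (Fin.cons p.1 p.2 : Fin (n+1) → ℂ) := by fun_prop
        exact (MvPolynomial.continuous_eval f).comp this
      rw [Measure.volume_eq_prod]
      have hswap : ∀ᵐ p ∂((volume : Measure (Fin n → ℂ)).prod (volume : Measure ℂ)), MvPolynomial.eval (Fin.cons p.2 p.1 : Fin (n+1) → ℂ) f ≠ 0 := by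
        refine (Measure.ae_prod_mem_iff_ae_ae_mem (s := {p : (Fin n → ℂ) × ℂ | MvPolynomial.eval (Fin.cons p.2 p.1 : Fin (n+1) → ℂ) f ≠ 0}) (measurable_swap ms)).2 ?_
        filter_upwards [h1] with y hy
        have hne : Polynomial.map (MvPolynomial.eval y) (MvPolynomial.finSuccEquiv ℂ n f) ≠ 0 := by
          intro h0
          apply hy
          rw [← Polynomial.coeff_map, h0, Polynomial.coeff_zero]
        have hfin := (Polynomial.map (MvPolynomial.eval y) (MvPolynomial.finSuccEquiv ℂ n f)).rootSet_finite ℂ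
        have : ∀ᵐ t : ℂ, t ∉ {t | (Polynomial.map (MvPolynomial.eval y) (MvPolynomial.finSuccEquiv ℂ n f)).IsRoot t} :=
          measure_eq_zero_iff_ae_notMem.1 ((Polynomial.finite_setOf_isRoot hne).measure_zero _)
        filter_upwards [this] with t ht h0
        apply ht
        show Polynomial.eval _ _ = 0
        rw [← MvPolynomial.eval_eq_eval_mv_eval']; exact h0
      have := (Measure.measurePreserving_swap (μ := (volume : Measure ℂ)) (ν := (volume : Measure (Fin n → ℂ)))).quasiMeasurePreserving.ae hswap
      exact this
    have := mp.quasiMeasurePreserving.ae key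
    filter_upwards [this] with x hx
    convert hx using 2
    congr 1
    ext i
    refine Fin.cases ?_ (fun j => ?_) i <;> rfl

section W
variable {n : ℕ} (c : Fin n → ℕ) (f : MvPolynomial (Fin n) ℂ)

lemma wOrd_le {m : Fin n →₀ ℕ} (hm : m ∈ f.support) : wOrd c f ≤ wDeg c m := Nat.sInf_le ⟨m, hm, rfl⟩
lemma wOrd_mem (hf : f ≠ 0) : ∃ m ∈ f.support, wDeg c m = wOrd c f := by
  obtain ⟨m, hm⟩ := MvPolynomial.support_nonempty.2 hf
  exact Nat.sInf_mem (s := {k | ∃ m ∈ f.support, wDeg c m = k}) ⟨_, m, hm, rfl⟩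

lemma wLowest_ne (hf : f ≠ 0) : wLowest c f ≠ 0 := by
  classical
  obtain ⟨m, hm, hd⟩ := wOrd_mem c f hf
  intro h
  have h2 : MvPolynomial.coeff m (wLowest c f) = MvPolynomial.coeff m f := by
    unfold wLowest
    rw [MvPolynomial.coeff_sum]
    simp only [MvPolynomial.coeff_monomial]
    rw [Finset.sum_ite_eq']
    simp only [Finset.mem_filter, hm, hd]; simp
  rw [h, MvPolynomial.coeff_zero] at h2
  exact (MvPolynomial.mem_support_iff.1 hm) h2.symm

/-- the strict transform -/
noncomputable def Fpoly : (Fin (n+1) → ℂ) → ℂ := fun x =>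
  ∑ m ∈ f.support, MvPolynomial.coeff m f * (x 0 ^ (wDeg c m - wOrd c f) * ∏ i, x i.succ ^ m i)

lemma Fpoly_zero (y : Fin n → ℂ) : Fpoly c f (Fin.cons 0 y) = MvPolynomial.eval y (wLowest c f) := by
  unfold Fpoly wLowest
  rw [map_sum, Finset.sum_filter]
  refine Finset.sum_congr rfl fun m hm => ?_
  have := wOrd_le c f hm
  simp only [Fin.cons_zero, Fin.cons_succ]
  split_ifs with h
  · rw [h, Nat.sub_self, pow_zero, one_mul, MvPolynomial.eval_monomial, Finsupp.prod_fintype _ _ (by simp)]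
  · rw [zero_pow (by omega)]; ring

/-- the weighted torus action -/
def ac (t : ℂ) : Fin n → ℂ := fun i => t ^ c i

lemma Fpoly_eq (t : ℂ) (y : Fin n → ℂ) : MvPolynomial.eval (dg (ac c t) y) f = t ^ wOrd c f * Fpoly c f (Fin.cons t y) := by
  unfold Fpoly
  rw [MvPolynomial.eval_eq', Finset.mul_sum]
  refine Finset.sum_congr rfl fun m hm => ?_
  have := wOrd_le c f hm
  simp only [Fin.cons_zero, Fin.cons_succ, dg_apply, ac]
  have h1 : ∏ i, (t ^ c i * y i) ^ m i = t ^ wDeg c m * ∏ i, y i ^ m i := by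
    unfold wDeg
    rw [← Finset.prod_pow_eq_pow_sum, ← Finset.prod_mul_distrib]
    refine Finset.prod_congr rfl fun i _ => ?_
    rw [mul_pow, ← pow_mul]
  rw [h1]
  have h2 : t ^ wDeg c m = t ^ wOrd c f * t ^ (wDeg c m - wOrd c f) := by rw [← pow_add]; congr 1; omega
  rw [h2]; ring

lemma G_hom (t : ℂ) (y : Fin n → ℂ) : MvPolynomial.eval (dg (ac c t) y) (wLowest c f) = t ^ wOrd c f * MvPolynomial.eval y (wLowest c f) := by
  unfold wLowest
  rw [map_sum, map_sum, Finset.mul_sum]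
  refine Finset.sum_congr rfl fun m hm => ?_
  rw [Finset.mem_filter] at hm
  rw [MvPolynomial.eval_monomial, MvPolynomial.eval_monomial, Finsupp.prod_fintype _ _ (by simp), Finsupp.prod_fintype _ _ (by simp)]
  simp only [dg_apply, ac]
  have h1 : ∏ i, (t ^ c i * y i) ^ m i = t ^ wDeg c m * ∏ i, y i ^ m i := by
    unfold wDeg
    rw [← Finset.prod_pow_eq_pow_sum, ← Finset.prod_mul_distrib]
    refine Finset.prod_congr rfl fun i _ => ?_
    rw [mul_pow, ← pow_mul]
  rw [h1, hm.2]; ring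

lemma cd_Fpoly : Differentiable ℂ (Fpoly c f) := by
  unfold Fpoly; fun_prop
lemma sm_Fpoly : ContDiff ℝ ∞ (Fpoly c f) := by
  unfold Fpoly; fun_prop

lemma prod_ac {t : ℂ} : ∏ i, ‖ac c t i‖ ^ 2 = (‖t‖ ^ 2) ^ (∑ i, c i) := by
  rw [← Finset.prod_pow_eq_pow_sum]
  refine Finset.prod_congr rfl fun i _ => ?_
  rw [ac, norm_pow, ← pow_mul, ← pow_mul, mul_comm]
end W
end OT

namespace OT
set_option linter.all false
open scoped ContDiff ComplexConjugate Convolution Topology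
open Complex (I)
variable {ι : Type} [Fintype ι] [DecidableEq ι]

lemma step {p : ℕ → Prop} (h0 : ¬ p 0) (h : ∃ k, p k) : ∃ k, ¬ p k ∧ p (k + 1) := by
  classical
  by_contra hcon
  push Not at hcon
  obtain ⟨k, hk⟩ := h
  have : ∀ k, ¬ p k := fun k => by
    induction k with
    | zero => exact h0
    | succ k ih => exact hcon k ih
  exact this k hk

section W
variable {n : ℕ} (c : Fin n → ℕ)

/-- weighted polydisc -/
def U (R : ℝ) : Set (Fin n → ℂ) := {y | ∀ i, ‖y i‖ ≤ R ^ c i}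

lemma U_closed (R : ℝ) : IsClosed (U c R) := by
  have : U c R = ⋂ i, {y : Fin n → ℂ | ‖y i‖ ≤ R ^ c i} := by ext y; simp [U]
  rw [this]
  exact isClosed_iInter fun i => isClosed_le (continuous_apply i).norm continuous_const
lemma U_meas (R : ℝ) : MeasurableSet (U c R) := (U_closed c R).measurableSet

lemma U_pre {R R' : ℝ} (hR : 0 < R) : (dg (ac c (R : ℂ))) ⁻¹' (U c (R * R')) = U c R' := by
  ext y
  simp only [U, Set.mem_preimage, Set.mem_setOf_eq, dg_apply, ac, norm_mul, norm_pow, mul_pow, Complex.norm_real, Real.norm_of_nonneg hR.le]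
  exact forall_congr' fun i => mul_le_mul_iff_right₀ (by positivity)

lemma U_one : U c 1 = Metric.closedBall 0 1 := by
  ext y
  simp only [U, Set.mem_setOf_eq, one_pow, mem_closedBall_zero_iff]
  rw [pi_norm_le_iff_of_nonneg zero_le_one]

lemma scale {a s : ℝ} {h : (Fin n → ℂ) → ENNReal} (hm : Measurable h) {R : ℝ} (hR : 0 < R)
    (hh : ∀ y, h (dg (ac c (R : ℂ)) y) = ENNReal.ofReal (R ^ a) * h y) (hs : 2 * ∑ i, (c i : ℝ) + a = s)
    {S : Set (Fin n → ℂ)} (hS : MeasurableSet S) :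
    ∫⁻ y in S, h y = ENNReal.ofReal (R ^ s) * ∫⁻ y in (dg (ac c (R : ℂ))) ⁻¹' S, h y := by
  have hcm : Measurable (dg (ac c (R : ℂ))) := (LinearMap.continuous_of_finiteDimensional _).measurable
  rw [← lintegral_indicator hS, ← lintegral_indicator (hcm hS), lint_dg (ac c (R:ℂ)) (fun i => by simp [ac, hR.ne']) (hm.indicator hS), prod_ac]
  have : ∀ y, S.indicator h (dg (ac c (R : ℂ)) y) = ENNReal.ofReal (R ^ a) * ((dg (ac c (R : ℂ))) ⁻¹' S).indicator h y := by
    intro y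
    by_cases hy : dg (ac c (R : ℂ)) y ∈ S
    · rw [Set.indicator_of_mem hy, Set.indicator_of_mem (show y ∈ (dg (ac c (R : ℂ))) ⁻¹' S from hy), hh]
    · rw [Set.indicator_of_notMem hy, Set.indicator_of_notMem (show y ∉ (dg (ac c (R : ℂ))) ⁻¹' S from hy), mul_zero]
  simp_rw [this]
  rw [lintegral_const_mul _ (hm.indicator (hcm hS)), ← mul_assoc, ← ENNReal.ofReal_mul (by positivity)]
  congr 2
  rw [← hs, Real.rpow_add hR, Complex.norm_real, Real.norm_of_nonneg hR.le, ← pow_mul, ← Real.rpow_natCast]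
  push_cast; rfl

lemma U_fin [NeZero n] (hc : ∀ i, 0 < c i) {a s : ℝ} {h : (Fin n → ℂ) → ENNReal} (hm : Measurable h)
    (hh : ∀ R : ℝ, 0 < R → ∀ y, h (dg (ac c (R : ℂ)) y) = ENNReal.ofReal (R ^ a) * h y) (hs : 2 * ∑ i, (c i : ℝ) + a = s)
    (hs0 : 0 < s) (hJ : ∫⁻ y in U c 1 \ U c (1/2), h y ≠ ⊤) : ∫⁻ y in U c 1, h y ≠ ⊤ := by
  set V : ℕ → Set (Fin n → ℂ) := fun k => U c ((1/2) ^ k) \ U c ((1/2) ^ (k + 1)) with hV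
  have hsub : U c 1 ⊆ {0} ∪ ⋃ k, V k := by
    intro y hy
    by_cases h0 : y = 0
    · left; exact h0
    · right
      obtain ⟨i, hi⟩ := Function.ne_iff.1 h0
      have hi' : 0 < ‖y i‖ := norm_pos_iff.2 hi
      have := step (p := fun k : ℕ => y ∉ U c ((1/2) ^ k)) (by simpa using hy) (by
        obtain ⟨k, hk⟩ := exists_pow_lt_of_lt_one hi' (by norm_num : (1/2 : ℝ) < 1)
        refine ⟨k, fun hyk => ?_⟩
        have h1 := hyk i
        have h2 : ((1/2 : ℝ) ^ k) ^ c i ≤ (1/2) ^ k := pow_le_of_le_one (by positivity) (pow_le_one₀ (by norm_num) (by norm_num)) (hc i).ne'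
        linarith)
      obtain ⟨k, hk1, hk2⟩ := this
      exact Set.mem_iUnion.2 ⟨k, not_not.1 hk1, hk2⟩
  have hVk : ∀ k, ∫⁻ y in V k, h y = ENNReal.ofReal (((1/2 : ℝ) ^ s)) ^ k * ∫⁻ y in U c 1 \ U c (1/2), h y := by
    intro k
    rw [scale c hm (R := (1/2) ^ k) (by positivity) (hh _ (by positivity)) hs ((U_meas c _).diff (U_meas c _)), Set.preimage_diff]
    have e1 : (1/2 : ℝ) ^ k = (1/2) ^ k * 1 := by ring
    have e2 : (1/2 : ℝ) ^ (k + 1) = (1/2) ^ k * (1/2) := by ring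
    rw [e2]
    nth_rewrite 3 [e1]
    rw [U_pre c (by positivity), U_pre c (by positivity), ← ENNReal.ofReal_pow (by positivity), mul_comm, mul_comm, Real.rpow_pow_comm (by norm_num)]
  refine ne_top_of_le_ne_top ?_ (lintegral_mono_set hsub)
  refine ne_top_of_le_ne_top ?_ (lintegral_union_le _ _ _)
  rw [Measure.restrict_singleton]
  have h0 : (volume : Measure (Fin n → ℂ)) {0} = 0 := measure_singleton 0
  rw [h0, zero_smul, lintegral_zero_measure, zero_add]
  refine ne_top_of_le_ne_top ?_ (lintegral_iUnion_le _ _)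
  simp_rw [hVk]
  rw [ENNReal.tsum_mul_right, ENNReal.tsum_geometric]
  refine ENNReal.mul_ne_top ?_ hJ
  rw [ENNReal.inv_ne_top]
  have : ENNReal.ofReal ((1/2 : ℝ) ^ s) < 1 := by
    rw [ENNReal.ofReal_lt_one]; exact Real.rpow_lt_one (by norm_num) (by norm_num) hs0
  exact (tsub_pos_of_lt this).ne'

lemma tail_sum (s : ℝ) (hs0 : 0 < s) : Summable fun k : ℕ => Real.exp (-(2 * 4 ^ k)) * ((2 : ℝ) ^ (k + 1)) ^ s := by
  obtain ⟨N, hN⟩ := exists_nat_ge s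
  refine Summable.of_nonneg_of_le (fun k => by positivity) (fun k => ?_) ((summable_geometric_of_lt_one (by norm_num) (by norm_num : (1/2 : ℝ) < 1)).mul_left (((N+1).factorial : ℝ) * 2 ^ N))
  have h1 : ((2 : ℝ) ^ (k + 1)) ^ s ≤ ((2 : ℝ) ^ (k + 1)) ^ N := by
    rw [← Real.rpow_natCast _ N]
    exact Real.rpow_le_rpow_of_exponent_le (one_le_pow₀ (by norm_num)) hN
  have h2 : (2 ^ k : ℝ) ≤ 2 * 4 ^ k := by
    have : (2 ^ k : ℝ) ≤ 4 ^ k := pow_le_pow_left₀ (by norm_num) (by norm_num) k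
    have : (0 : ℝ) < 4 ^ k := by positivity
    linarith
  have h3 := Real.pow_div_factorial_le_exp (2 ^ k : ℝ) (by positivity) (N + 1)
  have h4 : Real.exp (-(2 * 4 ^ k)) ≤ (N+1).factorial / ((2 : ℝ) ^ k) ^ (N + 1) := by
    rw [Real.exp_neg, ← one_div, div_le_div_iff₀ (Real.exp_pos _) (by positivity)]
    rw [div_le_iff₀ (by positivity)] at h3
    have := Real.exp_le_exp.2 h2
    have hf : (0 : ℝ) ≤ (N+1).factorial := by positivity
    nlinarith
  calc _ ≤ ((N+1).factorial / ((2 : ℝ) ^ k) ^ (N + 1)) * ((2 : ℝ) ^ (k + 1)) ^ N := mul_le_mul h4 h1 (by positivity) (by positivity)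
    _ = _ := by
      rw [one_div, inv_pow, pow_succ, pow_succ, mul_pow]
      field_simp

lemma all_fin (hc : ∀ i, 0 < c i) {a s : ℝ} {h : (Fin n → ℂ) → ENNReal} (hm : Measurable h)
    (hh : ∀ R : ℝ, 0 < R → ∀ y, h (dg (ac c (R : ℂ)) y) = ENNReal.ofReal (R ^ a) * h y) (hs : 2 * ∑ i, (c i : ℝ) + a = s)
    (hs0 : 0 < s) (hJ : ∫⁻ y in U c 1, h y ≠ ⊤) :
    ∫⁻ y, h y * ENNReal.ofReal (Real.exp (-(2 * ∑ i, ‖y i‖ ^ 2))) ≠ ⊤ := by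
  set V : ℕ → Set (Fin n → ℂ) := fun k => U c (2 ^ (k + 1)) \ U c (2 ^ k) with hV
  have hsub : Set.univ ⊆ U c 1 ∪ ⋃ k, V k := by
    intro y _
    by_cases hy : y ∈ U c 1
    · left; exact hy
    · right
      have := step (p := fun k : ℕ => y ∈ U c (2 ^ k)) (by simpa using hy) (by
        obtain ⟨k, hk⟩ := pow_unbounded_of_one_lt ‖y‖ (by norm_num : (1 : ℝ) < 2)
        refine ⟨k, fun i => ?_⟩
        have h1 := norm_le_pi_norm y i
        have h2 : (2 : ℝ) ^ k ≤ ((2 : ℝ) ^ k) ^ c i := le_self_pow₀ (one_le_pow₀ (by norm_num)) (hc i).ne'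
        linarith)
      obtain ⟨k, hk1, hk2⟩ := this
      exact Set.mem_iUnion.2 ⟨k, hk2, hk1⟩
  have hVk : ∀ k, ∫⁻ y in V k, h y * ENNReal.ofReal (Real.exp (-(2 * ∑ i, ‖y i‖ ^ 2))) ≤
      ENNReal.ofReal (Real.exp (-(2 * 4 ^ k)) * ((2 : ℝ) ^ (k + 1)) ^ s) * ∫⁻ y in U c 1, h y := by
    intro k
    calc _ ≤ ∫⁻ y in V k, h y * ENNReal.ofReal (Real.exp (-(2 * 4 ^ k))) := by
          refine setLIntegral_mono' ((U_meas c _).diff (U_meas c _)) fun y hy => ?_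
          gcongr
          obtain ⟨i, hi⟩ := not_forall.1 hy.2
          push Not at hi
          have h2 : (2 : ℝ) ^ k ≤ ((2 : ℝ) ^ k) ^ c i := le_self_pow₀ (one_le_pow₀ (by norm_num)) (hc i).ne'
          have h3 : (2 : ℝ) ^ k ≤ ‖y i‖ := by linarith
          have h4 : (4 : ℝ) ^ k = (2 ^ k) ^ 2 := by rw [← pow_mul, mul_comm, pow_mul]; norm_num
          rw [h4]
          calc _ ≤ ‖y i‖ ^ 2 := pow_le_pow_left₀ (by positivity) h3 2
            _ ≤ _ := Finset.single_le_sum (f := fun i => ‖y i‖ ^ 2) (fun i _ => by positivity) (Finset.mem_univ i)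
      _ = (∫⁻ y in V k, h y) * ENNReal.ofReal (Real.exp (-(2 * 4 ^ k))) := lintegral_mul_const _ hm
      _ ≤ (∫⁻ y in U c (2 ^ (k+1)), h y) * ENNReal.ofReal (Real.exp (-(2 * 4 ^ k))) := by
          gcongr; exact Set.diff_subset
      _ = _ := by
          rw [scale c hm (R := 2 ^ (k+1)) (by positivity) (hh _ (by positivity)) hs (U_meas c _)]
          have e1 : (2 : ℝ) ^ (k+1) = 2 ^ (k+1) * 1 := by ring
          nth_rewrite 3 [e1]
          rw [U_pre c (by positivity), ENNReal.ofReal_mul (by positivity)]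
          ring
  rw [← setLIntegral_univ]
  refine ne_top_of_le_ne_top ?_ (lintegral_mono_set hsub)
  refine ne_top_of_le_ne_top ?_ (lintegral_union_le _ _ _)
  refine ENNReal.add_ne_top.2 ⟨?_, ?_⟩
  · refine ne_top_of_le_ne_top hJ (lintegral_mono fun y => ?_)
    refine mul_le_of_le_one_right' ?_
    rw [ENNReal.ofReal_le_one, Real.exp_le_one_iff]
    have : 0 ≤ ∑ i, ‖y i‖ ^ 2 := Finset.sum_nonneg fun i _ => by positivity
    linarith
  · refine ne_top_of_le_ne_top ?_ (lintegral_iUnion_le _ _)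
    refine ne_top_of_le_ne_top ?_ (ENNReal.tsum_le_tsum hVk)
    rw [ENNReal.tsum_mul_right]
    exact ENNReal.mul_ne_top (tail_sum s hs0).tsum_ofReal_ne_top hJ
end W
end OT

namespace OT
set_option linter.all false
open scoped ContDiff ComplexConjugate Convolution Topology
open Complex (I)
variable {ι : Type} [Fintype ι] [DecidableEq ι]

lemma cons_eq {n : ℕ} : (fun p : ℂ × (Fin n → ℂ) => (Fin.cons p.1 p.2 : Fin (n+1) → ℂ)) = (MeasurableEquiv.piFinSuccAbove (fun _ : Fin (n+1) => ℂ) 0).symm := by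
  ext p i
  refine Fin.cases ?_ (fun j => ?_) i <;> rfl
lemma cons_mp (n : ℕ) : MeasurePreserving (fun p : ℂ × (Fin n → ℂ) => (Fin.cons p.1 p.2 : Fin (n+1) → ℂ)) volume volume := by
  rw [cons_eq]; exact (volume_preserving_piFinSuccAbove (fun _ : Fin (n+1) => ℂ) 0).symm
lemma cons_me (n : ℕ) : MeasurableEmbedding (fun p : ℂ × (Fin n → ℂ) => (Fin.cons p.1 p.2 : Fin (n+1) → ℂ)) := by
  rw [cons_eq]; exact MeasurableEquiv.measurableEmbedding _
lemma cons_cont (n : ℕ) : Continuous (fun p : ℂ × (Fin n → ℂ) => (Fin.cons p.1 p.2 : Fin (n+1) → ℂ)) := by fun_prop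

section W
variable {n : ℕ} (c : Fin n → ℕ)
lemma shell_fin {g : (Fin n → ℂ) → ℝ} (h : ∀ z : Fin n → ℂ, z ≠ 0 → ∃ ε > 0, IntegrableOn g (Metric.ball z ε)) :
    IntegrableOn g (U c 1 \ U c (1/2)) := by
  set O : Set (Fin n → ℂ) := ⋂ i, {y : Fin n → ℂ | ‖y i‖ < (1/2 : ℝ) ^ c i} with hO
  have oO : IsOpen O := isOpen_iInter_of_finite fun i =>
    isOpen_lt (f := fun y : Fin n → ℂ => ‖y i‖) (g := fun _ => (1/2 : ℝ) ^ c i) (continuous_apply i).norm continuous_const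
  have hK : IsCompact (U c 1 \ O) := by rw [U_one]; exact (isCompact_closedBall _ _).diff oO
  have : LocallyIntegrableOn g (U c 1 \ O) := by
    intro z hz
    have hz0 : z ≠ 0 := by
      rintro rfl
      refine hz.2 (Set.mem_iInter.2 fun i => ?_)
      show ‖(0 : ℂ)‖ < _
      rw [norm_zero]; positivity
    obtain ⟨ε, hε, hi⟩ := h z hz0
    exact ⟨_, mem_nhdsWithin_of_mem_nhds (Metric.ball_mem_nhds z hε), hi⟩
  refine (this.integrableOn_isCompact hK).mono_set (Set.diff_subset_diff_right ?_)
  intro y hy i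
  exact (Set.mem_iInter.1 hy i).le

variable (f : MvPolynomial (Fin n) ℂ)

lemma I0_fin [NeZero n] (hc : ∀ i, 0 < c i) {lam : ℝ} (hl : lam * (wOrd c f : ℝ) < ∑ i, (c i : ℝ))
    (h : ∀ z : Fin n → ℂ, z ≠ 0 → ∃ ε > 0, IntegrableOn
        (fun y : Fin n → ℂ => ‖MvPolynomial.eval y (wLowest c f)‖ ^ (-(2 * lam))) (Metric.ball z ε)) :
    ∫⁻ y, ENNReal.ofReal (‖MvPolynomial.eval y (wLowest c f)‖ ^ (-(2 * lam))) * ENNReal.ofReal (Real.exp (-(2 * ∑ i, ‖y i‖ ^ 2))) ≠ ⊤ := by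
  have hm : Measurable fun y => ENNReal.ofReal (‖MvPolynomial.eval y (wLowest c f)‖ ^ (-(2 * lam))) :=
    ENNReal.measurable_ofReal.comp ((MvPolynomial.continuous_eval _).norm.measurable.pow_const _)
  have hh : ∀ R : ℝ, 0 < R → ∀ y, ENNReal.ofReal (‖MvPolynomial.eval (dg (ac c (R : ℂ)) y) (wLowest c f)‖ ^ (-(2 * lam)))
      = ENNReal.ofReal (R ^ (-(2 * lam * wOrd c f))) * ENNReal.ofReal (‖MvPolynomial.eval y (wLowest c f)‖ ^ (-(2 * lam))) := by
    intro R hR y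
    rw [G_hom, norm_mul, norm_pow, Complex.norm_real, Real.norm_of_nonneg hR.le, Real.mul_rpow (by positivity) (norm_nonneg _),
      ENNReal.ofReal_mul (by positivity), ← Real.rpow_natCast, ← Real.rpow_mul hR.le]
    congr 3; ring
  have hs : 2 * ∑ i, (c i : ℝ) + -(2 * lam * wOrd c f) = 2 * (∑ i, (c i : ℝ) - lam * wOrd c f) := by ring
  have hs0 : 0 < 2 * (∑ i, (c i : ℝ) - lam * wOrd c f) := by linarith
  refine all_fin c hc hm hh hs hs0 (U_fin c hc hm hh hs hs0 ?_)
  have := (shell_fin c h).2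
  rw [hasFiniteIntegral_iff_ofReal (Filter.Eventually.of_forall fun x => Real.rpow_nonneg (norm_nonneg _) _)] at this
  exact this.ne

lemma hol_F : Hol (Fpoly c f) := hol_of_cdiff (sm_Fpoly c f) (cd_Fpoly c f)

set_option maxHeartbeats 1000000 in
lemma H_ok (hf : f ≠ 0) {lam : ℝ} (hlam : 0 ≤ lam)
    (hI : ∫⁻ y, ENNReal.ofReal (‖MvPolynomial.eval y (wLowest c f)‖ ^ (-(2 * lam))) * ENNReal.ofReal (Real.exp (-(2 * ∑ i, ‖y i‖ ^ 2))) ≠ ⊤) :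
    ∃ C0 : ℝ, ∀ η, 0 < η → η ≤ 1 → ∃ e, 0 < e ∧ e ≤ 1 ∧
      ∫ x in {x : Fin (n+1) → ℂ | ‖x 0‖ ≤ e}, Real.exp (-ph (Fpoly c f) lam η x) ≤ C0 * e ^ 2 := by
  obtain ⟨L0, hL0⟩ : ∃ L0, L0 = ∫⁻ y, ENNReal.ofReal (‖MvPolynomial.eval y (wLowest c f)‖ ^ (-(2 * lam))) * ENNReal.ofReal (Real.exp (-(2 * ∑ i, ‖y i‖ ^ 2))) := ⟨_, rfl⟩
  rw [← hL0] at hI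
  refine ⟨(L0.toReal + 1) * Real.pi, fun η hη hη1 => ?_⟩
  have Fc : Continuous (Fpoly c f) := (sm_Fpoly c f).continuous
  obtain ⟨q, hq⟩ : ∃ q : ℂ → (Fin n → ℂ) → ℝ, q = fun t y => (‖Fpoly c f (Fin.cons t y)‖ ^ 2 + η) ^ (-lam) * Real.exp (-(2 * ∑ i, ‖y i‖ ^ 2)) := ⟨_, rfl⟩
  have qc : Continuous (fun p : ℂ × (Fin n → ℂ) => q p.1 p.2) := by
    subst hq
    refine Continuous.mul ?_ ?_
    · have hne : ∀ p : ℂ × (Fin n → ℂ), (‖Fpoly c f (Fin.cons p.1 p.2)‖ ^ 2 + η : ℝ) ≠ 0 := fun p => by positivity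
      exact (((Fc.comp (cons_cont n)).norm.pow 2).add continuous_const).rpow_const fun p => Or.inl (hne p)
    · fun_prop
  have q0 : ∀ t y, 0 ≤ q t y := fun t y => by simp only [hq]; positivity
  have qb : ∀ t y, ‖q t y‖ ≤ η ^ (-lam) * Real.exp (-(2 * ∑ i, ‖y i‖ ^ 2)) := by
    intro t y
    rw [Real.norm_of_nonneg (q0 t y)]
    simp only [hq]
    refine mul_le_mul_of_nonneg_right ?_ (Real.exp_pos _).le
    exact Real.rpow_le_rpow_of_nonpos hη (by nlinarith [sq_nonneg ‖Fpoly c f (Fin.cons t y)‖]) (by linarith)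
  have gi : Integrable (fun y : Fin n → ℂ => η ^ (-lam) * Real.exp (-(2 * ∑ i, ‖y i‖ ^ 2))) := gauss_int.const_mul _
  have qcy : ∀ t, Continuous (q t) := fun t => qc.comp (Continuous.prodMk_right t)
  have qi : ∀ t, Integrable (q t) := fun t => gi.mono' (qcy t).aestronglyMeasurable (Filter.Eventually.of_forall (qb t))
  have psc : Continuous (fun t => ∫ y, q t y) := continuous_of_dominated (fun t => (qcy t).aestronglyMeasurable)
    (fun t => Filter.Eventually.of_forall (qb t)) gi (Filter.Eventually.of_forall fun y => qc.comp (Continuous.prodMk_left y))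
  have ps0 : ∫ y, q 0 y ≤ L0.toReal := by
    rw [integral_eq_lintegral_of_nonneg_ae (Filter.Eventually.of_forall (q0 0)) (qcy 0).aestronglyMeasurable]
    refine ENNReal.toReal_mono hI ?_
    rw [hL0]
    refine (lintegral_mono_ae ?_)
    filter_upwards [poly_null n _ (wLowest_ne c f hf)] with y hy
    rw [← ENNReal.ofReal_mul (by positivity)]
    refine ENNReal.ofReal_le_ofReal ?_
    simp only [hq]
    rw [Fpoly_zero]
    refine mul_le_mul_of_nonneg_right ?_ (Real.exp_pos _).le
    have hp : 0 < ‖MvPolynomial.eval y (wLowest c f)‖ := norm_pos_iff.2 hy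
    have : ‖MvPolynomial.eval y (wLowest c f)‖ ^ (-(2 * lam)) = (‖MvPolynomial.eval y (wLowest c f)‖ ^ 2) ^ (-lam) := by
      rw [← Real.rpow_natCast, ← Real.rpow_mul hp.le]; congr 1; push_cast; ring
    rw [this]
    exact Real.rpow_le_rpow_of_nonpos (by positivity) (by linarith) (by linarith)
  have psca : ContinuousAt (fun t => ∫ y, q t y) 0 := psc.continuousAt
  obtain ⟨e0, he0, hball⟩ := Metric.continuousAt_iff.1 psca 1 one_pos
  obtain ⟨e, epos, ele, ele1⟩ : ∃ e : ℝ, 0 < e ∧ e ≤ e0 / 2 ∧ e ≤ 1 := ⟨min (e0 / 2) 1, by positivity, min_le_left _ _, min_le_right _ _⟩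
  refine ⟨e, epos, ele1, ?_⟩
  have psle : ∀ t ∈ Metric.closedBall (0 : ℂ) e, ∫ y, q t y ≤ L0.toReal + 1 := by
    intro t ht
    have h1 : dist t 0 < e0 := by
      have : dist t 0 ≤ e := ht
      linarith
    have h2 := hball h1
    rw [Real.dist_eq] at h2
    linarith [le_abs_self ((∫ y, q t y) - ∫ y, q 0 y)]
  have iph := int_ph (η := η) (lam := lam) (F := Fpoly c f) (sm_Fpoly c f) hlam hη
  obtain ⟨Φ, hΦ⟩ : ∃ Φ : ℂ × (Fin n → ℂ) → ℝ, Φ = fun p => Real.exp (-ph (Fpoly c f) lam η (Fin.cons p.1 p.2)) := ⟨_, rfl⟩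
  have iΦ : Integrable Φ (volume.prod volume) := by
    have := ((cons_mp n).integrable_comp_emb (cons_me n)).2 iph
    rw [hΦ]; exact this
  have e1 : ∫ x in {x : Fin (n+1) → ℂ | ‖x 0‖ ≤ e}, Real.exp (-ph (Fpoly c f) lam η x) = ∫ p in Metric.closedBall (0:ℂ) e ×ˢ Set.univ, Φ p ∂(volume.prod volume) := by
    rw [← (cons_mp n).setIntegral_preimage_emb (cons_me n)]
    have : (fun p : ℂ × (Fin n → ℂ) => (Fin.cons p.1 p.2 : Fin (n+1) → ℂ)) ⁻¹' {x : Fin (n+1) → ℂ | ‖x 0‖ ≤ e} = Metric.closedBall (0:ℂ) e ×ˢ Set.univ := by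
      ext p; simp
    rw [this, hΦ]; rfl
  rw [e1, setIntegral_prod _ iΦ.integrableOn]
  simp only [Measure.restrict_univ]
  have Φ0 : ∀ p, 0 ≤ Φ p := fun p => by rw [hΦ]; exact (Real.exp_pos _).le
  have Φq : ∀ t y, Φ (t, y) ≤ q t y := by
    intro t y
    simp only [hΦ, hq]
    rw [exp_ph hη]
    refine mul_le_mul_of_nonneg_left (Real.exp_le_exp.2 ?_) (by positivity)
    rw [Fin.sum_univ_succ]
    simp only [Fin.cons_zero, Fin.cons_succ]
    nlinarith [sq_nonneg ‖t‖]
  calc _ ≤ ∫ t in Metric.closedBall (0:ℂ) e, (L0.toReal + 1) := by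
        refine setIntegral_mono_on iΦ.integral_prod_left.integrableOn ?_ measurableSet_closedBall fun t ht => ?_
        · exact continuous_const.continuousOn.integrableOn_compact (isCompact_closedBall _ _)
        · refine le_trans ?_ (psle t ht)
          refine integral_mono_of_nonneg (Filter.Eventually.of_forall fun y => Φ0 (t, y)) (qi t) (Filter.Eventually.of_forall fun y => Φq t y)
    _ = _ := by
        rw [setIntegral_const, smul_eq_mul, Measure.real, Complex.volume_closedBall]
        simp [epos.le]; ring

lemma part1 [NeZero n] (hc : ∀ i, 0 < c i) (hf : f ≠ 0) {lam : ℝ} (hlam : 0 ≤ lam) (hl : lam * (wOrd c f : ℝ) < ∑ i, (c i : ℝ))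
    (h : ∀ z : Fin n → ℂ, z ≠ 0 → ∃ ε > 0, IntegrableOn
        (fun y : Fin n → ℂ => ‖MvPolynomial.eval y (wLowest c f)‖ ^ (-(2 * lam))) (Metric.ball z ε)) :
    ∃ ε > 0, IntegrableOn
        (fun y : Fin n → ℂ => ‖MvPolynomial.eval y f‖ ^ (-(2 * lam)))
        (Metric.ball 0 ε) := by
  obtain ⟨C0, hC0⟩ := H_ok c f hf hlam (I0_fin c f hc hl h)
  obtain ⟨r0, hr0, hr⟩ := OT3 0 (hol_F c f) hlam hC0
  set r := min r0 1 with hrd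
  have rpos : 0 < r := lt_min hr0 one_pos
  have hr := hr.mono_set (Metric.ball_subset_ball (min_le_left _ _) : Metric.ball (0 : Fin (n+1) → ℂ) r ⊆ _)
  have hp := ((cons_mp n).integrableOn_comp_preimage (cons_me n)).2 hr
  have hpre : (fun p : ℂ × (Fin n → ℂ) => (Fin.cons p.1 p.2 : Fin (n+1) → ℂ)) ⁻¹' Metric.ball 0 r = Metric.ball 0 r ×ˢ Metric.ball 0 r := by
    ext p
    simp only [Set.mem_preimage, mem_ball_zero_iff, Set.mem_prod]
    rw [pi_norm_lt_iff rpos, pi_norm_lt_iff rpos, Fin.forall_fin_succ]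
    simp
  rw [hpre, Measure.volume_eq_prod, IntegrableOn, ← Measure.prod_restrict] at hp
  have hae := hp.prod_right_ae
  have hne : ∀ᵐ t : ℂ ∂(volume.restrict (Metric.ball 0 r)), t ≠ 0 :=
    ae_restrict_of_ae (measure_eq_zero_iff_ae_notMem.1 (measure_singleton (0:ℂ)))
  have nb : (ae ((volume : Measure ℂ).restrict (Metric.ball 0 r))).NeBot := by
    rw [ae_neBot, Ne, Measure.restrict_eq_zero]
    exact (Metric.measure_ball_pos _ _ rpos).ne'
  obtain ⟨t, ht, ht0, htr⟩ := (hae.and (hne.and (ae_restrict_mem measurableSet_ball))).exists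
  rw [mem_ball_zero_iff] at htr
  have tpos : 0 < ‖t‖ := norm_pos_iff.2 ht0
  have t1 : ‖t‖ ≤ 1 := htr.le.trans (min_le_right _ _)
  have ht' : IntegrableOn (fun y : Fin n → ℂ => ‖Fpoly c f (Fin.cons t y)‖ ^ (-(2 * lam))) (Metric.ball 0 r) := ht
  set ε := r * ‖t‖ ^ (∑ i, c i) with hε
  have εpos : 0 < ε := by positivity
  have hm : Measurable (fun y : Fin n → ℂ => ‖MvPolynomial.eval y f‖ ^ (-(2 * lam))) := (MvPolynomial.continuous_eval _).norm.measurable.pow_const _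
  refine ⟨ε, εpos, hm.aestronglyMeasurable, ?_⟩
  rw [hasFiniteIntegral_iff_ofReal (Filter.Eventually.of_forall fun x => Real.rpow_nonneg (norm_nonneg _) _)]
  have hfin := ht'.2
  rw [hasFiniteIntegral_iff_ofReal (Filter.Eventually.of_forall fun x => Real.rpow_nonneg (norm_nonneg _) _)] at hfin
  have hm3 : Measurable (fun y : Fin n → ℂ => ENNReal.ofReal (‖MvPolynomial.eval y f‖ ^ (-(2*lam)))) := ENNReal.measurable_ofReal.comp hm
  rw [← lintegral_indicator measurableSet_ball, lint_dg (ac c t) (fun i => pow_ne_zero _ ht0) (hm3.indicator measurableSet_ball)]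
  refine ENNReal.mul_lt_top ENNReal.ofReal_lt_top ?_
  refine lt_of_le_of_lt ?_ (ENNReal.mul_lt_top (a := ENNReal.ofReal ((‖t‖ ^ wOrd c f) ^ (-(2 * lam)))) ENNReal.ofReal_lt_top hfin)
  have hm2 : Measurable (fun y : Fin n → ℂ => ENNReal.ofReal (‖Fpoly c f (Fin.cons t y)‖ ^ (-(2 * lam)))) := by
    have : Continuous fun y : Fin n → ℂ => Fpoly c f (Fin.cons t y) := (sm_Fpoly c f).continuous.comp ((cons_cont n).comp (Continuous.prodMk_right t))
    exact ENNReal.measurable_ofReal.comp (this.norm.measurable.pow_const _)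
  rw [← lintegral_const_mul _ hm2, ← lintegral_indicator measurableSet_ball]
  refine lintegral_mono fun y => ?_
  by_cases hy : dg (ac c t) y ∈ Metric.ball (0 : Fin n → ℂ) ε
  · have hyr : y ∈ Metric.ball (0 : Fin n → ℂ) r := by
      rw [mem_ball_zero_iff, pi_norm_lt_iff rpos]
      intro i
      rw [mem_ball_zero_iff, pi_norm_lt_iff εpos] at hy
      have h1 := hy i
      rw [dg_apply, norm_mul, ac, norm_pow] at h1
      have h2 : ‖t‖ ^ (∑ i, c i) ≤ ‖t‖ ^ c i := pow_le_pow_of_le_one tpos.le t1 (Finset.single_le_sum (f := c) (fun i _ => Nat.zero_le _) (Finset.mem_univ i))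
      have h3 : ‖t‖ ^ c i * ‖y i‖ < ‖t‖ ^ c i * r := by
        refine h1.trans_le ?_
        rw [hε, mul_comm]; exact mul_le_mul_of_nonneg_right h2 rpos.le
      exact lt_of_mul_lt_mul_left h3 (by positivity)
    rw [Set.indicator_of_mem hy, Set.indicator_of_mem hyr, Fpoly_eq, norm_mul, norm_pow, Real.mul_rpow (by positivity) (norm_nonneg _),
      ENNReal.ofReal_mul (by positivity)]
  · rw [Set.indicator_of_notMem hy]; exact zero_le

lemma part2 (hc : ∀ i, 0 < c i) (hf : f ≠ 0) {lam : ℝ} (hlam : 0 ≤ lam) (hn : 0 < n) (hl : ∑ i, (c i : ℝ) ≤ lam * (wOrd c f : ℝ))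
    {ε : ℝ} (hε : 0 < ε) (hi : IntegrableOn (fun y : Fin n → ℂ => ‖MvPolynomial.eval y f‖ ^ (-(2 * lam))) (Metric.ball 0 ε)) : False := by
  have Fc : Continuous (Fpoly c f) := (sm_Fpoly c f).continuous
  obtain ⟨M, hM⟩ := (isCompact_closedBall (0 : Fin (n+1) → ℂ) 1).exists_bound_of_continuousOn Fc.continuousOn
  have hm : Measurable (fun y : Fin n → ℂ => ‖MvPolynomial.eval y f‖ ^ (-(2 * lam))) := (MvPolynomial.continuous_eval _).norm.measurable.pow_const _
  set g : (Fin n → ℂ) → ENNReal := fun y => ENNReal.ofReal (‖MvPolynomial.eval y f‖ ^ (-(2 * lam))) with hg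
  have gm : Measurable g := ENNReal.measurable_ofReal.comp hm
  have hfin := hi.2
  rw [hasFiniteIntegral_iff_ofReal (Filter.Eventually.of_forall fun x => Real.rpow_nonneg (norm_nonneg _) _)] at hfin
  set K : ENNReal := ENNReal.ofReal ((|M| + 1) ^ (-(2 * lam))) with hK
  have K0 : 0 < K := ENNReal.ofReal_pos.2 (by positivity)
  have hcm : ∀ R : ℝ, Measurable (dg (ac c (R : ℂ))) := fun R => (LinearMap.continuous_of_finiteDimensional _).measurable
  set P := volume (Metric.closedBall (0 : Fin n → ℂ) 1) with hP
  have P0 : 0 < P := Metric.measure_closedBall_pos _ _ one_pos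
  have Pf : P ≠ ⊤ := measure_closedBall_lt_top.ne
  -- lower bound
  have low : ∀ R : ℝ, 0 < R → R ≤ 1 → K * P ≤ ∫⁻ y in U c R, g y := by
    intro R hR hR1
    have hmm : Measurable (fun y => (U c R).indicator g (dg (ac c (R:ℂ)) y)) := (gm.indicator (U_meas c R)).comp (hcm R)
    rw [← lintegral_indicator (U_meas c R), lint_dg (ac c (R:ℂ)) (fun i => by simp [ac, hR.ne']) (gm.indicator (U_meas c R)), prod_ac, hP,
      ← setLIntegral_const, ← lintegral_indicator measurableSet_closedBall, ← lintegral_const_mul _ hmm]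
    have hRc : (R : ℂ) ≠ 0 := by exact_mod_cast hR.ne'
    have ae1 : ∀ᵐ y : Fin n → ℂ, MvPolynomial.eval (dg (ac c (R:ℂ)) y) f ≠ 0 := by
      have h0 := poly_null n f hf
      have hP : 0 < ∏ i, ‖ac c (R:ℂ) i‖ ^ 2 := by rw [prod_ac]; simp only [Complex.norm_real, Real.norm_of_nonneg hR.le]; positivity
      have hdet : LinearMap.det (dg (ac c (R:ℂ))) ≠ 0 := by rw [dg_det]; exact hP.ne'
      rw [ae_iff] at h0 ⊢
      have := Measure.addHaar_preimage_linearMap (volume : Measure (Fin n → ℂ)) hdet {y | ¬ MvPolynomial.eval y f ≠ 0}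
      rw [h0, mul_zero] at this
      exact this
    refine lintegral_mono_ae ?_
    filter_upwards [ae1] with y hy
    by_cases hy1 : y ∈ Metric.closedBall (0 : Fin n → ℂ) 1
    · have hyU : dg (ac c (R:ℂ)) y ∈ U c R := by
        have : y ∈ U c 1 := by rw [U_one]; exact hy1
        rw [← U_pre c (R := R) (R' := 1) hR, mul_one] at this
        exact this
      rw [Set.indicator_of_mem hy1, Set.indicator_of_mem hyU]
      simp only [hg, hK]
      rw [← ENNReal.ofReal_mul (by positivity)]
      refine ENNReal.ofReal_le_ofReal ?_
      rw [Fpoly_eq] at hy ⊢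
      rw [norm_mul, norm_pow, Complex.norm_real, Real.norm_of_nonneg hR.le, Real.mul_rpow (by positivity) (norm_nonneg _), ← mul_assoc]
      have F0 : 0 < ‖Fpoly c f (Fin.cons (R:ℂ) y)‖ := norm_pos_iff.2 (right_ne_zero_of_mul hy)
      have FM : ‖Fpoly c f (Fin.cons (R:ℂ) y)‖ ≤ |M| + 1 := by
        have := hM (Fin.cons (R:ℂ) y) (by
          rw [mem_closedBall_zero_iff, pi_norm_le_iff_of_nonneg zero_le_one, Fin.forall_fin_succ]
          refine ⟨?_, fun i => ?_⟩
          · simp only [Fin.cons_zero, Complex.norm_real, Real.norm_of_nonneg hR.le]; exact hR1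
          · simp only [Fin.cons_succ]
            exact (norm_le_pi_norm y i).trans (by simpa using hy1))
        linarith [le_abs_self M]
      have a1 : (|M| + 1) ^ (-(2 * lam)) ≤ ‖Fpoly c f (Fin.cons (R:ℂ) y)‖ ^ (-(2 * lam)) :=
        Real.rpow_le_rpow_of_nonpos F0 FM (by linarith)
      have a2 : 1 ≤ (R ^ 2) ^ (∑ i, c i) * (R ^ wOrd c f) ^ (-(2 * lam)) := by
        rw [← pow_mul, ← Real.rpow_natCast, ← Real.rpow_natCast, ← Real.rpow_mul hR.le, ← Real.rpow_add hR]
        refine Real.one_le_rpow_of_pos_of_le_one_of_nonpos hR hR1 ?_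
        push_cast; nlinarith
      calc _ ≤ ‖Fpoly c f (Fin.cons (R:ℂ) y)‖ ^ (-(2 * lam)) := a1
        _ ≤ _ := le_mul_of_one_le_left (by positivity) a2
    · rw [Set.indicator_of_notMem hy1]; exact zero_le
  -- volumes
  have vol : ∀ R : ℝ, 0 < R → volume (U c R) = ENNReal.ofReal ((R ^ 2) ^ (∑ i, c i)) * P := by
    intro R hR
    have hmm : Measurable ((U c R).indicator (fun _ => (1:ENNReal))) := (measurable_const (a := (1:ENNReal))).indicator (U_meas c R)
    rw [← setLIntegral_one, ← lintegral_indicator (U_meas c R), lint_dg (ac c (R:ℂ)) (fun i => by simp [ac, hR.ne']) hmm, prod_ac,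
      Complex.norm_real, Real.norm_of_nonneg hR.le]
    congr 1
    rw [hP, ← U_one c, ← setLIntegral_one, ← lintegral_indicator (U_meas c 1), ← U_pre c (R := R) (R' := 1) hR, mul_one]
    rfl
  have hsub : ∀ R : ℝ, 0 < R → R ≤ 1 → R < ε → U c R ⊆ Metric.ball 0 ε := by
    intro R hR hR1 hRε y hy
    rw [mem_ball_zero_iff, pi_norm_lt_iff hε]
    intro i
    exact ((hy i).trans (pow_le_of_le_one hR.le hR1 (hc i).ne')).trans_lt hRε
  have csum : 0 < ∑ i, c i := Finset.sum_pos (fun i _ => hc i) ⟨⟨0, hn⟩, Finset.mem_univ _⟩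
  set u : ℕ → ℝ := fun k => 1 / ((k:ℝ) + 1) with hu
  have upos : ∀ k, 0 < u k := fun k => by simp only [hu]; positivity
  have u1 : ∀ k, u k ≤ 1 := fun k => by
    simp only [hu]; rw [div_le_one (by positivity)]; linarith [Nat.cast_nonneg (α := ℝ) k]
  have ul : Filter.Tendsto u Filter.atTop (𝓝 0) := tendsto_one_div_add_atTop_nhds_zero_nat
  have vl : Filter.Tendsto ((volume.restrict (Metric.ball 0 ε)) ∘ (fun k => U c (u k))) Filter.atTop (𝓝 0) := by
    have h1 : Filter.Tendsto (fun k => ENNReal.ofReal ((u k ^ 2) ^ (∑ i, c i)) * P) Filter.atTop (𝓝 0) := by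
      have h2 : Filter.Tendsto (fun k => (u k ^ 2) ^ (∑ i, c i)) Filter.atTop (𝓝 0) := by
        have := ((ul.pow 2).pow (∑ i, c i))
        rwa [zero_pow (by norm_num), zero_pow csum.ne'] at this
      have := ENNReal.Tendsto.mul_const (b := P) (ENNReal.tendsto_ofReal h2) (Or.inr Pf)
      simpa using this
    refine tendsto_of_tendsto_of_tendsto_of_le_of_le tendsto_const_nhds h1 (fun k => zero_le) (fun k => ?_)
    show volume.restrict _ _ ≤ _
    rw [← vol _ (upos k)]; exact Measure.restrict_apply_le _ _
  have tz := tendsto_setLIntegral_zero (f := g) hfin.ne vl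
  have ev : ∀ᶠ k in Filter.atTop, ∫⁻ y in U c (u k), g y ∂(volume.restrict (Metric.ball 0 ε)) < K * P :=
    tz.eventually (gt_mem_nhds (by exact ENNReal.mul_pos K0.ne' P0.ne'))
  obtain ⟨k, hk1, hk2⟩ := (ev.and (ul.eventually (gt_mem_nhds hε))).exists
  have hs := hsub _ (upos k) (u1 k) hk2
  rw [Measure.restrict_restrict (U_meas c _), Set.inter_eq_left.2 hs] at hk1
  exact absurd (low _ (upos k) (u1 k)) (not_le.2 hk1)
end W
end OT

/-- Lemma: let `p ∈ X` be a germ of a smooth `n`-fold with local coordinates `x₁, …, xₙ`,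
`D` an effective ℚ-divisor on `X`, and `φ : Y → X` the weighted blowup at `p` with weights
`(c₁, …, cₙ)`, `gcd = 1`, with exceptional divisor `E`.  Then
`lct_p(X; D) ≥ min{ (c₁ + ⋯ + cₙ)/ord_E(D), lct(E, Diff; D̃|_E) }`, and if
`(c₁ + ⋯ + cₙ)/ord_E(D) ≤ lct(E, Diff; D̃|_E)` then equality
`lct_p(X; D) = (c₁ + ⋯ + cₙ)/ord_E(D)` holds.

Formalization via the analytic characterization of log canonicity.  Locally `D = λ · div(f)`
for a nonzero polynomial `f` vanishing at `0`; then `ord_E(D) = λ · wOrd c f`, the restriction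
`D̃|_E` is cut out on `E ≅ ℙ(c₁,…,cₙ)` by the lowest weight part `G = wLowest c f`, and the
pair `(E, Diff + λ D̃|_E)` is klt iff `(ℂⁿ ∖ {0}, λ · div G)` is klt, i.e. iff `‖G‖^(-2λ)`
is locally integrable at every `z ≠ 0` (the different `Diff` accounts exactly for the
quotient singularities of `Y` along `E`).  Thus:
(i) if `λ ≥ 0`, `λ · wOrd c f < ∑ cᵢ` and `‖G‖^(-2λ)` is locally integrable at every
`z ≠ 0`, then `‖f‖^(-2λ)` is integrable near `0`;
(ii) if the hypothesis of (i) on `G` holds for every such `λ` (i.e. `A ≤ B` where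
`A = (∑cᵢ)/wOrd c f` and `B = lct(E, Diff; D̃|_E)`), then for every `λ ≥ 0`, `‖f‖^(-2λ)`
is integrable near `0` iff `λ · wOrd c f < ∑ cᵢ`, i.e. `lct₀ = A`. -/
theorem stmt_13 (n : ℕ) (hn : 0 < n)
    (c : Fin n → ℕ) (hc : ∀ i, 0 < c i) (hgcd : Finset.univ.gcd c = 1)
    (f : MvPolynomial (Fin n) ℂ) (hf0 : f ≠ 0)
    (hp : MvPolynomial.eval (0 : Fin n → ℂ) f = 0) :
    (∀ lam : ℝ, 0 ≤ lam → lam * (wOrd c f : ℝ) < ∑ i, (c i : ℝ) →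
      (∀ z : Fin n → ℂ, z ≠ 0 → ∃ ε > 0, IntegrableOn
        (fun y : Fin n → ℂ => ‖MvPolynomial.eval y (wLowest c f)‖ ^ (-(2 * lam)))
        (Metric.ball z ε)) →
      ∃ ε > 0, IntegrableOn
        (fun y : Fin n → ℂ => ‖MvPolynomial.eval y f‖ ^ (-(2 * lam)))
        (Metric.ball 0 ε)) ∧
    ((∀ lam : ℝ, 0 ≤ lam → lam * (wOrd c f : ℝ) < ∑ i, (c i : ℝ) →
        ∀ z : Fin n → ℂ, z ≠ 0 → ∃ ε > 0, IntegrableOn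
          (fun y : Fin n → ℂ => ‖MvPolynomial.eval y (wLowest c f)‖ ^ (-(2 * lam)))
          (Metric.ball z ε)) →
      ∀ lam : ℝ, 0 ≤ lam →
        ((∃ ε > 0, IntegrableOn
            (fun y : Fin n → ℂ => ‖MvPolynomial.eval y f‖ ^ (-(2 * lam)))
            (Metric.ball 0 ε)) ↔ lam * (wOrd c f : ℝ) < ∑ i, (c i : ℝ))) := by
  have : NeZero n := ⟨hn.ne'⟩
  exact ⟨fun lam h0 hl h => OT.part1 c f hc hf0 h0 hl h,
    fun H lam h0 => ⟨fun ⟨ε, hε, hi⟩ => by_contra fun hn' =>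
      OT.part2 c f hc hf0 h0 hn (not_lt.1 hn') hε hi,
      fun hl => OT.part1 c f hc hf0 h0 hl (H lam h0 hl)⟩⟩
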